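/- Let 𝔸, 𝔹 be generalized algebraic theories, h ≥ 0, and suppose the pair (𝔸,𝔹) is h-derivable. Let X = (x₁:X₁,…,x_m:X_m) ⊢ u : U be derivable in 𝔸 and Y = (y₁:Y₁,…,yₙ:Yₙ) ⊢ v : V be derivable in 𝔹, with ht(X ⊢ u:U) · ht(Y ⊢ v:V) ≤ h+1. Let x, y be variables not occurring in X, Y respectively, and let σ denote the simultaneous substitution [u^U ⊗ y₁^{Y₁} | xy₁, …, u^U ⊗ yₙ^{Yₙ} | xyₙ, x₁^{X₁} ⊗ v^V | x₁y, …, x_m^{X_m} ⊗ v^V | x_my]. Then the judgments X⊗Y ⊢ u^U ⊗ v^V : (U ⊗ V)σ and X⊗Y ⊢ u^U ● v^V : (U ⊗ V)σ are both derivable in 𝔸⊗𝔹. -/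

import Mathlib

set_option linter.unusedVariables false

/-! # Syntax of generalized algebraic theories (following Cartmell / the paper's appendix) -/

namespace GATPaper

/-- A sort-and-term alphabet: a countably infinite set of variables, a set of sort
symbols and a set of term symbols. -/
structure Alphabet : Type 1 where
  Var : Type
  SortSym : Type
  TermSym : Type
  var_infinite : Infinite Var
  var_countable : Countable Var

attribute [instance] Alphabet.var_infinite Alphabet.var_countable

variable {A B : Alphabet}

/-- Term expressions over an alphabet. -/
inductive Expr (A : Alphabet) : Type where
  | var : A.Var → Expr A
  | app : A.TermSym → List (Expr A) → Expr A

/-- Sort expressions: a sort symbol applied to a list of term expressions. -/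
structure SortE (A : Alphabet) : Type where
  head : A.SortSym
  args : List (Expr A)

/-- Occurrence of a variable in a term expression. -/
inductive Occurs (x : A.Var) : Expr A → Prop where
  | var : Occurs x (Expr.var x)
  | app {t : A.TermSym} {es : List (Expr A)} {e : Expr A} :
      e ∈ es → Occurs x e → Occurs x (Expr.app t es)

/-- Occurrence of a variable in a sort expression. -/
def SOccurs (x : A.Var) (U : SortE A) : Prop := ∃ e ∈ U.args, Occurs x e

/-- Simultaneous substitution along a function on variables. -/
def Expr.subst (σ : A.Var → Expr A) : Expr A → Expr A
  | .var x => σ x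
  | .app t es => .app t (es.attach.map fun e => Expr.subst σ e.1)
termination_by e => sizeOf e
decreasing_by
  have := List.sizeOf_lt_of_mem e.2
  simp only [Expr.app.sizeOf_spec]
  omega

def SortE.subst (σ : A.Var → Expr A) (U : SortE A) : SortE A :=
  ⟨U.head, U.args.map (Expr.subst σ)⟩

open Classical in
/-- The function on variables determined by a finite list of substitution pairs
`(zᵢ, uᵢ)` (substituting `uᵢ` for `zᵢ`, first matching pair winning, all other
variables unchanged). -/
noncomputable def lookupV : List (A.Var × Expr A) → A.Var → Expr A
  | [], x => .var x
  | p :: ps, x => if p.1 = x then p.2 else lookupV ps x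

/-- The simultaneous substitution `e[u₁ | z₁, …, u_k | z_k]` where
`ps = [(z₁,u₁),…,(z_k,u_k)]`. -/
noncomputable def Expr.substL (e : Expr A) (ps : List (A.Var × Expr A)) : Expr A :=
  e.subst (lookupV ps)

noncomputable def SortE.substL (U : SortE A) (ps : List (A.Var × Expr A)) : SortE A :=
  U.subst (lookupV ps)

/-- A (pre)context is a finite list of (variable, sort expression) pairs. -/
abbrev PreCtx (A : Alphabet) := List (A.Var × SortE A)

/-- The list of variables of a precontext, as term expressions. -/
def ctxVars (X : PreCtx A) : List (Expr A) := X.map fun p => Expr.var p.1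

/-- The scoping condition of a precontext: the `i`-th sort expression only contains
variables among the first `i` variables. -/
def IsPreCtx (X : PreCtx A) : Prop :=
  ∀ i (hi : i < X.length) (v : A.Var),
    SOccurs v (X[i]'hi).2 → v ∈ (X.take i).map Prod.fst

/-- Substitution pairs sending the variables of `X` to the entries of `f`. -/
def mkSub (X : PreCtx A) (f : List (Expr A)) : List (A.Var × Expr A) :=
  (X.map Prod.fst).zip f

/-- `Xᵢ[f₁ | x₁, …, f_{i-1} | x_{i-1}]` (0-based: the `i`-th sort of `X`
substituted along the first `i` entries of `f`). -/
noncomputable def subPre (X : PreCtx A) (f : List (Expr A)) (i : ℕ) (hi : i < X.length) :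
    SortE A :=
  ((X[i]'hi).2).substL (mkSub (X.take i) (f.take i))

/-- Judgments: context judgments and the four kinds of standard judgments. -/
inductive Judg (A : Alphabet) : Type where
  | ctx (X : PreCtx A)
  | sort (X : PreCtx A) (U : SortE A)
  | term (X : PreCtx A) (u : Expr A) (U : SortE A)
  | sortEq (X : PreCtx A) (U V : SortE A)
  | termEq (X : PreCtx A) (u v : Expr A) (U : SortE A)

/-- The context of a judgment. -/
def Judg.ctxOf : Judg A → PreCtx A
  | .ctx X => X
  | .sort X _ => X
  | .term X _ _ => X
  | .sortEq X _ _ => X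
  | .termEq X _ _ _ => X

/-- The judgment introducing a sort symbol over the context `X`. -/
def introSort (X : PreCtx A) (S : A.SortSym) : Judg A := .sort X ⟨S, ctxVars X⟩

/-- The judgment introducing a term symbol over the context `X`, with sort `U`. -/
def introTerm (X : PreCtx A) (t : A.TermSym) (U : SortE A) : Judg A :=
  .term X (.app t (ctxVars X)) U

/-- A set of axioms is a pretheory if: no axiom is a context judgment, every
axiom's context is a precontext, every sort symbol has a unique introducing sort
axiom and there are no other sort axioms, and likewise for term symbols. -/
structure IsPretheory (Ax : Set (Judg A)) : Prop where
  no_ctx : ∀ X : PreCtx A, Judg.ctx X ∉ Ax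
  wf_ctx : ∀ J ∈ Ax, IsPreCtx J.ctxOf
  sort_intro : ∀ S : A.SortSym, ∃! X : PreCtx A, introSort X S ∈ Ax
  sort_shape : ∀ (X : PreCtx A) (U : SortE A), Judg.sort X U ∈ Ax → U.args = ctxVars X
  term_intro : ∀ t : A.TermSym, ∃! p : PreCtx A × SortE A, introTerm p.1 t p.2 ∈ Ax
  term_shape : ∀ (X : PreCtx A) (u : Expr A) (U : SortE A), Judg.term X u U ∈ Ax →
      ∃ t : A.TermSym, u = Expr.app t (ctxVars X)

/-- One inference step of the paper's system: `Step Ax D J` holds when `J` is the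
conclusion of an instance of one of the sixteen rules all of whose premises
satisfy `D`. -/
inductive Step (Ax : Set (Judg A)) (D : Judg A → Prop) : Judg A → Prop where
  | ctx_nil : Step Ax D (.ctx [])
  | ctx_cons {X : PreCtx A} {U : SortE A} {x : A.Var}
      (hs : D (.sort X U)) (hfresh : ∀ p ∈ X, p.1 ≠ x)
      (hpre : IsPreCtx (X ++ [(x, U)])) :
      Step Ax D (.ctx (X ++ [(x, U)]))
  | s1 {X : PreCtx A} {U : SortE A} (h : D (.sort X U)) : Step Ax D (.sortEq X U U)
  | s2 {X : PreCtx A} {U V : SortE A} (h : D (.sortEq X U V)) : Step Ax D (.sortEq X V U)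
  | s3 {X : PreCtx A} {U V W : SortE A}
      (h1 : D (.sortEq X U V)) (h2 : D (.sortEq X V W)) : Step Ax D (.sortEq X U W)
  | t1 {X : PreCtx A} {u : Expr A} {U : SortE A}
      (h : D (.term X u U)) : Step Ax D (.termEq X u u U)
  | t2 {X : PreCtx A} {u v : Expr A} {U : SortE A}
      (h : D (.termEq X u v U)) : Step Ax D (.termEq X v u U)
  | t3 {X : PreCtx A} {u v w : Expr A} {U : SortE A}
      (h1 : D (.termEq X u v U)) (h2 : D (.termEq X v w U)) : Step Ax D (.termEq X u w U)
  | seqt {X : PreCtx A} {U U' : SortE A} {u : Expr A}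
      (h1 : D (.sortEq X U U')) (h2 : D (.term X u U)) : Step Ax D (.term X u U')
  | seqteq {X : PreCtx A} {U U' : SortE A} {u u' : Expr A}
      (h1 : D (.sortEq X U U')) (h2 : D (.termEq X u u' U))
      (h3 : D (.term X u U')) (h4 : D (.term X u' U')) : Step Ax D (.termEq X u u' U')
  | var {X : PreCtx A} {i : ℕ} (hi : i < X.length)
      (h : D (.sort X (X[i]'hi).2)) :
      Step Ax D (.term X (.var (X[i]'hi).1) (X[i]'hi).2)
  | sA {X : PreCtx A} {U : SortE A} (hax : Judg.sort X U ∈ Ax) (h : D (.ctx X))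
      (hv : ∀ i (hi : i < X.length), D (.term X (.var (X[i]'hi).1) (X[i]'hi).2)) :
      Step Ax D (.sort X U)
  | tA {X : PreCtx A} {u : Expr A} {U : SortE A} (hax : Judg.term X u U ∈ Ax)
      (h : D (.sort X U))
      (hv : ∀ i (hi : i < X.length), D (.term X (.var (X[i]'hi).1) (X[i]'hi).2)) :
      Step Ax D (.term X u U)
  | seqA {X : PreCtx A} {U U' : SortE A} (hax : Judg.sortEq X U U' ∈ Ax)
      (h1 : D (.sort X U)) (h2 : D (.sort X U')) : Step Ax D (.sortEq X U U')
  | teqA {X : PreCtx A} {u u' : Expr A} {U : SortE A} (hax : Judg.termEq X u u' U ∈ Ax)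
      (h1 : D (.term X u U)) (h2 : D (.term X u' U)) : Step Ax D (.termEq X u u' U)
  | sSub {X : PreCtx A} {S : A.SortSym} (hax : introSort X S ∈ Ax)
      {Y : PreCtx A} (hY : IsPreCtx Y) {f : List (Expr A)} (hlen : f.length = X.length)
      (hJ : D (introSort X S)) (hYc : D (.ctx Y))
      (hargs : ∀ i (hi : i < X.length) (hif : i < f.length),
        D (.term Y (f[i]'hif) (subPre X f i hi))) :
      Step Ax D (.sort Y ⟨S, f⟩)
  | tSub {X : PreCtx A} {t : A.TermSym} {U : SortE A} (hax : introTerm X t U ∈ Ax)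
      {Y : PreCtx A} (hY : IsPreCtx Y) {f : List (Expr A)} (hlen : f.length = X.length)
      (hJ : D (introTerm X t U))
      (hU : D (.sort Y (U.substL (mkSub X f))))
      (hargs : ∀ i (hi : i < X.length) (hif : i < f.length),
        D (.term Y (f[i]'hif) (subPre X f i hi))) :
      Step Ax D (.term Y (.app t f) (U.substL (mkSub X f)))
  | seqSub1 {X : PreCtx A} {U U' : SortE A} (hax : Judg.sortEq X U U' ∈ Ax)
      {Y : PreCtx A} (hY : IsPreCtx Y) {f : List (Expr A)} (hlen : f.length = X.length)
      (hJ : D (.sortEq X U U'))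
      (h1 : D (.sort Y (U.substL (mkSub X f)))) (h2 : D (.sort Y (U'.substL (mkSub X f))))
      (hargs : ∀ i (hi : i < X.length) (hif : i < f.length),
        D (.term Y (f[i]'hif) (subPre X f i hi))) :
      Step Ax D (.sortEq Y (U.substL (mkSub X f)) (U'.substL (mkSub X f)))
  | seqSub2 {X : PreCtx A} {S : A.SortSym} (hax : introSort X S ∈ Ax)
      {Y : PreCtx A} (hY : IsPreCtx Y) {f g : List (Expr A)}
      (hlf : f.length = X.length) (hlg : g.length = X.length)
      (hJ : D (introSort X S))
      (h1 : D (.sort Y ⟨S, f⟩)) (h2 : D (.sort Y ⟨S, g⟩))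
      (hargs : ∀ i (hi : i < X.length) (hif : i < f.length) (hig : i < g.length),
        D (.termEq Y (f[i]'hif) (g[i]'hig) (subPre X f i hi))) :
      Step Ax D (.sortEq Y ⟨S, f⟩ ⟨S, g⟩)
  | teqSub1 {X : PreCtx A} {u u' : Expr A} {U : SortE A}
      (hax : Judg.termEq X u u' U ∈ Ax)
      {Y : PreCtx A} (hY : IsPreCtx Y) {f : List (Expr A)} (hlen : f.length = X.length)
      (hJ : D (.termEq X u u' U))
      (h1 : D (.term Y (u.substL (mkSub X f)) (U.substL (mkSub X f))))
      (h2 : D (.term Y (u'.substL (mkSub X f)) (U.substL (mkSub X f))))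
      (hargs : ∀ i (hi : i < X.length) (hif : i < f.length),
        D (.term Y (f[i]'hif) (subPre X f i hi))) :
      Step Ax D (.termEq Y (u.substL (mkSub X f)) (u'.substL (mkSub X f))
        (U.substL (mkSub X f)))
  | teqSub2 {X : PreCtx A} {t : A.TermSym} {U : SortE A} (hax : introTerm X t U ∈ Ax)
      {Y : PreCtx A} (hY : IsPreCtx Y) {f g : List (Expr A)}
      (hlf : f.length = X.length) (hlg : g.length = X.length)
      (hJ : D (introTerm X t U))
      (h1 : D (.term Y (.app t f) (U.substL (mkSub X f))))
      (h2 : D (.term Y (.app t g) (U.substL (mkSub X f))))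
      (hargs : ∀ i (hi : i < X.length) (hif : i < f.length) (hig : i < g.length),
        D (.termEq Y (f[i]'hif) (g[i]'hig) (subPre X f i hi))) :
      Step Ax D (.termEq Y (.app t f) (.app t g) (U.substL (mkSub X f)))

/-- `DerAt Ax n J`: `J` is the conclusion of an inference step in the `n`-th stage
`𝒟ₙ` of the recursive construction of the derivable judgments. -/
def DerAt (Ax : Set (Judg A)) : ℕ → Judg A → Prop
  | 0, _ => False
  | n + 1, J => DerAt Ax n J ∨ Step Ax (DerAt Ax n) J

/-- A judgment is derivable if it is the conclusion of a step of some stage. -/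
def Derivable (Ax : Set (Judg A)) (J : Judg A) : Prop := ∃ n, DerAt Ax n J

/-- The height of a (derivable) judgment: the least stage at which it appears. -/
noncomputable def ht (Ax : Set (Judg A)) (J : Judg A) : ℕ := sInf {n | DerAt Ax n J}

/-- The height of a context: `0` for the empty context, and the height of
`∂X ⊢ Xₙ sort` otherwise. -/
noncomputable def htCtx (Ax : Set (Judg A)) (X : PreCtx A) : ℕ :=
  match X with
  | [] => 0
  | p :: X' =>
      ht Ax (.sort ((p :: X').dropLast) (((p :: X').getLast (List.cons_ne_nil p X')).2))

/-- A generalized algebraic theory: a pretheory all of whose axioms are derivable. -/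
def IsGAT (Ax : Set (Judg A)) : Prop := IsPretheory Ax ∧ ∀ J ∈ Ax, Derivable Ax J

/-- The partial term judgment `X ⊢ u term` is derivable. -/
def DerTerm (Ax : Set (Judg A)) (X : PreCtx A) (u : Expr A) : Prop :=
  ∃ U, Derivable Ax (.term X u U)

/-- The partial term equality judgment `X ⊢ u ≡ v term` is derivable. -/
def DerTermEq (Ax : Set (Judg A)) (X : PreCtx A) (u v : Expr A) : Prop :=
  ∃ U, Derivable Ax (.termEq X u v U)

/-- Height of a derivable partial term judgment: the minimum of the heights of
`X ⊢ u : U` over all `U`. -/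
noncomputable def htTerm (Ax : Set (Judg A)) (X : PreCtx A) (u : Expr A) : ℕ :=
  sInf {n | ∃ U, DerAt Ax n (.term X u U)}

/-- `f` is a context morphism from `X` to `Y`. -/
def IsMor (Ax : Set (Judg A)) (X Y : PreCtx A) (f : List (Expr A)) : Prop :=
  Derivable Ax (.ctx X) ∧ Derivable Ax (.ctx Y) ∧ f.length = Y.length ∧
  ∀ i (hi : i < Y.length) (hif : i < f.length),
    Derivable Ax (.term X (f[i]'hif) (subPre Y f i hi))

/-- The morphism equality `f ≡ g : X → Y` is derivable. -/
def MorEq (Ax : Set (Judg A)) (X Y : PreCtx A) (f g : List (Expr A)) : Prop :=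
  IsMor Ax X Y f ∧ IsMor Ax X Y g ∧
  ∀ i (hi : i < Y.length) (hif : i < f.length) (hig : i < g.length),
    Derivable Ax (.termEq X (f[i]'hif) (g[i]'hig) (subPre Y f i hi))

/-- The context equality `X ≡ Y ctx` is derivable. -/
def CtxEq (Ax : Set (Judg A)) (X Y : PreCtx A) : Prop :=
  X.length = Y.length ∧ Derivable Ax (.ctx X) ∧ Derivable Ax (.ctx Y) ∧
  ∀ i (hX : i < X.length) (hY : i < Y.length),
    Derivable Ax (.sortEq (X.take i) (X[i]'hX).2
      (((Y[i]'hY).2).substL (mkSub (Y.take i) (ctxVars (X.take i)))))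

/-- Height of a context morphism. -/
noncomputable def htMor (Ax : Set (Judg A)) (X Y : PreCtx A) (f : List (Expr A)) : ℕ :=
  max (htCtx Ax X) (max (htCtx Ax Y)
    ((Finset.range Y.length).sup fun i =>
      if h : i < Y.length ∧ i < f.length then
        ht Ax (.term X (f[i]'h.2) (subPre Y f i h.1))
      else 0))

/-- Height of a morphism equality. -/
noncomputable def htMorEq (Ax : Set (Judg A)) (X Y : PreCtx A) (f g : List (Expr A)) : ℕ :=
  max (htMor Ax X Y f) (max (htMor Ax X Y g)
    ((Finset.range Y.length).sup fun i =>
      if h : i < Y.length ∧ i < f.length ∧ i < g.length then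
        ht Ax (.termEq X (f[i]'h.2.1) (g[i]'h.2.2) (subPre Y f i h.1))
      else 0))

/-- The composite `g ∘ f` of tuples of term expressions, where `f : X → Y` and
`g : Y → Z`: the `i`-th entry is `gᵢ[f]`. -/
noncomputable def compMor (Y : PreCtx A) (f g : List (Expr A)) : List (Expr A) :=
  g.map fun e => e.substL (mkSub Y f)

/-- The canonical sort `𝒮(u)` of a term in a context (as a relation). -/
inductive CanonSort (Ax : Set (Judg A)) (X : PreCtx A) : Expr A → SortE A → Prop where
  | var {i : ℕ} (hi : i < X.length) : CanonSort Ax X (.var (X[i]'hi).1) (X[i]'hi).2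
  | app {t : A.TermSym} {f : List (Expr A)} {Xa : PreCtx A} {V : SortE A}
      (hax : introTerm Xa t V ∈ Ax) :
      CanonSort Ax X (.app t f) (V.substL (mkSub Xa f))


/-! ## The tensor product of generalized algebraic theories (§2 of the paper) -/

/-- The tensor product of two sort-and-term alphabets. -/
abbrev Alphabet.tensor (A B : Alphabet) : Alphabet :=
  { Var := A.Var × B.Var
    SortSym := A.SortSym × B.SortSym
    TermSym := (A.SortSym × B.TermSym) ⊕ (A.TermSym × B.SortSym)
    var_infinite := inferInstance
    var_countable := inferInstance }

/-- An input for the tensor term operations `⊗_t`, `●_t`: a derivable term judgment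
`X ⊢ u : U` (notation `u^U`), or an augmented derivable sort judgment
`(X ⊢ U sort, x)` (notation `x^U`), represented with `tm = var x`. -/
structure TArg (A : Alphabet) : Type where
  ctx : PreCtx A
  tm : Expr A
  srt : SortE A

/-- `L` is the lexicographically ordered `m × n` grid whose `(i,j)` entry is `M i j`. -/
def IsGrid {γ : Type} (m n : ℕ) (M : ℕ → ℕ → γ) (L : List γ) : Prop :=
  L.length = m * n ∧
  ∀ i j (hi : i < m) (hj : j < n) (h : i * n + j < L.length), L[i * n + j]'h = M i j

/-- Substitution pairs `[g 1 | x y₁, …, g n | x yₙ]` where the `yⱼ` are the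
variables of `Y`. -/
def pairsR (x : A.Var) (Y : PreCtx B) (g : ℕ → Expr (A.tensor B)) :
    List ((A.tensor B).Var × Expr (A.tensor B)) :=
  (List.finRange Y.length).map fun j => ((x, (Y.get j).1), g j.1)

/-- Substitution pairs `[g 1 | x₁ y, …, g m | x_m y]` where the `xᵢ` are the
variables of `X`. -/
def pairsL (X : PreCtx A) (y : B.Var) (g : ℕ → Expr (A.tensor B)) :
    List ((A.tensor B).Var × Expr (A.tensor B)) :=
  (List.finRange X.length).map fun i => (((X.get i).1, y), g i.1)

variable {A B : Alphabet}

/-- The graph of the tensor term operation on pairs of (augmented sort / term)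
judgments: `TTg TA TB false a b e` means `e = a ⊗_t b` and
`TTg TA TB true a b e` means `e = a ⊗*_t b` (the variant of §8 in which the two
defining substitution formulas for non-variable terms are interchanged). -/
inductive TTg (TA : Set (Judg A)) (TB : Set (Judg B)) :
    Bool → TArg A → TArg B → Expr (A.tensor B) → Prop where
  | varvar {b : Bool} {X : PreCtx A} {U : SortE A} {x : A.Var}
      {Y : PreCtx B} {V : SortE B} {y : B.Var} :
      TTg TA TB b ⟨X, .var x, U⟩ ⟨Y, .var y, V⟩ (.var (x, y))
  | varapp {b : Bool} {X : PreCtx A} {x : A.Var} {S : A.SortSym} {ss : List (Expr A)}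
      {Y : PreCtx B} {t : B.TermSym} {ts : List (Expr B)} {V : SortE B}
      (SS : ℕ → SortE A) (TSf : ℕ → SortE B)
      (hSS : ∀ i (hi : i < ss.length), CanonSort TA X (ss[i]'hi) (SS i))
      (hTS : ∀ j (hj : j < ts.length), CanonSort TB Y (ts[j]'hj) (TSf j))
      (M : ℕ → ℕ → Expr (A.tensor B)) (out : List (Expr (A.tensor B)))
      (hM : ∀ i (hi : i < ss.length), ∀ j (hj : j < ts.length),
          TTg TA TB b ⟨X, ss[i]'hi, SS i⟩ ⟨Y, ts[j]'hj, TSf j⟩ (M i j))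
      (hMx : ∀ j (hj : j < ts.length),
          TTg TA TB b ⟨X, .var x, ⟨S, ss⟩⟩ ⟨Y, ts[j]'hj, TSf j⟩ (M ss.length j))
      (hout : IsGrid (ss.length + 1) ts.length M out) :
      TTg TA TB b ⟨X, .var x, ⟨S, ss⟩⟩ ⟨Y, .app t ts, V⟩ (.app (Sum.inl (S, t)) out)
  | appvar {b : Bool} {X : PreCtx A} {s : A.TermSym} {ss : List (Expr A)} {U : SortE A}
      {Y : PreCtx B} {y : B.Var} {T : B.SortSym} {ts : List (Expr B)}
      (SS : ℕ → SortE A) (TSf : ℕ → SortE B)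
      (hSS : ∀ i (hi : i < ss.length), CanonSort TA X (ss[i]'hi) (SS i))
      (hTS : ∀ j (hj : j < ts.length), CanonSort TB Y (ts[j]'hj) (TSf j))
      (M : ℕ → ℕ → Expr (A.tensor B)) (out : List (Expr (A.tensor B)))
      (hM : ∀ i (hi : i < ss.length), ∀ j (hj : j < ts.length),
          TTg TA TB b ⟨X, ss[i]'hi, SS i⟩ ⟨Y, ts[j]'hj, TSf j⟩ (M i j))
      (hMy : ∀ i (hi : i < ss.length),
          TTg TA TB b ⟨X, ss[i]'hi, SS i⟩ ⟨Y, .var y, ⟨T, ts⟩⟩ (M i ts.length))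
      (hout : IsGrid ss.length (ts.length + 1) M out) :
      TTg TA TB b ⟨X, .app s ss, U⟩ ⟨Y, .var y, ⟨T, ts⟩⟩ (.app (Sum.inr (s, T)) out)
  | appapp_base {X : PreCtx A} {s : A.TermSym} {ss : List (Expr A)} {U : SortE A}
      {Y : PreCtx B} {t : B.TermSym} {ts : List (Expr B)} {V : SortE B} {x : A.Var}
      (hx : ∀ p ∈ X, p.1 ≠ x)
      (e0 : Expr (A.tensor B))
      (h0 : TTg TA TB false ⟨X, .var x, U⟩ ⟨Y, .app t ts, V⟩ e0)
      (g : ℕ → Expr (A.tensor B))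
      (hg : ∀ j (hj : j < Y.length),
          TTg TA TB false ⟨X, .app s ss, U⟩
            ⟨Y.take j, .var (Y[j]'hj).1, (Y[j]'hj).2⟩ (g j)) :
      TTg TA TB false ⟨X, .app s ss, U⟩ ⟨Y, .app t ts, V⟩ (e0.substL (pairsR x Y g))
  | appapp_star {X : PreCtx A} {s : A.TermSym} {ss : List (Expr A)} {U : SortE A}
      {Y : PreCtx B} {t : B.TermSym} {ts : List (Expr B)} {V : SortE B} {y : B.Var}
      (hy : ∀ p ∈ Y, p.1 ≠ y)
      (e0 : Expr (A.tensor B))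
      (h0 : TTg TA TB true ⟨X, .app s ss, U⟩ ⟨Y, .var y, V⟩ e0)
      (g : ℕ → Expr (A.tensor B))
      (hg : ∀ i (hi : i < X.length),
          TTg TA TB true ⟨X.take i, .var (X[i]'hi).1, (X[i]'hi).2⟩
            ⟨Y, .app t ts, V⟩ (g i)) :
      TTg TA TB true ⟨X, .app s ss, U⟩ ⟨Y, .app t ts, V⟩ (e0.substL (pairsL X y g))

/-- The graph of the operation `●_t` (flag `false`), resp. of `●*_t` (flag `true`). -/
inductive TTd (TA : Set (Judg A)) (TB : Set (Judg B)) :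
    Bool → TArg A → TArg B → Expr (A.tensor B) → Prop where
  | varL {b : Bool} {X : PreCtx A} {x : A.Var} {U : SortE A} {bArg : TArg B}
      {e : Expr (A.tensor B)}
      (h : TTg TA TB b ⟨X, .var x, U⟩ bArg e) : TTd TA TB b ⟨X, .var x, U⟩ bArg e
  | varR {b : Bool} {aArg : TArg A} {Y : PreCtx B} {y : B.Var} {V : SortE B}
      {e : Expr (A.tensor B)}
      (h : TTg TA TB b aArg ⟨Y, .var y, V⟩ e) : TTd TA TB b aArg ⟨Y, .var y, V⟩ e
  | appapp_base {X : PreCtx A} {s : A.TermSym} {ss : List (Expr A)} {U : SortE A}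
      {Y : PreCtx B} {t : B.TermSym} {ts : List (Expr B)} {V : SortE B} {y : B.Var}
      (hy : ∀ p ∈ Y, p.1 ≠ y)
      (e0 : Expr (A.tensor B))
      (h0 : TTg TA TB false ⟨X, .app s ss, U⟩ ⟨Y, .var y, V⟩ e0)
      (g : ℕ → Expr (A.tensor B))
      (hg : ∀ i (hi : i < X.length),
          TTg TA TB false ⟨X.take i, .var (X[i]'hi).1, (X[i]'hi).2⟩
            ⟨Y, .app t ts, V⟩ (g i)) :
      TTd TA TB false ⟨X, .app s ss, U⟩ ⟨Y, .app t ts, V⟩ (e0.substL (pairsL X y g))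
  | appapp_star {X : PreCtx A} {s : A.TermSym} {ss : List (Expr A)} {U : SortE A}
      {Y : PreCtx B} {t : B.TermSym} {ts : List (Expr B)} {V : SortE B} {x : A.Var}
      (hx : ∀ p ∈ X, p.1 ≠ x)
      (e0 : Expr (A.tensor B))
      (h0 : TTg TA TB true ⟨X, .var x, U⟩ ⟨Y, .app t ts, V⟩ e0)
      (g : ℕ → Expr (A.tensor B))
      (hg : ∀ j (hj : j < Y.length),
          TTg TA TB true ⟨X, .app s ss, U⟩
            ⟨Y.take j, .var (Y[j]'hj).1, (Y[j]'hj).2⟩ (g j)) :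
      TTd TA TB true ⟨X, .app s ss, U⟩ ⟨Y, .app t ts, V⟩ (e0.substL (pairsR x Y g))

/-- The graph of the tensor sort operation `⊗_s` (resp. `⊗*_s` for flag `true`):
`TSo TA TB b X x U Y y V W` means `W = U^x ⊗ V^y`. -/
inductive TSo (TA : Set (Judg A)) (TB : Set (Judg B)) :
    Bool → PreCtx A → A.Var → SortE A → PreCtx B → B.Var → SortE B →
    SortE (A.tensor B) → Prop where
  | mk {b : Bool} {X : PreCtx A} {x : A.Var} {S : A.SortSym} {ss : List (Expr A)}
      {Y : PreCtx B} {y : B.Var} {T : B.SortSym} {ts : List (Expr B)}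
      (hx : ∀ p ∈ X, p.1 ≠ x) (hy : ∀ p ∈ Y, p.1 ≠ y)
      (SS : ℕ → SortE A) (TSf : ℕ → SortE B)
      (hSS : ∀ i (hi : i < ss.length), CanonSort TA X (ss[i]'hi) (SS i))
      (hTS : ∀ j (hj : j < ts.length), CanonSort TB Y (ts[j]'hj) (TSf j))
      (M : ℕ → ℕ → Expr (A.tensor B)) (out : List (Expr (A.tensor B)))
      (hM : ∀ i (hi : i < ss.length), ∀ j (hj : j < ts.length),
          TTg TA TB b ⟨X, ss[i]'hi, SS i⟩ ⟨Y, ts[j]'hj, TSf j⟩ (M i j))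
      (hMx : ∀ j (hj : j < ts.length),
          TTg TA TB b ⟨X, .var x, ⟨S, ss⟩⟩ ⟨Y, ts[j]'hj, TSf j⟩ (M ss.length j))
      (hMy : ∀ i (hi : i < ss.length),
          TTg TA TB b ⟨X, ss[i]'hi, SS i⟩ ⟨Y, .var y, ⟨T, ts⟩⟩ (M i ts.length))
      (hout : IsGrid (ss.length + 1) (ts.length + 1) M out) :
      TSo TA TB b X x ⟨S, ss⟩ Y y ⟨T, ts⟩ ⟨(S, T), out.dropLast⟩

/-- The tensor precontext `Z = X ⊗ Y`, with entries `xᵢyⱼ : Xᵢ ⊗ Yⱼ` ordered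
lexicographically. -/
def TCtx (TA : Set (Judg A)) (TB : Set (Judg B)) (b : Bool)
    (X : PreCtx A) (Y : PreCtx B) (Z : PreCtx (A.tensor B)) : Prop :=
  Z.length = X.length * Y.length ∧
  ∀ i j (hi : i < X.length) (hj : j < Y.length) (h : i * Y.length + j < Z.length),
    (Z[i * Y.length + j]'h).1 = ((X[i]'hi).1, (Y[j]'hj).1) ∧
    TSo TA TB b (X.take i) (X[i]'hi).1 (X[i]'hi).2
      (Y.take j) (Y[j]'hj).1 (Y[j]'hj).2 (Z[i * Y.length + j]'h).2

/-- The graph of the tensor operation `⊙` on pairs of judgments of the admissible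
kinds of Table 1 (flag `false`), resp. of the interchanged operation `⊙*` of §8
(flag `true`).  `chA` and `chB` are the functions choosing, for each context, a
variable not occurring in it. -/
inductive TJudg (TA : Set (Judg A)) (TB : Set (Judg B))
    (chA : PreCtx A → A.Var) (chB : PreCtx B → B.Var) :
    Bool → Judg A → Judg B → Judg (A.tensor B) → Prop where
  /- sort ⊙ sort -/
  | ss {b : Bool} {X : PreCtx A} {U : SortE A} {Y : PreCtx B} {V : SortE B}
      {Z : PreCtx (A.tensor B)} {W : SortE (A.tensor B)}
      (hZ : TCtx TA TB b (X ++ [(chA X, U)]) (Y ++ [(chB Y, V)]) Z)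
      (hW : TSo TA TB b X (chA X) U Y (chB Y) V W) :
      TJudg TA TB chA chB b (.sort X U) (.sort Y V) (.sort Z.dropLast W)
  /- sort ⊙ term -/
  | st {b : Bool} {X : PreCtx A} {U : SortE A} {Y : PreCtx B} {v : Expr B} {V : SortE B}
      {Z : PreCtx (A.tensor B)} {e : Expr (A.tensor B)} {W : SortE (A.tensor B)}
      {g : ℕ → Expr (A.tensor B)}
      (hZ : TCtx TA TB b (X ++ [(chA X, U)]) Y Z)
      (he : TTg TA TB b ⟨X, .var (chA X), U⟩ ⟨Y, v, V⟩ e)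
      (hW : TSo TA TB b X (chA X) U Y (chB Y) V W)
      (hg : ∀ i (hi : i < X.length),
          TTg TA TB b ⟨X.take i, .var (X[i]'hi).1, (X[i]'hi).2⟩ ⟨Y, v, V⟩ (g i)) :
      TJudg TA TB chA chB b (.sort X U) (.term Y v V)
        (.term Z e (W.substL (pairsL X (chB Y) g)))
  /- term ⊙ sort -/
  | ts {b : Bool} {X : PreCtx A} {u : Expr A} {U : SortE A} {Y : PreCtx B} {V : SortE B}
      {Z : PreCtx (A.tensor B)} {e : Expr (A.tensor B)} {W : SortE (A.tensor B)}
      {g : ℕ → Expr (A.tensor B)}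
      (hZ : TCtx TA TB b X (Y ++ [(chB Y, V)]) Z)
      (he : TTg TA TB b ⟨X, u, U⟩ ⟨Y, .var (chB Y), V⟩ e)
      (hW : TSo TA TB b X (chA X) U Y (chB Y) V W)
      (hg : ∀ j (hj : j < Y.length),
          TTg TA TB b ⟨X, u, U⟩ ⟨Y.take j, .var (Y[j]'hj).1, (Y[j]'hj).2⟩ (g j)) :
      TJudg TA TB chA chB b (.term X u U) (.sort Y V)
        (.term Z e (W.substL (pairsR (chA X) Y g)))
  /- term ⊙ term -/
  | tt {b : Bool} {X : PreCtx A} {u : Expr A} {U : SortE A}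
      {Y : PreCtx B} {v : Expr B} {V : SortE B}
      {Z : PreCtx (A.tensor B)} {e1 e2 : Expr (A.tensor B)} {W : SortE (A.tensor B)}
      {gx gy : ℕ → Expr (A.tensor B)}
      (hZ : TCtx TA TB b X Y Z)
      (he1 : TTg TA TB b ⟨X, u, U⟩ ⟨Y, v, V⟩ e1)
      (he2 : TTd TA TB b ⟨X, u, U⟩ ⟨Y, v, V⟩ e2)
      (hW : TSo TA TB b X (chA X) U Y (chB Y) V W)
      (hgx : ∀ i (hi : i < X.length),
          TTg TA TB b ⟨X.take i, .var (X[i]'hi).1, (X[i]'hi).2⟩ ⟨Y, v, V⟩ (gx i))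
      (hgy : ∀ j (hj : j < Y.length),
          TTg TA TB b ⟨X, u, U⟩ ⟨Y.take j, .var (Y[j]'hj).1, (Y[j]'hj).2⟩ (gy j)) :
      TJudg TA TB chA chB b (.term X u U) (.term Y v V)
        (.termEq Z e1 e2 (W.substL (pairsL X (chB Y) gx ++ pairsR (chA X) Y gy)))
  /- sort ⊙ sort equality -/
  | sseq {b : Bool} {X : PreCtx A} {U : SortE A} {Y : PreCtx B} {V V' : SortE B}
      {Z : PreCtx (A.tensor B)} {W W' : SortE (A.tensor B)}
      (hZ : TCtx TA TB b (X ++ [(chA X, U)]) (Y ++ [(chB Y, V)]) Z)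
      (hW : TSo TA TB b X (chA X) U Y (chB Y) V W)
      (hW' : TSo TA TB b X (chA X) U Y (chB Y) V' W') :
      TJudg TA TB chA chB b (.sort X U) (.sortEq Y V V') (.sortEq Z.dropLast W W')
  /- sort equality ⊙ sort -/
  | seqs {b : Bool} {X : PreCtx A} {U U' : SortE A} {Y : PreCtx B} {V : SortE B}
      {Z : PreCtx (A.tensor B)} {W W' : SortE (A.tensor B)}
      (hZ : TCtx TA TB b (X ++ [(chA X, U)]) (Y ++ [(chB Y, V)]) Z)
      (hW : TSo TA TB b X (chA X) U Y (chB Y) V W)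
      (hW' : TSo TA TB b X (chA X) U' Y (chB Y) V W') :
      TJudg TA TB chA chB b (.sortEq X U U') (.sort Y V) (.sortEq Z.dropLast W W')
  /- sort ⊙ term equality -/
  | steq {b : Bool} {X : PreCtx A} {U : SortE A} {Y : PreCtx B} {v v' : Expr B}
      {V : SortE B} {Z : PreCtx (A.tensor B)} {e e' : Expr (A.tensor B)}
      {W : SortE (A.tensor B)} {g : ℕ → Expr (A.tensor B)}
      (hZ : TCtx TA TB b (X ++ [(chA X, U)]) Y Z)
      (he : TTg TA TB b ⟨X, .var (chA X), U⟩ ⟨Y, v, V⟩ e)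
      (he' : TTg TA TB b ⟨X, .var (chA X), U⟩ ⟨Y, v', V⟩ e')
      (hW : TSo TA TB b X (chA X) U Y (chB Y) V W)
      (hg : ∀ i (hi : i < X.length),
          TTg TA TB b ⟨X.take i, .var (X[i]'hi).1, (X[i]'hi).2⟩ ⟨Y, v, V⟩ (g i)) :
      TJudg TA TB chA chB b (.sort X U) (.termEq Y v v' V)
        (.termEq Z e e' (W.substL (pairsL X (chB Y) g)))
  /- term equality ⊙ sort -/
  | teqs {b : Bool} {X : PreCtx A} {u u' : Expr A} {U : SortE A} {Y : PreCtx B}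
      {V : SortE B} {Z : PreCtx (A.tensor B)} {e e' : Expr (A.tensor B)}
      {W : SortE (A.tensor B)} {g : ℕ → Expr (A.tensor B)}
      (hZ : TCtx TA TB b X (Y ++ [(chB Y, V)]) Z)
      (he : TTg TA TB b ⟨X, u, U⟩ ⟨Y, .var (chB Y), V⟩ e)
      (he' : TTg TA TB b ⟨X, u', U⟩ ⟨Y, .var (chB Y), V⟩ e')
      (hW : TSo TA TB b X (chA X) U Y (chB Y) V W)
      (hg : ∀ j (hj : j < Y.length),
          TTg TA TB b ⟨X, u, U⟩ ⟨Y.take j, .var (Y[j]'hj).1, (Y[j]'hj).2⟩ (g j)) :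
      TJudg TA TB chA chB b (.termEq X u u' U) (.sort Y V)
        (.termEq Z e e' (W.substL (pairsR (chA X) Y g)))
  /- sort equality ⊙ term -/
  | seqt {b : Bool} {X : PreCtx A} {U U' : SortE A} {Y : PreCtx B} {v : Expr B}
      {V : SortE B} {Z : PreCtx (A.tensor B)} {e e' : Expr (A.tensor B)}
      {W : SortE (A.tensor B)} {g : ℕ → Expr (A.tensor B)}
      (hZ : TCtx TA TB b (X ++ [(chA X, U)]) Y Z)
      (he : TTg TA TB b ⟨X, .var (chA X), U⟩ ⟨Y, v, V⟩ e)
      (he' : TTg TA TB b ⟨X, .var (chA X), U'⟩ ⟨Y, v, V⟩ e')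
      (hW : TSo TA TB b X (chA X) U Y (chB Y) V W)
      (hg : ∀ i (hi : i < X.length),
          TTg TA TB b ⟨X.take i, .var (X[i]'hi).1, (X[i]'hi).2⟩ ⟨Y, v, V⟩ (g i)) :
      TJudg TA TB chA chB b (.sortEq X U U') (.term Y v V)
        (.termEq Z e e' (W.substL (pairsL X (chB Y) g)))
  /- term ⊙ sort equality -/
  | tseq {b : Bool} {X : PreCtx A} {u : Expr A} {U : SortE A} {Y : PreCtx B}
      {V V' : SortE B} {Z : PreCtx (A.tensor B)} {e e' : Expr (A.tensor B)}
      {W : SortE (A.tensor B)} {g : ℕ → Expr (A.tensor B)}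
      (hZ : TCtx TA TB b X (Y ++ [(chB Y, V)]) Z)
      (he : TTg TA TB b ⟨X, u, U⟩ ⟨Y, .var (chB Y), V⟩ e)
      (he' : TTg TA TB b ⟨X, u, U⟩ ⟨Y, .var (chB Y), V'⟩ e')
      (hW : TSo TA TB b X (chA X) U Y (chB Y) V W)
      (hg : ∀ j (hj : j < Y.length),
          TTg TA TB b ⟨X, u, U⟩ ⟨Y.take j, .var (Y[j]'hj).1, (Y[j]'hj).2⟩ (g j)) :
      TJudg TA TB chA chB b (.term X u U) (.sortEq Y V V')
        (.termEq Z e e' (W.substL (pairsR (chA X) Y g)))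

/-- A choice, for every precontext, of a variable not contained in it. -/
def FreshCh {A : Alphabet} (ch : PreCtx A → A.Var) : Prop :=
  ∀ X : PreCtx A, ∀ p ∈ X, p.1 ≠ ch X

/-- The set of axioms of the pretheory `𝔸 ⊗ 𝔹`: the judgments `J ⊙ J'` for `J` an
axiom of `𝔸` and `J'` an axiom of `𝔹`. -/
def tensorAx (TA : Set (Judg A)) (TB : Set (Judg B))
    (chA : PreCtx A → A.Var) (chB : PreCtx B → B.Var) : Set (Judg (A.tensor B)) :=
  {K | ∃ J J', J ∈ TA ∧ J' ∈ TB ∧ TJudg TA TB chA chB false J J' K}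

/-- The pair `(𝔸, 𝔹)` is `h`-derivable: `J ⊙ J'` is derivable in the pretheory
`𝔸 ⊗ 𝔹` whenever `J`, `J'` are derivable judgments of `𝔸`, `𝔹` (of admissible
kinds) with `ht J * ht J' ≤ h`. -/
def hDerivable (TA : Set (Judg A)) (TB : Set (Judg B))
    (chA : PreCtx A → A.Var) (chB : PreCtx B → B.Var) (h : ℕ) : Prop :=
  ∀ (J : Judg A) (J' : Judg B) (K : Judg (A.tensor B)),
    Derivable TA J → Derivable TB J' → ht TA J * ht TB J' ≤ h →
    TJudg TA TB chA chB false J J' K → Derivable (tensorAx TA TB chA chB) K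

/-- The tensor `out = f ⊗ g` of two tuples of derivable terms, each entry being
the tensor of terms taken at their canonical sorts, ordered lexicographically. -/
def TMor (TA : Set (Judg A)) (TB : Set (Judg B)) (b : Bool)
    (X : PreCtx A) (f : List (Expr A)) (Y : PreCtx B) (g : List (Expr B))
    (out : List (Expr (A.tensor B))) : Prop :=
  out.length = f.length * g.length ∧
  ∀ i j (hi : i < f.length) (hj : j < g.length) (h : i * g.length + j < out.length),
    ∃ U V, CanonSort TA X (f[i]'hi) U ∧ CanonSort TB Y (g[j]'hj) V ∧
      TTg TA TB b ⟨X, f[i]'hi, U⟩ ⟨Y, g[j]'hj, V⟩ (out[i * g.length + j]'h)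

/-- The tensor `out = f ⊗ Y` of a tuple of derivable terms of `𝔸` with a context
of `𝔹`: entries `fᵢ^{𝒮(fᵢ)} ⊗ yⱼ^{Yⱼ}`. -/
def TMorCtx (TA : Set (Judg A)) (TB : Set (Judg B)) (b : Bool)
    (X : PreCtx A) (f : List (Expr A)) (Y : PreCtx B)
    (out : List (Expr (A.tensor B))) : Prop :=
  out.length = f.length * Y.length ∧
  ∀ i j (hi : i < f.length) (hj : j < Y.length) (h : i * Y.length + j < out.length),
    ∃ U, CanonSort TA X (f[i]'hi) U ∧
      TTg TA TB b ⟨X, f[i]'hi, U⟩ ⟨Y.take j, .var (Y[j]'hj).1, (Y[j]'hj).2⟩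
        (out[i * Y.length + j]'h)

/-- The tensor `out = X ⊗ g` of a context of `𝔸` with a tuple of derivable terms
of `𝔹`: entries `xᵢ^{Xᵢ} ⊗ gⱼ^{𝒮(gⱼ)}`. -/
def TCtxMor (TA : Set (Judg A)) (TB : Set (Judg B)) (b : Bool)
    (X : PreCtx A) (Y : PreCtx B) (g : List (Expr B))
    (out : List (Expr (A.tensor B))) : Prop :=
  out.length = X.length * g.length ∧
  ∀ i j (hi : i < X.length) (hj : j < g.length) (h : i * g.length + j < out.length),
    ∃ V, CanonSort TB Y (g[j]'hj) V ∧
      TTg TA TB b ⟨X.take i, .var (X[i]'hi).1, (X[i]'hi).2⟩ ⟨Y, g[j]'hj, V⟩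
        (out[i * g.length + j]'h)

/-- The tensor `out = (x₁,…,x_m,u^U) ⊗ Y` of the section determined by a term
`X ⊢ u : U` with a context of `𝔹`. -/
def TSecL (TA : Set (Judg A)) (TB : Set (Judg B)) (b : Bool)
    (X : PreCtx A) (u : Expr A) (U : SortE A) (Y : PreCtx B)
    (out : List (Expr (A.tensor B))) : Prop :=
  out.length = (X.length + 1) * Y.length ∧
  (∀ i j (hi : i < X.length) (hj : j < Y.length) (h : i * Y.length + j < out.length),
      TTg TA TB b ⟨X.take i, .var (X[i]'hi).1, (X[i]'hi).2⟩
        ⟨Y.take j, .var (Y[j]'hj).1, (Y[j]'hj).2⟩ (out[i * Y.length + j]'h)) ∧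
  (∀ j (hj : j < Y.length) (h : X.length * Y.length + j < out.length),
      TTg TA TB b ⟨X, u, U⟩ ⟨Y.take j, .var (Y[j]'hj).1, (Y[j]'hj).2⟩
        (out[X.length * Y.length + j]'h))

/-- The tensor `out = X ⊗ (y₁,…,yₙ,v^V)` of a context of `𝔸` with the section
determined by a term `Y ⊢ v : V` of `𝔹`. -/
def TSecR (TA : Set (Judg A)) (TB : Set (Judg B)) (b : Bool)
    (X : PreCtx A) (Y : PreCtx B) (v : Expr B) (V : SortE B)
    (out : List (Expr (A.tensor B))) : Prop :=
  out.length = X.length * (Y.length + 1) ∧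
  (∀ i j (hi : i < X.length) (hj : j < Y.length)
      (h : i * (Y.length + 1) + j < out.length),
      TTg TA TB b ⟨X.take i, .var (X[i]'hi).1, (X[i]'hi).2⟩
        ⟨Y.take j, .var (Y[j]'hj).1, (Y[j]'hj).2⟩ (out[i * (Y.length + 1) + j]'h)) ∧
  (∀ i (hi : i < X.length) (h : i * (Y.length + 1) + Y.length < out.length),
      TTg TA TB b ⟨X.take i, .var (X[i]'hi).1, (X[i]'hi).2⟩ ⟨Y, v, V⟩
        (out[i * (Y.length + 1) + Y.length]'h))

section

/-! ### Substitution and occurrence of variables -/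

theorem Expr.induct {P : Expr A → Prop} (hv : ∀ x, P (.var x))
    (ha : ∀ t es, (∀ e ∈ es, P e) → P (.app t es)) : ∀ e, P e
  | .var x => hv x
  | .app t es => ha t es fun e _ => Expr.induct hv ha e
termination_by e => sizeOf e
decreasing_by
  have := List.sizeOf_lt_of_mem ‹_›
  simp only [Expr.app.sizeOf_spec]
  omega

@[simp] theorem Expr.subst_var (σ : A.Var → Expr A) (x : A.Var) :
    (Expr.var x).subst σ = σ x := by
  rw [Expr.subst]

@[simp] theorem Expr.subst_app (σ : A.Var → Expr A) (t : A.TermSym) (es : List (Expr A)) :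
    (Expr.app t es).subst σ = .app t (es.map (Expr.subst σ)) := by
  rw [Expr.subst]
  simp

@[simp] theorem occurs_var {x y : A.Var} : Occurs x (.var y) ↔ x = y :=
  ⟨fun h => by cases h; rfl, fun h => h ▸ .var⟩

@[simp] theorem occurs_app {x : A.Var} {t : A.TermSym} {es : List (Expr A)} :
    Occurs x (.app t es) ↔ ∃ e ∈ es, Occurs x e :=
  ⟨fun h => by cases h with | app h1 h2 => exact ⟨_, h1, h2⟩,
    fun ⟨_, h1, h2⟩ => .app h1 h2⟩

theorem Expr.subst_congr {σ τ : A.Var → Expr A} (e : Expr A)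
    (h : ∀ v, Occurs v e → σ v = τ v) : e.subst σ = e.subst τ := by
  induction e using Expr.induct with
  | hv x => simpa using h x .var
  | ha t es ih =>
    simp only [Expr.subst_app, Expr.app.injEq, true_and]
    exact List.map_congr_left fun e he => ih e he fun v hv => h v (.app he hv)

theorem Expr.subst_subst (σ τ : A.Var → Expr A) (e : Expr A) :
    (e.subst σ).subst τ = e.subst fun v => (σ v).subst τ := by
  induction e using Expr.induct with
  | hv x => simp
  | ha t es ih =>
    simp only [Expr.subst_app, List.map_map, Expr.app.injEq, true_and]
    exact List.map_congr_left fun e he => ih e he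

theorem Expr.subst_id (e : Expr A) : e.subst .var = e := by
  induction e using Expr.induct with
  | hv x => simp
  | ha t es ih =>
    simp only [Expr.subst_app, Expr.app.injEq, true_and]
    exact (List.map_congr_left ih).trans (List.map_id _)

theorem Expr.subst_eq_self {σ : A.Var → Expr A} (e : Expr A)
    (h : ∀ v, Occurs v e → σ v = .var v) : e.subst σ = e :=
  (e.subst_congr h).trans e.subst_id

theorem Occurs.of_subst {σ : A.Var → Expr A} {v : A.Var} {e : Expr A}
    (h : Occurs v (e.subst σ)) : ∃ w, Occurs w e ∧ Occurs v (σ w) := by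
  induction e using Expr.induct with
  | hv x => exact ⟨x, .var, by simpa using h⟩
  | ha t es ih =>
    simp only [Expr.subst_app, occurs_app, List.mem_map] at h
    obtain ⟨_, ⟨e, he, rfl⟩, hv⟩ := h
    obtain ⟨w, hw, hw'⟩ := ih e he hv
    exact ⟨w, .app he hw, hw'⟩

theorem SortE.subst_congr {σ τ : A.Var → Expr A} (U : SortE A)
    (h : ∀ v, SOccurs v U → σ v = τ v) : U.subst σ = U.subst τ := by
  simp only [SortE.subst, SortE.mk.injEq, true_and]
  exact List.map_congr_left fun e he => e.subst_congr fun v hv => h v ⟨e, he, hv⟩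

theorem SortE.subst_subst (σ τ : A.Var → Expr A) (U : SortE A) :
    (U.subst σ).subst τ = U.subst fun v => (σ v).subst τ := by
  simp only [SortE.subst, List.map_map, SortE.mk.injEq, true_and]
  exact List.map_congr_left fun e _ => e.subst_subst σ τ

theorem SortE.subst_eq_self {σ : A.Var → Expr A} (U : SortE A)
    (h : ∀ v, SOccurs v U → σ v = .var v) : U.subst σ = U := by
  obtain ⟨S, ss⟩ := U
  simp only [SortE.subst, SortE.mk.injEq, true_and]
  refine (List.map_congr_left fun e he => ?_).trans (List.map_id _)
  exact e.subst_eq_self fun v hv => h v ⟨e, he, hv⟩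

/-! ### Lookup in lists of substitution pairs -/

theorem lookupV_of_notMem {ps : List (A.Var × Expr A)} {v : A.Var}
    (h : v ∉ ps.map Prod.fst) : lookupV ps v = .var v := by
  induction ps with
  | nil => rfl
  | cons p ps ih =>
    simp only [List.map_cons, List.mem_cons, not_or] at h
    rw [lookupV, if_neg (Ne.symm h.1), ih h.2]

theorem lookupV_mem {ps : List (A.Var × Expr A)} {v : A.Var}
    (h : v ∈ ps.map Prod.fst) : (v, lookupV ps v) ∈ ps := by
  induction ps with
  | nil => simp at h
  | cons p ps ih =>
    rw [lookupV]
    split_ifs with hp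
    · subst hp; exact List.mem_cons_self
    · simp only [List.map_cons, List.mem_cons] at h
      exact List.mem_cons_of_mem _ (ih (h.resolve_left (Ne.symm hp)))

theorem lookupV_append_of_mem {ps qs : List (A.Var × Expr A)} {v : A.Var}
    (h : v ∈ ps.map Prod.fst) : lookupV (ps ++ qs) v = lookupV ps v := by
  induction ps with
  | nil => simp at h
  | cons p ps ih =>
    rw [List.cons_append, lookupV, lookupV]
    split_ifs with hp
    · rfl
    · simp only [List.map_cons, List.mem_cons] at h
      exact ih (h.resolve_left (Ne.symm hp))

theorem lookupV_append_of_notMem {ps qs : List (A.Var × Expr A)} {v : A.Var}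
    (h : v ∉ ps.map Prod.fst) : lookupV (ps ++ qs) v = lookupV qs v := by
  induction ps with
  | nil => rfl
  | cons p ps ih =>
    simp only [List.map_cons, List.mem_cons, not_or] at h
    rw [List.cons_append, lookupV, if_neg (Ne.symm h.1), ih h.2]

/-- The variables declared by a precontext. -/
abbrev keys (X : PreCtx A) : List A.Var := X.map Prod.fst

theorem lookupV_mkSub_map {X : PreCtx A} {f : List (Expr A)} (hl : f.length = X.length)
    (ρ : A.Var → Expr A) {v : A.Var} (hv : v ∈ keys X) :
    lookupV (mkSub X (f.map (Expr.subst ρ))) v = (lookupV (mkSub X f) v).subst ρ := by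
  induction X generalizing f with
  | nil => simp at hv
  | cons p X ih =>
    cases f with
    | nil => simp at hl
    | cons e f =>
      simp only [mkSub, List.map_cons, List.zip_cons_cons, lookupV]
      split_ifs with hp
      · rfl
      · simp only [List.map_cons, List.mem_cons] at hv
        exact ih (by simpa using hl) (hv.resolve_left (Ne.symm hp))

theorem lookupV_mkSub_self {X : PreCtx A} (ρ : A.Var → Expr A) {v : A.Var}
    (hv : v ∈ keys X) : lookupV (mkSub X (X.map fun p => ρ p.1)) v = ρ v := by
  induction X with
  | nil => simp at hv
  | cons p X ih =>
    simp only [mkSub, List.map_cons, List.zip_cons_cons, lookupV]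
    split_ifs with hp
    · rw [hp]
    · simp only [List.map_cons, List.mem_cons] at hv
      exact ih (hv.resolve_left (Ne.symm hp))

/-- Every variable of the term expression is declared by the precontext. -/
def ScopedE (X : PreCtx A) (e : Expr A) : Prop := ∀ v, Occurs v e → v ∈ keys X

/-- Every variable of the sort expression is declared by the precontext. -/
def ScopedS (X : PreCtx A) (U : SortE A) : Prop := ∀ v, SOccurs v U → v ∈ keys X

theorem ScopedE.substL_map {X : PreCtx A} {e : Expr A} (h : ScopedE X e)
    {f : List (Expr A)} (hl : f.length = X.length) (ρ : A.Var → Expr A) :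
    (e.substL (mkSub X f)).subst ρ = e.substL (mkSub X (f.map (Expr.subst ρ))) := by
  rw [Expr.substL, Expr.subst_subst]
  exact e.subst_congr fun v hv => (lookupV_mkSub_map hl ρ (h v hv)).symm

theorem ScopedS.substL_map {X : PreCtx A} {U : SortE A} (h : ScopedS X U)
    {f : List (Expr A)} (hl : f.length = X.length) (ρ : A.Var → Expr A) :
    (U.substL (mkSub X f)).subst ρ = U.substL (mkSub X (f.map (Expr.subst ρ))) := by
  rw [SortE.substL, SortE.subst_subst]
  exact U.subst_congr fun v hv => (lookupV_mkSub_map hl ρ (h v hv)).symm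

theorem ScopedE.substL_self {X : PreCtx A} {e : Expr A} (h : ScopedE X e)
    (ρ : A.Var → Expr A) : e.substL (mkSub X (X.map fun p => ρ p.1)) = e.subst ρ :=
  e.subst_congr fun v hv => lookupV_mkSub_self ρ (h v hv)

theorem ScopedS.substL_self {X : PreCtx A} {U : SortE A} (h : ScopedS X U)
    (ρ : A.Var → Expr A) : U.substL (mkSub X (X.map fun p => ρ p.1)) = U.subst ρ :=
  U.subst_congr fun v hv => lookupV_mkSub_self ρ (h v hv)

theorem IsPreCtx.scoped {X : PreCtx A} (hX : IsPreCtx X) {i : ℕ} (hi : i < X.length) :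
    ScopedS (X.take i) (X[i]'hi).2 := hX i hi

theorem keys_take_subset (X : PreCtx A) (i : ℕ) {v : A.Var} (h : v ∈ keys (X.take i)) :
    v ∈ keys X := by
  rw [keys, List.map_take] at h
  exact List.mem_of_mem_take h

theorem subPre_map {X : PreCtx A} (hX : IsPreCtx X) {f : List (Expr A)}
    (hl : f.length = X.length) {i : ℕ} (hi : i < X.length) (ρ : A.Var → Expr A) :
    (subPre X f i hi).subst ρ = subPre X (f.map (Expr.subst ρ)) i hi := by
  rw [subPre, subPre, (hX.scoped hi).substL_map (by simp [hl]), List.map_take]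

theorem subPre_self {X : PreCtx A} (hX : IsPreCtx X) {i : ℕ} (hi : i < X.length)
    (ρ : A.Var → Expr A) :
    subPre X (X.map fun p => ρ p.1) i hi = (X[i]'hi).2.subst ρ := by
  rw [subPre, ← List.map_take, (hX.scoped hi).substL_self]

theorem mem_ctxVars {X : PreCtx A} {e : Expr A} (h : e ∈ ctxVars X) : ScopedE X e := by
  intro v hv
  simp only [ctxVars, List.mem_map] at h
  obtain ⟨p, hp, rfl⟩ := h
  rw [occurs_var] at hv
  exact hv ▸ List.mem_map_of_mem hp

theorem map_subst_ctxVars (X : PreCtx A) (ρ : A.Var → Expr A) :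
    (ctxVars X).map (Expr.subst ρ) = X.map fun p => ρ p.1 := by
  simp [ctxVars, Function.comp_def]

/-! ### Derivations -/

theorem DerAt.mono {Ax : Set (Judg A)} {J : Judg A} {n m : ℕ} (h : DerAt Ax n J)
    (hnm : n ≤ m) : DerAt Ax m J := by
  induction m, hnm using Nat.le_induction with
  | base => exact h
  | succ m _ ih => exact Or.inl ih

theorem exists_uniform_bound {len : ℕ} {P : ∀ i, i < len → ℕ → Prop}
    (hmono : ∀ i hi n m, n ≤ m → P i hi n → P i hi m)
    (h : ∀ i (hi : i < len), ∃ n, P i hi n) : ∃ N, ∀ i (hi : i < len), P i hi N := by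
  choose f hf using h
  refine ⟨(Finset.univ : Finset (Fin len)).sup fun i => f i.1 i.2, fun i hi => ?_⟩
  exact hmono i hi _ _ (Finset.le_sup (f := fun i : Fin len => f i.1 i.2)
    (Finset.mem_univ (⟨i, hi⟩ : Fin len))) (hf i hi)

theorem exists_derAt_args {Ax : Set (Judg A)} {m : ℕ} {L : List (Expr A)}
    (hl : L.length = m) {J : ∀ i, i < m → i < L.length → Judg A}
    (h : ∀ i (hi : i < m) (hif : i < L.length), Derivable Ax (J i hi hif)) :
    ∃ N, ∀ i (hi : i < m) (hif : i < L.length), DerAt Ax N (J i hi hif) := by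
  obtain ⟨N, hN⟩ := exists_uniform_bound (len := m)
    (P := fun i hi n => DerAt Ax n (J i hi (hl ▸ hi)))
    (fun i hi n m hnm hd => hd.mono hnm) (fun i hi => h i hi _)
  exact ⟨N, fun i hi _ => hN i hi⟩

theorem exists_derAt_vars {Ax : Set (Judg A)} {m : ℕ} {J : ∀ i, i < m → Judg A}
    (h : ∀ i (hi : i < m), Derivable Ax (J i hi)) :
    ∃ N, ∀ i (hi : i < m), DerAt Ax N (J i hi) :=
  exists_uniform_bound (fun _ _ _ _ hnm hd => DerAt.mono hd hnm) h

/-- The derivable judgments are closed under the inference rules. -/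
theorem Derivable.of_step {Ax : Set (Judg A)} {J : Judg A}
    (h : Step Ax (Derivable Ax) J) : Derivable Ax J := by
  suffices ∃ n, Step Ax (DerAt Ax n) J from this.imp' Nat.succ fun n hn => Or.inr hn
  cases h with
  | ctx_nil => exact ⟨0, .ctx_nil⟩
  | ctx_cons hs hf hp => obtain ⟨n, hs⟩ := hs; exact ⟨n, .ctx_cons hs hf hp⟩
  | s1 h => obtain ⟨n, h⟩ := h; exact ⟨n, .s1 h⟩
  | s2 h => obtain ⟨n, h⟩ := h; exact ⟨n, .s2 h⟩
  | s3 h1 h2 =>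
    obtain ⟨n1, h1⟩ := h1
    obtain ⟨n2, h2⟩ := h2
    exact ⟨n1 + n2, .s3 (h1.mono (by omega)) (h2.mono (by omega))⟩
  | t1 h => obtain ⟨n, h⟩ := h; exact ⟨n, .t1 h⟩
  | t2 h => obtain ⟨n, h⟩ := h; exact ⟨n, .t2 h⟩
  | t3 h1 h2 =>
    obtain ⟨n1, h1⟩ := h1
    obtain ⟨n2, h2⟩ := h2
    exact ⟨n1 + n2, .t3 (h1.mono (by omega)) (h2.mono (by omega))⟩
  | seqt h1 h2 =>
    obtain ⟨n1, h1⟩ := h1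
    obtain ⟨n2, h2⟩ := h2
    exact ⟨n1 + n2, .seqt (h1.mono (by omega)) (h2.mono (by omega))⟩
  | seqteq h1 h2 h3 h4 =>
    obtain ⟨n1, h1⟩ := h1
    obtain ⟨n2, h2⟩ := h2
    obtain ⟨n3, h3⟩ := h3
    obtain ⟨n4, h4⟩ := h4
    exact ⟨n1 + n2 + n3 + n4, .seqteq (h1.mono (by omega)) (h2.mono (by omega))
      (h3.mono (by omega)) (h4.mono (by omega))⟩
  | var hi h => obtain ⟨n, h⟩ := h; exact ⟨n, .var hi h⟩
  | sA hax h hv =>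
    obtain ⟨n1, h⟩ := h
    obtain ⟨n2, hv⟩ := exists_derAt_vars hv
    exact ⟨n1 + n2, .sA hax (h.mono (by omega)) fun i hi => (hv i hi).mono (by omega)⟩
  | tA hax h hv =>
    obtain ⟨n1, h⟩ := h
    obtain ⟨n2, hv⟩ := exists_derAt_vars hv
    exact ⟨n1 + n2, .tA hax (h.mono (by omega)) fun i hi => (hv i hi).mono (by omega)⟩
  | seqA hax h1 h2 =>
    obtain ⟨n1, h1⟩ := h1
    obtain ⟨n2, h2⟩ := h2
    exact ⟨n1 + n2, .seqA hax (h1.mono (by omega)) (h2.mono (by omega))⟩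
  | teqA hax h1 h2 =>
    obtain ⟨n1, h1⟩ := h1
    obtain ⟨n2, h2⟩ := h2
    exact ⟨n1 + n2, .teqA hax (h1.mono (by omega)) (h2.mono (by omega))⟩
  | sSub hax hY hlen h1 h2 ha =>
    obtain ⟨n1, h1⟩ := h1
    obtain ⟨n2, h2⟩ := h2
    obtain ⟨n3, ha⟩ := exists_derAt_args hlen ha
    exact ⟨n1 + n2 + n3, .sSub hax hY hlen (h1.mono (by omega)) (h2.mono (by omega))
      fun i hi hf => (ha i hi hf).mono (by omega)⟩
  | tSub hax hY hlen h1 h2 ha =>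
    obtain ⟨n1, h1⟩ := h1
    obtain ⟨n2, h2⟩ := h2
    obtain ⟨n3, ha⟩ := exists_derAt_args hlen ha
    exact ⟨n1 + n2 + n3, .tSub hax hY hlen (h1.mono (by omega)) (h2.mono (by omega))
      fun i hi hf => (ha i hi hf).mono (by omega)⟩
  | seqSub1 hax hY hlen h1 h2 h3 ha =>
    obtain ⟨n1, h1⟩ := h1
    obtain ⟨n2, h2⟩ := h2
    obtain ⟨n3, h3⟩ := h3
    obtain ⟨n4, ha⟩ := exists_derAt_args hlen ha
    exact ⟨n1 + n2 + n3 + n4, .seqSub1 hax hY hlen (h1.mono (by omega)) (h2.mono (by omega))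
      (h3.mono (by omega)) fun i hi hf => (ha i hi hf).mono (by omega)⟩
  | seqSub2 hax hY hlf hlg h1 h2 h3 ha =>
    obtain ⟨n1, h1⟩ := h1
    obtain ⟨n2, h2⟩ := h2
    obtain ⟨n3, h3⟩ := h3
    obtain ⟨n4, ha⟩ := exists_derAt_args hlf fun i hi hf => ha i hi hf (by omega)
    exact ⟨n1 + n2 + n3 + n4, .seqSub2 hax hY hlf hlg (h1.mono (by omega))
      (h2.mono (by omega)) (h3.mono (by omega)) fun i hi hf _ => (ha i hi hf).mono (by omega)⟩
  | teqSub1 hax hY hlen h1 h2 h3 ha =>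
    obtain ⟨n1, h1⟩ := h1
    obtain ⟨n2, h2⟩ := h2
    obtain ⟨n3, h3⟩ := h3
    obtain ⟨n4, ha⟩ := exists_derAt_args hlen ha
    exact ⟨n1 + n2 + n3 + n4, .teqSub1 hax hY hlen (h1.mono (by omega)) (h2.mono (by omega))
      (h3.mono (by omega)) fun i hi hf => (ha i hi hf).mono (by omega)⟩
  | teqSub2 hax hY hlf hlg h1 h2 h3 ha =>
    obtain ⟨n1, h1⟩ := h1
    obtain ⟨n2, h2⟩ := h2
    obtain ⟨n3, h3⟩ := h3
    obtain ⟨n4, ha⟩ := exists_derAt_args hlf fun i hi hf => ha i hi hf (by omega)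
    exact ⟨n1 + n2 + n3 + n4, .teqSub2 hax hY hlf hlg (h1.mono (by omega))
      (h2.mono (by omega)) (h3.mono (by omega)) fun i hi hf _ => (ha i hi hf).mono (by omega)⟩

theorem DerAt.derivable {Ax : Set (Judg A)} {J : Judg A} {n : ℕ} (h : DerAt Ax n J) :
    Derivable Ax J := ⟨n, h⟩

theorem Derivable.derAt_ht {Ax : Set (Judg A)} {J : Judg A} (h : Derivable Ax J) :
    DerAt Ax (ht Ax J) J :=
  Nat.sInf_mem (s := {n | DerAt Ax n J}) h

theorem DerAt.ht_le {Ax : Set (Judg A)} {J : Judg A} {n : ℕ} (h : DerAt Ax n J) :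
    ht Ax J ≤ n :=
  Nat.sInf_le (s := {n | DerAt Ax n J}) h

/-- The axioms introducing sort and term symbols apply them to the variables of their context. -/
structure Shaped (Ax : Set (Judg A)) : Prop where
  sort : ∀ X U, Judg.sort X U ∈ Ax → U.args = ctxVars X
  term : ∀ X u U, Judg.term X u U ∈ Ax → ∃ t : A.TermSym, u = .app t (ctxVars X)

theorem IsGAT.shaped {Ax : Set (Judg A)} (h : IsGAT Ax) : Shaped Ax :=
  ⟨h.1.sort_shape, h.1.term_shape⟩

/-- A precontext whose variables are distinct. -/
def GoodCtx (X : PreCtx A) : Prop := IsPreCtx X ∧ (keys X).Nodup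

/-- The context of the judgment is well formed and declares every variable of the judgment. -/
def Judg.Scoped : Judg A → Prop
  | .ctx X => GoodCtx X
  | .sort X U => GoodCtx X ∧ ScopedS X U
  | .term X u U => GoodCtx X ∧ ScopedE X u ∧ ScopedS X U
  | .sortEq X U V => GoodCtx X ∧ ScopedS X U ∧ ScopedS X V
  | .termEq X u v U => GoodCtx X ∧ ScopedE X u ∧ ScopedE X v ∧ ScopedS X U

theorem scopedE_of_args {Y : PreCtx A} {m : ℕ} {f : List (Expr A)} (hl : f.length = m)
    (h : ∀ i, i < m → ∀ hif : i < f.length, ScopedE Y (f[i]'hif)) :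
    ∀ e ∈ f, ScopedE Y e := by
  intro e he
  obtain ⟨i, hi, rfl⟩ := List.getElem_of_mem he
  exact h i (hl ▸ hi) hi

theorem ScopedE.app {Y : PreCtx A} {t : A.TermSym} {f : List (Expr A)}
    (h : ∀ e ∈ f, ScopedE Y e) : ScopedE Y (.app t f) := by
  intro v hv
  obtain ⟨e, he, hv⟩ := occurs_app.1 hv
  exact h e he v hv

theorem scopedS_mk {Y : PreCtx A} {S : A.SortSym} {f : List (Expr A)}
    (h : ∀ e ∈ f, ScopedE Y e) : ScopedS Y ⟨S, f⟩ := by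
  rintro v ⟨e, he, hv⟩
  exact h e he v hv

theorem DerAt.scoped {Ax : Set (Judg A)} (hS : Shaped Ax) {n : ℕ} {J : Judg A}
    (h : DerAt Ax n J) : J.Scoped := by
  induction n generalizing J with
  | zero => exact h.elim
  | succ n ih =>
    rcases h with h | h
    · exact ih h
    cases h with
    | ctx_nil => exact ⟨by intro i hi; simp at hi, by simp [keys]⟩
    | @ctx_cons X U x hs hf hp =>
      refine ⟨hp, ?_⟩
      have := (ih hs).1.2
      simp only [keys, List.map_append, List.map_cons, List.map_nil]
      rw [List.nodup_append]
      refine ⟨this, by simp, ?_⟩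
      intro a ha b hb
      simp only [List.mem_map] at ha
      obtain ⟨p, hp, rfl⟩ := ha
      rw [List.mem_singleton] at hb
      exact hb ▸ hf p hp
    | s1 h => exact ⟨(ih h).1, (ih h).2, (ih h).2⟩
    | s2 h => exact ⟨(ih h).1, (ih h).2.2, (ih h).2.1⟩
    | s3 h1 h2 => exact ⟨(ih h1).1, (ih h1).2.1, (ih h2).2.2⟩
    | t1 h => exact ⟨(ih h).1, (ih h).2.1, (ih h).2.1, (ih h).2.2⟩
    | t2 h => exact ⟨(ih h).1, (ih h).2.2.1, (ih h).2.1, (ih h).2.2.2⟩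
    | t3 h1 h2 => exact ⟨(ih h1).1, (ih h1).2.1, (ih h2).2.2.1, (ih h2).2.2.2⟩
    | seqt h1 h2 => exact ⟨(ih h1).1, (ih h2).2.1, (ih h1).2.2⟩
    | seqteq h1 h2 h3 h4 => exact ⟨(ih h1).1, (ih h3).2.1, (ih h4).2.1, (ih h4).2.2⟩
    | var hi h =>
      refine ⟨(ih h).1, fun v hv => ?_, (ih h).2⟩
      rw [occurs_var] at hv
      exact hv ▸ List.mem_map_of_mem (List.getElem_mem hi)
    | sA hax h hv =>
      refine ⟨ih h, ?_⟩
      rintro v ⟨e, he, hv⟩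
      rw [hS.sort _ _ hax] at he
      exact mem_ctxVars he v hv
    | tA hax h hv =>
      obtain ⟨t, rfl⟩ := hS.term _ _ _ hax
      exact ⟨(ih h).1, .app fun e he => mem_ctxVars he, (ih h).2⟩
    | seqA hax h1 h2 => exact ⟨(ih h1).1, (ih h1).2, (ih h2).2⟩
    | teqA hax h1 h2 => exact ⟨(ih h1).1, (ih h1).2.1, (ih h2).2.1, (ih h2).2.2⟩
    | sSub hax hY hlen h1 h2 ha =>
      exact ⟨ih h2, scopedS_mk (scopedE_of_args hlen fun i hi hf => (ih (ha i hi hf)).2.1)⟩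
    | tSub hax hY hlen h1 h2 ha =>
      exact ⟨(ih h2).1, .app (scopedE_of_args hlen fun i hi hf => (ih (ha i hi hf)).2.1),
        (ih h2).2⟩
    | seqSub1 hax hY hlen h1 h2 h3 ha => exact ⟨(ih h2).1, (ih h2).2, (ih h3).2⟩
    | seqSub2 hax hY hlf hlg h1 h2 h3 ha => exact ⟨(ih h2).1, (ih h2).2, (ih h3).2⟩
    | teqSub1 hax hY hlen h1 h2 h3 ha =>
      exact ⟨(ih h2).1, (ih h2).2.1, (ih h3).2.1, (ih h3).2.2⟩
    | teqSub2 hax hY hlf hlg h1 h2 h3 ha =>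
      exact ⟨(ih h2).1, (ih h2).2.1, (ih h3).2.1, (ih h2).2.2⟩

theorem Derivable.scoped {Ax : Set (Judg A)} (hS : Shaped Ax) {J : Judg A}
    (h : Derivable Ax J) : J.Scoped := h.choose_spec.scoped hS

/-- `ρ` maps the variables of `Y` to terms over `Z` of the corresponding sorts. -/
def FMor (Ax : Set (Judg A)) (Y : PreCtx A) (ρ : A.Var → Expr A) (Z : PreCtx A) : Prop :=
  Derivable Ax (.ctx Z) ∧ ∀ p ∈ Y, Derivable Ax (.term Z (ρ p.1) (p.2.subst ρ))

/-- Every substitution instance of the judgment along a morphism is derivable. -/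
def Judg.Substitutive (Ax : Set (Judg A)) : Judg A → Prop
  | .ctx _ => True
  | .sort X U => ∀ ρ Z, FMor Ax X ρ Z → Derivable Ax (.sort Z (U.subst ρ))
  | .term X u U => ∀ ρ Z, FMor Ax X ρ Z →
      Derivable Ax (.term Z (u.subst ρ) (U.subst ρ))
  | .sortEq X U V => ∀ ρ Z, FMor Ax X ρ Z →
      Derivable Ax (.sortEq Z (U.subst ρ) (V.subst ρ))
  | .termEq X u v U => ∀ ρ Z, FMor Ax X ρ Z →
      Derivable Ax (.termEq Z (u.subst ρ) (v.subst ρ) (U.subst ρ))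

theorem FMor.args {Ax : Set (Judg A)} {X Z : PreCtx A} {ρ : A.Var → Expr A}
    (h : FMor Ax X ρ Z) (hX : IsPreCtx X) (i : ℕ) (hi : i < X.length)
    (hif : i < (X.map fun p => ρ p.1).length) :
    Derivable Ax (.term Z ((X.map fun p => ρ p.1)[i]'hif)
      (subPre X (X.map fun p => ρ p.1) i hi)) := by
  rw [subPre_self hX]
  simpa using h.2 _ (List.getElem_mem hi)

theorem DerAt.substitutive {Ax : Set (Judg A)} (hS : Shaped Ax) {n : ℕ} {J : Judg A}
    (h : DerAt Ax n J) : J.Substitutive Ax := by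
  induction n generalizing J with
  | zero => exact h.elim
  | succ n ih =>
    rcases h with h | h
    · exact ih h
    have inst : ∀ {X Y : PreCtx A} {f : List (Expr A)} {ρ : A.Var → Expr A} {Z : PreCtx A},
        IsPreCtx X → FMor Ax Y ρ Z → f.length = X.length →
        (∀ i (hi : i < X.length) (hif : i < f.length),
          DerAt Ax n (.term Y (f[i]'hif) (subPre X f i hi))) →
        ∀ i (hi : i < X.length) (hif : i < (f.map (Expr.subst ρ)).length),
          Derivable Ax (.term Z ((f.map (Expr.subst ρ))[i]'hif)
            (subPre X (f.map (Expr.subst ρ)) i hi)) := by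
      intro X Y f ρ Z hX hρ hl ha i hi hif
      rw [← subPre_map hX hl hi]
      simpa using ih (ha i hi (hl ▸ hi)) ρ Z hρ
    have instEq : ∀ {X Y : PreCtx A} {f g : List (Expr A)} {ρ : A.Var → Expr A}
        {Z : PreCtx A}, IsPreCtx X → FMor Ax Y ρ Z → f.length = X.length →
        g.length = X.length →
        (∀ i (hi : i < X.length) (hif : i < f.length) (hig : i < g.length),
          DerAt Ax n (.termEq Y (f[i]'hif) (g[i]'hig) (subPre X f i hi))) →
        ∀ i (hi : i < X.length) (hif : i < (f.map (Expr.subst ρ)).length)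
          (hig : i < (g.map (Expr.subst ρ)).length),
          Derivable Ax (.termEq Z ((f.map (Expr.subst ρ))[i]'hif)
            ((g.map (Expr.subst ρ))[i]'hig) (subPre X (f.map (Expr.subst ρ)) i hi)) := by
      intro X Y f g ρ Z hX hρ hl hl' ha i hi hif hig
      rw [← subPre_map hX hl hi]
      simpa using ih (ha i hi (hl ▸ hi) (hl' ▸ hi)) ρ Z hρ
    cases h with
    | ctx_nil => trivial
    | ctx_cons => trivial
    | s1 h => exact fun ρ Z hρ => .of_step (.s1 (ih h ρ Z hρ))
    | s2 h => exact fun ρ Z hρ => .of_step (.s2 (ih h ρ Z hρ))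
    | s3 h1 h2 => exact fun ρ Z hρ => .of_step (.s3 (ih h1 ρ Z hρ) (ih h2 ρ Z hρ))
    | t1 h => exact fun ρ Z hρ => .of_step (.t1 (ih h ρ Z hρ))
    | t2 h => exact fun ρ Z hρ => .of_step (.t2 (ih h ρ Z hρ))
    | t3 h1 h2 => exact fun ρ Z hρ => .of_step (.t3 (ih h1 ρ Z hρ) (ih h2 ρ Z hρ))
    | seqt h1 h2 => exact fun ρ Z hρ => .of_step (.seqt (ih h1 ρ Z hρ) (ih h2 ρ Z hρ))
    | seqteq h1 h2 h3 h4 =>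
      exact fun ρ Z hρ => .of_step (.seqteq (ih h1 ρ Z hρ) (ih h2 ρ Z hρ) (ih h3 ρ Z hρ)
        (ih h4 ρ Z hρ))
    | var hi h =>
      intro ρ Z hρ
      rw [Expr.subst_var]
      exact hρ.2 _ (List.getElem_mem hi)
    | @sA X U hax h hv =>
      intro ρ Z hρ
      obtain ⟨S, ss⟩ := U
      obtain rfl : ss = ctxVars X := hS.sort _ _ hax
      rw [SortE.subst, map_subst_ctxVars]
      exact .of_step (.sSub hax (hρ.1.scoped hS).1 (by simp)
        (.of_step (.sA hax h.derivable fun i hi => (hv i hi).derivable)) hρ.1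
        (hρ.args (h.scoped hS).1))
    | @tA X u U hax h hv =>
      intro ρ Z hρ
      obtain ⟨t, rfl⟩ := hS.term _ _ _ hax
      have hs := h.scoped hS
      rw [Expr.subst_app, map_subst_ctxVars, ← hs.2.substL_self]
      refine .of_step (.tSub hax (hρ.1.scoped hS).1 (by simp)
        (.of_step (.tA hax h.derivable fun i hi => (hv i hi).derivable)) ?_
        (hρ.args hs.1.1))
      rw [hs.2.substL_self]
      exact ih h ρ Z hρ
    | @seqA X U U' hax h1 h2 =>
      intro ρ Z hρ
      have hs1 := h1.scoped hS
      have hs2 := h2.scoped hS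
      rw [← hs1.2.substL_self, ← hs2.2.substL_self]
      refine .of_step (.seqSub1 hax (hρ.1.scoped hS).1 (by simp)
        (.of_step (.seqA hax h1.derivable h2.derivable)) ?_ ?_ (hρ.args hs1.1.1))
      · rw [hs1.2.substL_self]; exact ih h1 ρ Z hρ
      · rw [hs2.2.substL_self]; exact ih h2 ρ Z hρ
    | @teqA X u u' U hax h1 h2 =>
      intro ρ Z hρ
      have hs1 := h1.scoped hS
      have hs2 := h2.scoped hS
      rw [← hs1.2.1.substL_self, ← hs2.2.1.substL_self, ← hs1.2.2.substL_self]
      refine .of_step (.teqSub1 hax (hρ.1.scoped hS).1 (by simp)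
        (.of_step (.teqA hax h1.derivable h2.derivable)) ?_ ?_ (hρ.args hs1.1.1))
      · rw [hs1.2.1.substL_self, hs1.2.2.substL_self]; exact ih h1 ρ Z hρ
      · rw [hs2.2.1.substL_self, hs1.2.2.substL_self]; exact ih h2 ρ Z hρ
    | sSub hax hY hlen h1 h2 ha =>
      intro ρ Z hρ
      exact .of_step (.sSub hax (hρ.1.scoped hS).1 (by simpa using hlen) h1.derivable hρ.1
        (inst (h1.scoped hS).1.1 hρ hlen ha))
    | tSub hax hY hlen h1 h2 ha =>
      intro ρ Z hρ
      have hs := h1.scoped hS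
      have h2' := ih h2 ρ Z hρ
      rw [hs.2.2.substL_map hlen] at h2' ⊢
      rw [Expr.subst_app]
      exact .of_step (.tSub hax (hρ.1.scoped hS).1 (by simpa using hlen) h1.derivable h2'
        (inst hs.1.1 hρ hlen ha))
    | seqSub1 hax hY hlen h1 h2 h3 ha =>
      intro ρ Z hρ
      have hs := h1.scoped hS
      have h2' := ih h2 ρ Z hρ
      have h3' := ih h3 ρ Z hρ
      rw [hs.2.1.substL_map hlen] at h2' ⊢
      rw [hs.2.2.substL_map hlen] at h3' ⊢
      exact .of_step (.seqSub1 hax (hρ.1.scoped hS).1 (by simpa using hlen) h1.derivable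
        h2' h3' (inst hs.1.1 hρ hlen ha))
    | seqSub2 hax hY hlf hlg h1 h2 h3 ha =>
      intro ρ Z hρ
      exact .of_step (.seqSub2 hax (hρ.1.scoped hS).1 (by simpa using hlf)
        (by simpa using hlg) h1.derivable (ih h2 ρ Z hρ) (ih h3 ρ Z hρ)
        (instEq (h1.scoped hS).1.1 hρ hlf hlg ha))
    | teqSub1 hax hY hlen h1 h2 h3 ha =>
      intro ρ Z hρ
      have hs := h1.scoped hS
      have h2' := ih h2 ρ Z hρ
      have h3' := ih h3 ρ Z hρ
      rw [hs.2.1.substL_map hlen, hs.2.2.2.substL_map hlen] at h2'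
      rw [hs.2.2.1.substL_map hlen, hs.2.2.2.substL_map hlen] at h3'
      rw [hs.2.1.substL_map hlen, hs.2.2.1.substL_map hlen, hs.2.2.2.substL_map hlen]
      exact .of_step (.teqSub1 hax (hρ.1.scoped hS).1 (by simpa using hlen) h1.derivable
        h2' h3' (inst hs.1.1 hρ hlen ha))
    | teqSub2 hax hY hlf hlg h1 h2 h3 ha =>
      intro ρ Z hρ
      have hs := h1.scoped hS
      have h2' := ih h2 ρ Z hρ
      have h3' := ih h3 ρ Z hρ
      rw [hs.2.2.substL_map hlf, Expr.subst_app] at h2' h3' ⊢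
      rw [Expr.subst_app]
      exact .of_step (.teqSub2 hax (hρ.1.scoped hS).1 (by simpa using hlf)
        (by simpa using hlg) h1.derivable h2' h3' (instEq hs.1.1 hρ hlf hlg ha))

/-! ### Heights of premises -/

theorem DerAt.ctx_of_sort {Ax : Set (Judg A)} {n : ℕ} {X : PreCtx A} {U : SortE A}
    (h : DerAt Ax n (.sort X U)) : ∃ m < n, DerAt Ax m (.ctx X) := by
  induction n with
  | zero => exact h.elim
  | succ n ih =>
    rcases h with h | h
    · obtain ⟨m, hm, hd⟩ := ih h
      exact ⟨m, by omega, hd⟩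
    cases h with
    | sA hax h hv => exact ⟨n, by omega, h⟩
    | sSub hax hY hlen h1 h2 ha => exact ⟨n, by omega, h2⟩

theorem DerAt.ctx_take {Ax : Set (Judg A)} {n : ℕ} {X : PreCtx A}
    (h : DerAt Ax n (.ctx X)) (i : ℕ) : DerAt Ax n (.ctx (X.take i)) := by
  induction n generalizing X i with
  | zero => exact h.elim
  | succ n ih =>
    rcases h with h | h
    · exact Or.inl (ih h i)
    cases h with
    | ctx_nil => rw [List.take_nil]; exact Or.inr .ctx_nil
    | @ctx_cons X U x hs hf hp =>
      by_cases hi : i ≤ X.length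
      · rw [List.take_append_of_le_length hi]
        obtain ⟨m, hm, hd⟩ := hs.ctx_of_sort
        exact Or.inl (ih (hd.mono hm.le) i)
      · rw [List.take_of_length_le (by simp; omega)]
        exact Or.inr (.ctx_cons hs hf hp)

theorem DerAt.sort_of_ctx {Ax : Set (Judg A)} {n : ℕ} {X : PreCtx A}
    (h : DerAt Ax n (.ctx X)) (i : ℕ) (hi : i < X.length) :
    ∃ m < n, DerAt Ax m (.sort (X.take i) (X[i]'hi).2) := by
  induction n generalizing X i with
  | zero => exact h.elim
  | succ n ih =>
    rcases h with h | h
    · obtain ⟨m, hm, hd⟩ := ih h i hi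
      exact ⟨m, by omega, hd⟩
    cases h with
    | ctx_nil => simp at hi
    | @ctx_cons X U x hs hf hp =>
      by_cases hi' : i < X.length
      · rw [List.take_append_of_le_length hi'.le, List.getElem_append_left hi']
        obtain ⟨m, hm, hd⟩ := hs.ctx_of_sort
        obtain ⟨k, hk, hk'⟩ := ih (hd.mono hm.le) i hi'
        exact ⟨k, by omega, hk'⟩
      · obtain rfl : i = X.length := by simp at hi; omega
        rw [List.take_left, List.getElem_append_right le_rfl]
        exact ⟨n, by omega, by simpa using hs⟩

theorem DerAt.sorts_of_sortEq {Ax : Set (Judg A)} {n : ℕ} {X : PreCtx A} {U V : SortE A}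
    (h : DerAt Ax n (.sortEq X U V)) :
    (∃ m < n, DerAt Ax m (.sort X U)) ∧ ∃ m < n, DerAt Ax m (.sort X V) := by
  have lift : ∀ {n : ℕ} {J : Judg A}, (∃ m < n, DerAt Ax m J) → ∃ m < n + 1, DerAt Ax m J :=
    fun ⟨m, hm, hd⟩ => ⟨m, by omega, hd⟩
  induction n generalizing U V with
  | zero => exact h.elim
  | succ n ih =>
    rcases h with h | h
    · exact ⟨lift (ih h).1, lift (ih h).2⟩
    cases h with
    | s1 h => exact ⟨⟨n, by omega, h⟩, n, by omega, h⟩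
    | s2 h => exact ⟨lift (ih h).2, lift (ih h).1⟩
    | s3 h1 h2 => exact ⟨lift (ih h1).1, lift (ih h2).2⟩
    | seqA hax h1 h2 => exact ⟨⟨n, by omega, h1⟩, n, by omega, h2⟩
    | seqSub1 hax hY hlen h1 h2 h3 ha => exact ⟨⟨n, by omega, h2⟩, n, by omega, h3⟩
    | seqSub2 hax hY hlf hlg h1 h2 h3 ha => exact ⟨⟨n, by omega, h2⟩, n, by omega, h3⟩

theorem DerAt.sort_of_term {Ax : Set (Judg A)} {n : ℕ} {X : PreCtx A} {u : Expr A}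
    {U : SortE A} (h : DerAt Ax n (.term X u U)) : ∃ m < n, DerAt Ax m (.sort X U) := by
  induction n with
  | zero => exact h.elim
  | succ n ih =>
    rcases h with h | h
    · obtain ⟨m, hm, hd⟩ := ih h
      exact ⟨m, by omega, hd⟩
    cases h with
    | seqt h1 h2 =>
      obtain ⟨m, hm, hd⟩ := h1.sorts_of_sortEq.2
      exact ⟨m, by omega, hd⟩
    | var hi h => exact ⟨n, by omega, h⟩
    | tA hax h hv => exact ⟨n, by omega, h⟩
    | tSub hax hY hlen h1 h2 ha => exact ⟨n, by omega, h2⟩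

/-- The canonical sort of a term is derivable at no greater height than any other of its sorts. -/
theorem DerAt.exists_canonSort {Ax : Set (Judg A)} (hS : Shaped Ax) {n : ℕ} {X : PreCtx A}
    {u : Expr A} {U : SortE A} (h : DerAt Ax n (.term X u U)) :
    ∃ V, CanonSort Ax X u V ∧ DerAt Ax n (.term X u V) := by
  induction n generalizing U with
  | zero => exact h.elim
  | succ n ih =>
    rcases h with h | h
    · obtain ⟨V, hV, hd⟩ := ih h
      exact ⟨V, hV, Or.inl hd⟩
    cases h with
    | seqt h1 h2 =>
      obtain ⟨V, hV, hd⟩ := ih h2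
      exact ⟨V, hV, Or.inl hd⟩
    | var hi h => exact ⟨_, .var hi, Or.inr (.var hi h)⟩
    | tA hax h hv =>
      obtain ⟨t, rfl⟩ := hS.term _ _ _ hax
      refine ⟨U, ?_, Or.inr (.tA hax h hv)⟩
      have := CanonSort.app (X := X) (f := ctxVars X) hax
      rwa [ctxVars, (h.scoped hS).2.substL_self, SortE.subst_eq_self U fun _ _ => rfl] at this
    | tSub hax hY hlen h1 h2 ha =>
      exact ⟨_, .app hax, Or.inr (.tSub hax hY hlen h1 h2 ha)⟩

theorem CanonSort.unique {Ax : Set (Judg A)} (hA : IsGAT Ax) {X : PreCtx A}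
    (hX : (keys X).Nodup) {u : Expr A} {U V : SortE A} (hU : CanonSort Ax X u U)
    (hV : CanonSort Ax X u V) : U = V := by
  cases hU with
  | @var i hi =>
    generalize hw : Expr.var (X[i]'hi).1 = w at hV
    cases hV with
    | @var j hj =>
      have : i = j := by
        rw [List.nodup_iff_injective_get] at hX
        have := @hX ⟨i, by simpa using hi⟩ ⟨j, by simpa using hj⟩ (by simpa using hw)
        simpa using this
      subst this
      rfl
    | app hax => simp at hw
  | @app t f Xa W hax =>
    cases hV with
    | @app _ _ Xa' W' hax' =>
      have := (hA.1.term_intro t).unique (y₁ := (Xa, W)) (y₂ := (Xa', W')) hax hax'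
      simp only [Prod.mk.injEq] at this
      rw [this.1, this.2]

theorem DerAt.args_of_sort {Ax : Set (Judg A)} (hS : Shaped Ax) {n : ℕ} {X : PreCtx A}
    {U : SortE A} (h : DerAt Ax n (.sort X U)) {e : Expr A} (he : e ∈ U.args) :
    ∃ m < n, ∃ V, DerAt Ax m (.term X e V) := by
  induction n with
  | zero => exact h.elim
  | succ n ih =>
    rcases h with h | h
    · obtain ⟨m, hm, hd⟩ := ih h
      exact ⟨m, by omega, hd⟩
    cases h with
    | sA hax h hv =>
      rw [hS.sort _ _ hax, ctxVars, List.mem_map] at he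
      obtain ⟨p, hp, rfl⟩ := he
      obtain ⟨i, hi, rfl⟩ := List.getElem_of_mem hp
      exact ⟨n, by omega, _, hv i hi⟩
    | sSub hax hY hlen h1 h2 ha =>
      obtain ⟨i, hi, rfl⟩ := List.getElem_of_mem he
      exact ⟨n, by omega, _, ha i (hlen ▸ hi) hi⟩

theorem DerAt.args_of_term {Ax : Set (Judg A)} (hS : Shaped Ax) {n : ℕ} {X : PreCtx A}
    {t : A.TermSym} {ts : List (Expr A)} {U : SortE A}
    (h : DerAt Ax n (.term X (.app t ts) U)) {e : Expr A} (he : e ∈ ts) :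
    ∃ m < n, ∃ V, DerAt Ax m (.term X e V) := by
  induction n generalizing U with
  | zero => exact h.elim
  | succ n ih =>
    rcases h with h | h
    · obtain ⟨m, hm, hd⟩ := ih h
      exact ⟨m, by omega, hd⟩
    cases h with
    | seqt h1 h2 =>
      obtain ⟨m, hm, hd⟩ := ih h2
      exact ⟨m, by omega, hd⟩
    | tA hax h hv =>
      obtain ⟨t', ht⟩ := hS.term _ _ _ hax
      cases ht
      rw [ctxVars, List.mem_map] at he
      obtain ⟨p, hp, rfl⟩ := he
      obtain ⟨i, hi, rfl⟩ := List.getElem_of_mem hp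
      exact ⟨n, by omega, _, hv i hi⟩
    | tSub hax hY hlen h1 h2 ha =>
      obtain ⟨i, hi, rfl⟩ := List.getElem_of_mem he
      exact ⟨n, by omega, _, ha i (hlen ▸ hi) hi⟩

theorem FMor.id_take {Ax : Set (Judg A)} (hS : Shaped Ax) {Z : PreCtx A}
    (hZ : Derivable Ax (.ctx Z)) (i : ℕ) : FMor Ax (Z.take i) Expr.var Z := by
  have hsub : ∀ U : SortE A, U.subst .var = U := fun U => U.subst_eq_self fun _ _ => rfl
  induction i with
  | zero => exact ⟨hZ, by simp⟩
  | succ i ih =>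
    by_cases hi : i < Z.length
    · refine ⟨hZ, fun p hp => ?_⟩
      rw [List.take_succ_eq_append_getElem hi, List.mem_append, List.mem_singleton] at hp
      rcases hp with hp | rfl
      · exact ih.2 p hp
      · obtain ⟨m, -, hd⟩ := hZ.choose_spec.sort_of_ctx i hi
        have := hd.substitutive hS _ _ ih
        rw [hsub] at this ⊢
        exact .of_step (.var hi this)
    · rw [List.take_of_length_le (by omega)] at ih ⊢
      exact ih

theorem Derivable.var_of_ctx {Ax : Set (Judg A)} (hS : Shaped Ax) {Z : PreCtx A}
    (hZ : Derivable Ax (.ctx Z)) {p : A.Var × SortE A} (hp : p ∈ Z) :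
    Derivable Ax (.term Z (.var p.1) p.2) := by
  have := (FMor.id_take hS hZ Z.length).2 p (by simpa using hp)
  rwa [SortE.subst_eq_self _ fun _ _ => rfl] at this

/-! ### Grids -/

theorem grid_index_lt {m n i j : ℕ} (hi : i < m) (hj : j < n) : i * n + j < m * n := by
  calc i * n + j < i * n + n := by omega
    _ = (i + 1) * n := by ring
    _ ≤ m * n := Nat.mul_le_mul_right n hi

theorem exists_grid_index {m n k : ℕ} (hk : k < m * n) :
    ∃ i < m, ∃ j < n, k = i * n + j := by
  have hn : 0 < n := by
    rcases Nat.eq_zero_or_pos n with rfl | h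
    · simp at hk
    · exact h
  exact ⟨k / n, Nat.div_lt_of_lt_mul (by rwa [mul_comm]), k % n, Nat.mod_lt _ hn,
    by rw [mul_comm]; exact (Nat.div_add_mod k n).symm⟩

theorem exists_grid {γ : Type} {m n : ℕ} {P : ℕ → ℕ → γ → Prop}
    (h : ∀ i < m, ∀ j < n, ∃ e, P i j e) :
    ∃ L : List γ, L.length = m * n ∧
      ∀ i j (_ : i < m) (_ : j < n) (hL : i * n + j < L.length), P i j (L[i * n + j]'hL) := by
  have h' : ∀ k : Fin (m * n), ∃ e, ∀ i j, i < m → j < n → k.1 = i * n + j → P i j e := by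
    rintro ⟨k, hk⟩
    obtain ⟨i, hi, j, hj, rfl⟩ := exists_grid_index hk
    obtain ⟨e, he⟩ := h i hi j hj
    refine ⟨e, fun i' j' _ hj' hij => ?_⟩
    have hii : i = i' := by
      have := congrArg (· / n) hij
      simpa [Nat.add_div_of_dvd_right (Dvd.intro_left _ rfl), Nat.div_eq_of_lt hj,
        Nat.div_eq_of_lt hj', Nat.mul_div_cancel _ (Nat.zero_lt_of_lt hj)] using this
    subst hii
    obtain rfl : j = j' := by simpa using hij
    exact he
  choose f hf using h'
  refine ⟨List.ofFn f, by simp, fun i j hi hj hL => ?_⟩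
  rw [List.getElem_ofFn]
  exact hf _ i j hi hj rfl

theorem exists_isGrid {γ : Type} (m n : ℕ) (M : ℕ → ℕ → γ) : ∃ L, IsGrid m n M L :=
  exists_grid (P := fun i j e => e = M i j) fun i _ j _ => ⟨M i j, rfl⟩

theorem grid_ext {γ : Type} {m n : ℕ} {L L' : List γ} (hL : L.length = m * n)
    (hL' : L'.length = m * n)
    (h : ∀ i j (_ : i < m) (_ : j < n) (h1 : i * n + j < L.length)
      (h2 : i * n + j < L'.length), L[i * n + j]'h1 = L'[i * n + j]'h2) : L = L' := by
  refine List.ext_getElem (by rw [hL, hL']) fun k h1 h2 => ?_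
  obtain ⟨i, hi, j, hj, rfl⟩ := exists_grid_index (hL ▸ h1)
  exact h i j hi hj h1 h2

theorem IsGrid.ext {γ : Type} {m n : ℕ} {M M' : ℕ → ℕ → γ} {L L' : List γ}
    (hL : IsGrid m n M L) (hL' : IsGrid m n M' L')
    (h : ∀ i < m, ∀ j < n, M i j = M' i j) : L = L' :=
  grid_ext hL.1 hL'.1 fun i j hi hj h1 h2 => by
    rw [hL.2 i j hi hj h1, hL'.2 i j hi hj h2, h i hi j hj]

theorem IsGrid.map {γ δ : Type} {m n : ℕ} {M : ℕ → ℕ → γ} {L : List γ}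
    (hL : IsGrid m n M L) (f : γ → δ) : IsGrid m n (fun i j => f (M i j)) (L.map f) :=
  ⟨by simp [hL.1], fun i j hi hj h => by simp [hL.2 i j hi hj (by simpa using h)]⟩

theorem IsGrid.mem {γ : Type} {m n : ℕ} {M : ℕ → ℕ → γ} {L : List γ}
    (hL : IsGrid m n M L) {e : γ} (he : e ∈ L) : ∃ i < m, ∃ j < n, e = M i j := by
  obtain ⟨k, hk, rfl⟩ := List.getElem_of_mem he
  obtain ⟨i, hi, j, hj, rfl⟩ := exists_grid_index (hL.1 ▸ hk)
  exact ⟨i, hi, j, hj, hL.2 i j hi hj hk⟩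

theorem IsGrid.mem_dropLast {γ : Type} {m n : ℕ} {M : ℕ → ℕ → γ} {L : List γ}
    (hL : IsGrid (m + 1) (n + 1) M L) {e : γ} (he : e ∈ L.dropLast) :
    ∃ i < m + 1, ∃ j < n + 1, (i ≠ m ∨ j ≠ n) ∧ e = M i j := by
  obtain ⟨k, hk, rfl⟩ := List.getElem_of_mem he
  rw [List.getElem_dropLast]
  rw [List.length_dropLast, hL.1] at hk
  obtain ⟨i, hi, j, hj, rfl⟩ := exists_grid_index (show k < (m + 1) * (n + 1) by omega)
  refine ⟨i, hi, j, hj, ?_, hL.2 i j hi hj _⟩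
  by_contra hc
  push Not at hc
  obtain ⟨rfl, rfl⟩ := hc
  have : (i + 1) * (j + 1) = i * (j + 1) + j + 1 := by ring
  omega

theorem IsGrid.dropLast_ext {γ : Type} {m n : ℕ} {M M' : ℕ → ℕ → γ} {L L' : List γ}
    (hL : IsGrid (m + 1) (n + 1) M L) (hL' : IsGrid (m + 1) (n + 1) M' L')
    (h : ∀ i < m + 1, ∀ j < n + 1, (i ≠ m ∨ j ≠ n) → M i j = M' i j) :
    L.dropLast = L'.dropLast := by
  refine List.ext_getElem (by simp [hL.1, hL'.1]) fun k h1 h2 => ?_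
  rw [List.getElem_dropLast, List.getElem_dropLast]
  rw [List.length_dropLast, hL.1] at h1
  obtain ⟨i, hi, j, hj, rfl⟩ := exists_grid_index (show k < (m + 1) * (n + 1) by omega)
  rw [hL.2 i j hi hj, hL'.2 i j hi hj]
  refine h i hi j hj ?_
  by_contra hc
  push Not at hc
  obtain ⟨rfl, rfl⟩ := hc
  have : (i + 1) * (j + 1) = i * (j + 1) + j + 1 := by ring
  omega

/-! ### Derivable arguments of the tensor operations -/

/-- The argument of a tensor operation is a term judgment, or an augmented sort judgment,
derivable at height `n`. -/
def TArg.DerAt (Ax : Set (Judg A)) (n : ℕ) (a : TArg A) : Prop :=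
  GATPaper.DerAt Ax n (.term a.ctx a.tm a.srt) ∨
    ((∃ x, a.tm = .var x) ∧ GATPaper.DerAt Ax n (.sort a.ctx a.srt))

theorem TArg.DerAt.sort {Ax : Set (Judg A)} {n : ℕ} {X : PreCtx A} {u : Expr A} {U : SortE A}
    (h : TArg.DerAt Ax n ⟨X, u, U⟩) : GATPaper.DerAt Ax n (.sort X U) := by
  rcases h with h | h
  · obtain ⟨m, hm, hd⟩ := h.sort_of_term
    exact hd.mono hm.le
  · exact h.2

theorem TArg.DerAt.goodCtx {Ax : Set (Judg A)} (hA : IsGAT Ax) {n : ℕ} {X : PreCtx A}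
    {u : Expr A} {U : SortE A} (h : TArg.DerAt Ax n ⟨X, u, U⟩) : GoodCtx X :=
  (h.sort.scoped hA.shaped).1

theorem TArg.DerAt.augment {Ax : Set (Judg A)} {n : ℕ} {X : PreCtx A} {t : A.TermSym}
    {ts : List (Expr A)} {U : SortE A} (h : TArg.DerAt Ax n ⟨X, .app t ts, U⟩) (x : A.Var) :
    ∃ m < n, TArg.DerAt Ax m ⟨X, .var x, U⟩ := by
  rcases h with h | ⟨⟨_, h⟩, -⟩
  · obtain ⟨m, hm, hd⟩ := h.sort_of_term
    exact ⟨m, hm, Or.inr ⟨⟨x, rfl⟩, hd⟩⟩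
  · cases h

theorem TArg.DerAt.ctxVar {Ax : Set (Judg A)} {n : ℕ} {X : PreCtx A} {u : Expr A}
    {U : SortE A} (h : TArg.DerAt Ax n ⟨X, u, U⟩) (i : ℕ) (hi : i < X.length) :
    ∃ m < n, TArg.DerAt Ax m ⟨X.take i, .var (X[i]'hi).1, (X[i]'hi).2⟩ := by
  obtain ⟨m, hm, hd⟩ := h.sort.ctx_of_sort
  obtain ⟨k, hk, hd⟩ := hd.sort_of_ctx i hi
  exact ⟨k, by omega, Or.inr ⟨⟨_, rfl⟩, hd⟩⟩

theorem TArg.DerAt.sortArg {Ax : Set (Judg A)} (hA : IsGAT Ax) {n : ℕ} {X : PreCtx A}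
    {u : Expr A} {S : A.SortSym} {ss : List (Expr A)} (h : TArg.DerAt Ax n ⟨X, u, ⟨S, ss⟩⟩)
    {i : ℕ} (hi : i < ss.length) {V : SortE A} (hV : CanonSort Ax X (ss[i]'hi) V) :
    ∃ m < n, TArg.DerAt Ax m ⟨X, ss[i]'hi, V⟩ := by
  obtain ⟨m, hm, W, hd⟩ := h.sort.args_of_sort hA.shaped (List.getElem_mem hi)
  obtain ⟨V', hV', hd⟩ := hd.exists_canonSort hA.shaped
  exact ⟨m, hm, Or.inl (hV.unique hA (h.goodCtx hA).2 hV' ▸ hd)⟩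

theorem TArg.DerAt.termArg {Ax : Set (Judg A)} (hA : IsGAT Ax) {n : ℕ} {X : PreCtx A}
    {t : A.TermSym} {ts : List (Expr A)} {U : SortE A}
    (h : TArg.DerAt Ax n ⟨X, .app t ts, U⟩)
    {i : ℕ} (hi : i < ts.length) {V : SortE A} (hV : CanonSort Ax X (ts[i]'hi) V) :
    ∃ m < n, TArg.DerAt Ax m ⟨X, ts[i]'hi, V⟩ := by
  have hX := (h.goodCtx hA).2
  rcases h with h | ⟨⟨_, h⟩, -⟩
  · obtain ⟨m, hm, W, hd⟩ := h.args_of_term hA.shaped (List.getElem_mem hi)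
    obtain ⟨V', hV', hd⟩ := hd.exists_canonSort hA.shaped
    exact ⟨m, hm, Or.inl (hV.unique hA hX hV' ▸ hd)⟩
  · cases h

theorem TArg.DerAt.exists_sortArgs {Ax : Set (Judg A)} (hA : IsGAT Ax) {n : ℕ} {X : PreCtx A}
    {u : Expr A} {S : A.SortSym} {ss : List (Expr A)} (h : TArg.DerAt Ax n ⟨X, u, ⟨S, ss⟩⟩) :
    ∃ SS : ℕ → SortE A, ∀ i (hi : i < ss.length), CanonSort Ax X (ss[i]'hi) (SS i) := by
  have : ∀ i, ∃ V, ∀ hi : i < ss.length, CanonSort Ax X (ss[i]'hi) V := by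
    intro i
    by_cases hi : i < ss.length
    · obtain ⟨m, hm, W, hd⟩ := h.sort.args_of_sort hA.shaped (List.getElem_mem hi)
      obtain ⟨V', hV', hd⟩ := hd.exists_canonSort hA.shaped
      exact ⟨V', fun _ => hV'⟩
    · exact ⟨⟨S, ss⟩, fun h => absurd h hi⟩
  choose f hf using this
  exact ⟨f, hf⟩

theorem TArg.DerAt.exists_termArgs {Ax : Set (Judg A)} (hA : IsGAT Ax) {n : ℕ} {X : PreCtx A}
    {t : A.TermSym} {ts : List (Expr A)} {U : SortE A}
    (h : TArg.DerAt Ax n ⟨X, .app t ts, U⟩) :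
    ∃ SS : ℕ → SortE A, ∀ i (hi : i < ts.length), CanonSort Ax X (ts[i]'hi) (SS i) := by
  rcases h with h | ⟨⟨_, h⟩, -⟩
  · have : ∀ i, ∃ V, ∀ hi : i < ts.length, CanonSort Ax X (ts[i]'hi) V := by
      intro i
      by_cases hi : i < ts.length
      · obtain ⟨m, hm, W, hd⟩ := h.args_of_term hA.shaped (List.getElem_mem hi)
        obtain ⟨V', hV', hd⟩ := hd.exists_canonSort hA.shaped
        exact ⟨V', fun _ => hV'⟩
      · exact ⟨U, fun h => absurd h hi⟩
    choose f hf using this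
    exact ⟨f, hf⟩
  · cases h

theorem CanonSort.mem_of_var {Ax : Set (Judg A)} {X : PreCtx A} {v : A.Var} {U : SortE A}
    (h : CanonSort Ax X (.var v) U) : v ∈ keys X := by
  cases h
  exact List.mem_map_of_mem (List.getElem_mem _)

/-! ### The substitutions in the definition of the tensor operations -/

theorem mem_keys_getElem {X : PreCtx A} {i : ℕ} (hi : i < X.length) : (X[i]'hi).1 ∈ keys X :=
  List.mem_map_of_mem (List.getElem_mem hi)

theorem exists_getElem_of_mem_keys {X : PreCtx A} {x : A.Var} (h : x ∈ keys X) :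
    ∃ i, ∃ hi : i < X.length, (X[i]'hi).1 = x := by
  simp only [List.mem_map] at h
  obtain ⟨p, hp, rfl⟩ := h
  obtain ⟨i, hi, rfl⟩ := List.getElem_of_mem hp
  exact ⟨i, hi, rfl⟩

theorem keys_getElem_inj {X : PreCtx A} (hX : (keys X).Nodup) {i j : ℕ} (hi : i < X.length)
    (hj : j < X.length) (h : (X[i]'hi).1 = (X[j]'hj).1) : i = j := by
  refine (hX.getElem_inj_iff (hi := by simpa using hi) (hj := by simpa using hj)).1 ?_
  simpa using h

theorem notMem_keys {X : PreCtx A} {x : A.Var} (h : ∀ p ∈ X, p.1 ≠ x) : x ∉ keys X := by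
  intro hx
  simp only [List.mem_map] at hx
  obtain ⟨p, hp, rfl⟩ := hx
  exact h p hp rfl

theorem keys_pairsR (x : A.Var) (Y : PreCtx B) (g : ℕ → Expr (A.tensor B)) :
    (pairsR x Y g).map Prod.fst = (keys Y).map fun y => (x, y) := by
  refine List.ext_getElem (by simp [pairsR]) fun i h1 h2 => by simp [pairsR]

theorem keys_pairsL (X : PreCtx A) (y : B.Var) (g : ℕ → Expr (A.tensor B)) :
    (pairsL X y g).map Prod.fst = (keys X).map fun x => (x, y) := by
  refine List.ext_getElem (by simp [pairsL]) fun i h1 h2 => by simp [pairsL]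

theorem mem_keys_pairsR {x p : A.Var} {q : B.Var} {Y : PreCtx B} {g : ℕ → Expr (A.tensor B)} :
    (p, q) ∈ (pairsR x Y g).map Prod.fst ↔ p = x ∧ q ∈ keys Y := by
  rw [keys_pairsR, List.mem_map]
  constructor
  · rintro ⟨q, hq, h⟩
    cases h
    exact ⟨rfl, hq⟩
  · rintro ⟨rfl, hq⟩
    exact ⟨q, hq, rfl⟩

theorem mem_keys_pairsL {y q : B.Var} {p : A.Var} {X : PreCtx A} {g : ℕ → Expr (A.tensor B)} :
    (p, q) ∈ (pairsL X y g).map Prod.fst ↔ p ∈ keys X ∧ q = y := by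
  rw [keys_pairsL, List.mem_map]
  constructor
  · rintro ⟨q, hq, h⟩
    cases h
    exact ⟨hq, rfl⟩
  · rintro ⟨hp, rfl⟩
    exact ⟨p, hp, rfl⟩

theorem lookupV_pairsR_of_notMem {x p : A.Var} {q : B.Var} {Y : PreCtx B}
    {g : ℕ → Expr (A.tensor B)} (h : ¬ (p = x ∧ q ∈ keys Y)) :
    lookupV (pairsR x Y g) (p, q) = .var (p, q) :=
  lookupV_of_notMem (A := A.tensor B) (mem_keys_pairsR.not.2 h)

theorem lookupV_pairsL_of_notMem {y q : B.Var} {p : A.Var} {X : PreCtx A}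
    {g : ℕ → Expr (A.tensor B)} (h : ¬ (p ∈ keys X ∧ q = y)) :
    lookupV (pairsL X y g) (p, q) = .var (p, q) :=
  lookupV_of_notMem (A := A.tensor B) (mem_keys_pairsL.not.2 h)

theorem exists_lookupV_pairsR (x : A.Var) {q : B.Var} {Y : PreCtx B}
    (g : ℕ → Expr (A.tensor B)) (hq : q ∈ keys Y) :
    ∃ j, ∃ hj : j < Y.length, (Y[j]'hj).1 = q ∧ lookupV (pairsR x Y g) (x, q) = g j := by
  have := lookupV_mem (A := A.tensor B) (mem_keys_pairsR (x := x) (g := g).2 ⟨rfl, hq⟩)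
  rw [pairsR, List.mem_map] at this
  obtain ⟨j, -, hj⟩ := this
  simp only [Prod.mk.injEq, true_and] at hj
  exact ⟨j.1, j.2, hj.1, hj.2.symm⟩

theorem exists_lookupV_pairsL (y : B.Var) {p : A.Var} {X : PreCtx A}
    (g : ℕ → Expr (A.tensor B)) (hp : p ∈ keys X) :
    ∃ i, ∃ hi : i < X.length, (X[i]'hi).1 = p ∧ lookupV (pairsL X y g) (p, y) = g i := by
  have := lookupV_mem (A := A.tensor B) (mem_keys_pairsL (y := y) (g := g).2 ⟨hp, rfl⟩)
  rw [pairsL, List.mem_map] at this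
  obtain ⟨j, -, hj⟩ := this
  simp only [Prod.mk.injEq, and_true] at hj
  exact ⟨j.1, j.2, hj.1, hj.2.symm⟩

theorem lookupV_pairsR (x : A.Var) {Y : PreCtx B} (hY : (keys Y).Nodup)
    (g : ℕ → Expr (A.tensor B)) {j : ℕ} (hj : j < Y.length) :
    lookupV (pairsR x Y g) (x, (Y[j]'hj).1) = g j := by
  obtain ⟨k, hk, h1, h2⟩ := exists_lookupV_pairsR x g (mem_keys_getElem hj)
  rw [h2, keys_getElem_inj hY hk hj h1]

theorem lookupV_pairsL (y : B.Var) {X : PreCtx A} (hX : (keys X).Nodup)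
    (g : ℕ → Expr (A.tensor B)) {i : ℕ} (hi : i < X.length) :
    lookupV (pairsL X y g) ((X[i]'hi).1, y) = g i := by
  obtain ⟨k, hk, h1, h2⟩ := exists_lookupV_pairsL y g (mem_keys_getElem hi)
  rw [h2, keys_getElem_inj hX hk hi h1]

/-! ### Variables of tensors -/

/-- A variable allowed to occur in a tensor with argument `a`. -/
def TArg.Scope (a : TArg A) (p : A.Var) : Prop := p ∈ keys a.ctx ∨ a.tm = .var p

theorem TArg.Scope.of_canonSort {Ax : Set (Judg A)} {X : PreCtx A} {u : Expr A} {U : SortE A}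
    (hU : CanonSort Ax X u U) {p : A.Var} (h : TArg.Scope ⟨X, u, U⟩ p) : p ∈ keys X := by
  rcases h with h | h
  · exact h
  · simp only at h
    subst h
    exact hU.mem_of_var

theorem TArg.Scope.of_take {X : PreCtx A} {i : ℕ} {hi : i < X.length} {U : SortE A} {p : A.Var}
    (h : TArg.Scope ⟨X.take i, .var (X[i]'hi).1, U⟩ p) : p ∈ keys X := by
  rcases h with h | h
  · exact keys_take_subset X i h
  · cases h
    exact mem_keys_getElem hi

variable {TA : Set (Judg A)} {TB : Set (Judg B)}

theorem TTg.occurs {b : Bool} {a : TArg A} {c : TArg B} {e : Expr (A.tensor B)}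
    (h : TTg TA TB b a c e) {p : A.Var} {q : B.Var}
    (ho : Occurs (A := A.tensor B) (p, q) e) : a.Scope p ∧ c.Scope q := by
  induction h generalizing p q with
  | varvar =>
    rw [occurs_var] at ho
    cases ho
    exact ⟨.inr rfl, .inr rfl⟩
  | @varapp b X x S ss Y t ts V SS TSf hSS hTS M out hM hMx hout ihM ihMx =>
    rw [occurs_app] at ho
    obtain ⟨e, he, ho⟩ := ho
    obtain ⟨i, hi, j, hj, rfl⟩ := hout.mem he
    rcases Nat.lt_succ_iff_lt_or_eq.1 hi with hi | rfl
    · obtain ⟨h1, h2⟩ := ihM i hi j hj ho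
      exact ⟨.inl (h1.of_canonSort (hSS i hi)), .inl (h2.of_canonSort (hTS j hj))⟩
    · obtain ⟨h1, h2⟩ := ihMx j hj ho
      exact ⟨h1, .inl (h2.of_canonSort (hTS j hj))⟩
  | @appvar b X s ss U Y y T ts SS TSf hSS hTS M out hM hMy hout ihM ihMy =>
    rw [occurs_app] at ho
    obtain ⟨e, he, ho⟩ := ho
    obtain ⟨i, hi, j, hj, rfl⟩ := hout.mem he
    rcases Nat.lt_succ_iff_lt_or_eq.1 hj with hj | rfl
    · obtain ⟨h1, h2⟩ := ihM i hi j hj ho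
      exact ⟨.inl (h1.of_canonSort (hSS i hi)), .inl (h2.of_canonSort (hTS j hj))⟩
    · obtain ⟨h1, h2⟩ := ihMy i hi ho
      exact ⟨.inl (h1.of_canonSort (hSS i hi)), h2⟩
  | @appapp_base X s ss U Y t ts V x hx e0 h0 g hg ih0 ihg =>
    obtain ⟨⟨p', q'⟩, ho', hl⟩ := ho.of_subst
    obtain ⟨h1, h2⟩ := ih0 ho'
    have hq' : q' ∈ keys Y := by simpa [TArg.Scope] using h2
    by_cases hp : p' = x
    · subst hp
      obtain ⟨j, hj, -, h⟩ := exists_lookupV_pairsR p' g hq'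
      rw [h] at hl
      obtain ⟨h1, h2⟩ := ihg j hj hl
      exact ⟨by simpa [TArg.Scope] using h1, .inl h2.of_take⟩
    · rw [lookupV_pairsR_of_notMem fun h => hp h.1, occurs_var] at hl
      cases hl
      exact ⟨.inl (h1.resolve_right fun h => hp (by cases h; rfl)), .inl hq'⟩
  | @appapp_star X s ss U Y t ts V y hy e0 h0 g hg ih0 ihg =>
    obtain ⟨⟨p', q'⟩, ho', hl⟩ := ho.of_subst
    obtain ⟨h1, h2⟩ := ih0 ho'
    have hp' : p' ∈ keys X := by simpa [TArg.Scope] using h1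
    by_cases hq : q' = y
    · subst hq
      obtain ⟨j, hj, -, h⟩ := exists_lookupV_pairsL q' g hp'
      rw [h] at hl
      obtain ⟨h1, h2⟩ := ihg j hj hl
      exact ⟨.inl h1.of_take, by simpa [TArg.Scope] using h2⟩
    · rw [lookupV_pairsL_of_notMem fun h => hq h.2, occurs_var] at hl
      cases hl
      exact ⟨.inl hp', .inl (h2.resolve_right fun h => hq (by cases h; rfl))⟩

/-! ### Renaming the augmenting variable -/

open Classical in
/-- The substitution renaming `x` to `x'` in the first component of the variables. -/
noncomputable def renA (x x' : A.Var) : (A.tensor B).Var → Expr (A.tensor B) := fun z =>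
  .var (if z.1 = x then x' else z.1, z.2)

open Classical in
/-- The substitution renaming `y` to `y'` in the second component of the variables. -/
noncomputable def renB (y y' : B.Var) : (A.tensor B).Var → Expr (A.tensor B) := fun z =>
  .var (z.1, if z.2 = y then y' else z.2)

theorem renA_self (x x' : A.Var) (q : B.Var) : renA x x' (x, q) = .var (x', q) := by
  simp [renA]

theorem renA_of_ne {x p : A.Var} (h : p ≠ x) (x' : A.Var) (q : B.Var) :
    renA x x' (p, q) = .var (p, q) := by
  simp [renA, h]

theorem renB_self (y y' : B.Var) (p : A.Var) : renB y y' (p, y) = .var (p, y') := by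
  simp [renB]

theorem renB_of_ne {y q : B.Var} (h : q ≠ y) (y' : B.Var) (p : A.Var) :
    renB y y' (p, q) = .var (p, q) := by
  simp [renB, h]

theorem subst_renA_of_scope {x : A.Var} {X : PreCtx A} (hx : x ∉ keys X) (x' : A.Var)
    {e : Expr (A.tensor B)}
    (h : ∀ p q, Occurs (A := A.tensor B) (p, q) e → p ∈ keys X) : e.subst (renA x x') = e :=
  e.subst_eq_self fun ⟨p, q⟩ ho => renA_of_ne (fun hp : p = x => hx (hp ▸ h p q ho)) x' q

theorem subst_renB_of_scope {y : B.Var} {Y : PreCtx B} (hy : y ∉ keys Y) (y' : B.Var)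
    {e : Expr (A.tensor B)}
    (h : ∀ p q, Occurs (A := A.tensor B) (p, q) e → q ∈ keys Y) : e.subst (renB y y') = e :=
  e.subst_eq_self fun ⟨p, q⟩ ho => renB_of_ne (fun hq : q = y => hy (hq ▸ h p q ho)) y' p

theorem TTg.renameA {b : Bool} {X : PreCtx A} {x : A.Var} {U : SortE A} {c : TArg B}
    {e : Expr (A.tensor B)} (h : TTg TA TB b ⟨X, .var x, U⟩ c e) (hx : x ∉ keys X)
    (x' : A.Var) : TTg TA TB b ⟨X, .var x', U⟩ c (e.subst (renA x x')) := by
  generalize ha : (⟨X, .var x, U⟩ : TArg A) = a at h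
  induction h generalizing x with
  | varvar =>
    cases ha
    rw [Expr.subst_var, renA_self]
    exact .varvar
  | @varapp b X x S ss Y t ts V SS TSf hSS hTS M out hM hMx hout ihM ihMx =>
    cases ha
    rw [Expr.subst_app]
    refine .varapp SS TSf hSS hTS (fun i j => (M i j).subst (renA x x')) _
      (fun i hi j hj => ?_) (fun j hj => ihMx j hj hx rfl) (hout.map _)
    rw [subst_renA_of_scope hx x' fun p q ho =>
      ((hM i hi j hj).occurs ho).1.of_canonSort (hSS i hi)]
    exact hM i hi j hj
  | appvar => cases ha
  | appapp_base => cases ha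
  | appapp_star => cases ha

theorem TTg.renameB {b : Bool} {Y : PreCtx B} {y : B.Var} {V : SortE B} {a : TArg A}
    {e : Expr (A.tensor B)} (h : TTg TA TB b a ⟨Y, .var y, V⟩ e) (hy : y ∉ keys Y)
    (y' : B.Var) : TTg TA TB b a ⟨Y, .var y', V⟩ (e.subst (renB y y')) := by
  generalize hc : (⟨Y, .var y, V⟩ : TArg B) = c at h
  induction h generalizing y with
  | varvar =>
    cases hc
    rw [Expr.subst_var, renB_self]
    exact .varvar
  | varapp => cases hc
  | @appvar b X s ss U Y y T ts SS TSf hSS hTS M out hM hMy hout ihM ihMy =>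
    cases hc
    rw [Expr.subst_app]
    refine .appvar SS TSf hSS hTS (fun i j => (M i j).subst (renB y y')) _
      (fun i hi j hj => ?_) (fun j hj => ihMy j hj hy rfl) (hout.map _)
    rw [subst_renB_of_scope hy y' fun p q ho =>
      ((hM i hi j hj).occurs ho).2.of_canonSort (hTS j hj)]
    exact hM i hi j hj
  | appapp_base => cases hc
  | appapp_star => cases hc

/-! ### Uniqueness and existence of tensor terms -/

theorem nodup_keys_take {X : PreCtx A} (h : (keys X).Nodup) (i : ℕ) :
    (keys (X.take i)).Nodup := by
  rw [keys, List.map_take]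
  exact h.sublist (List.take_sublist _ _)

theorem TTg.unique (hA : IsGAT TA) (hB : IsGAT TB) {a : TArg A} {c : TArg B}
    {e e' : Expr (A.tensor B)} (ha : (keys a.ctx).Nodup) (hc : (keys c.ctx).Nodup)
    (h : TTg TA TB false a c e) (h' : TTg TA TB false a c e') : e = e' := by
  generalize hb : false = b at h
  induction h generalizing e' with
  | varvar => cases h'; rfl
  | @varapp b X x S ss Y t ts V SS TSf hSS hTS M out hM hMx hout ihM ihMx =>
    cases h' with
    | varapp SS' TSf' hSS' hTS' M' out' hM' hMx' hout' =>
      rw [hout.ext hout' fun i hi j hj => ?_]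
      rcases Nat.lt_succ_iff_lt_or_eq.1 hi with hi | rfl
      · refine ihM i hi j hj ha hc ?_ hb
        rw [(hSS i hi).unique hA ha (hSS' i hi), (hTS j hj).unique hB hc (hTS' j hj)]
        exact hM' i hi j hj
      · refine ihMx j hj ha hc ?_ hb
        rw [(hTS j hj).unique hB hc (hTS' j hj)]
        exact hMx' j hj
  | @appvar b X s ss U Y y T ts SS TSf hSS hTS M out hM hMy hout ihM ihMy =>
    cases h' with
    | appvar SS' TSf' hSS' hTS' M' out' hM' hMy' hout' =>
      rw [hout.ext hout' fun i hi j hj => ?_]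
      rcases Nat.lt_succ_iff_lt_or_eq.1 hj with hj | rfl
      · refine ihM i hi j hj ha hc ?_ hb
        rw [(hSS i hi).unique hA ha (hSS' i hi), (hTS j hj).unique hB hc (hTS' j hj)]
        exact hM' i hi j hj
      · refine ihMy i hi ha hc ?_ hb
        rw [(hSS i hi).unique hA ha (hSS' i hi)]
        exact hMy' i hi
  | @appapp_base X s ss U Y t ts V x hx e0 h0 g hg ih0 ihg =>
    cases h' with
    | @appapp_base _ _ _ _ _ _ _ _ x' hx' e0' h0' g' hg' =>
      have hr := h0'.renameA (notMem_keys hx') x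
      rw [ih0 ha hc hr rfl, Expr.substL, Expr.substL, Expr.subst_subst]
      refine Expr.subst_congr _ fun ⟨p, q⟩ ho => ?_
      obtain ⟨h1, h2⟩ := h0'.occurs ho
      have hq : q ∈ keys Y := by simpa [TArg.Scope] using h2
      by_cases hp : p = x'
      · subst hp
        rw [renA_self, Expr.subst_var]
        obtain ⟨j, hj, rfl⟩ := exists_getElem_of_mem_keys hq
        rw [lookupV_pairsR _ hc, lookupV_pairsR _ hc]
        exact ihg j hj ha (nodup_keys_take hc j) (hg' j hj) rfl
      · rw [renA_of_ne hp, Expr.subst_var, lookupV_pairsR_of_notMem,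
          lookupV_pairsR_of_notMem fun h => hp h.1]
        rintro ⟨rfl, -⟩
        rcases h1 with h1 | h1
        · exact notMem_keys hx h1
        · cases h1
          exact hp rfl
  | appapp_star => cases hb

theorem exists_notMem_keys (X : PreCtx A) : ∃ x, ∀ p ∈ X, p.1 ≠ x := by
  classical
  obtain ⟨x, hx⟩ := Infinite.exists_notMem_finset (keys X).toFinset
  exact ⟨x, fun p hp h => hx (by simpa using ⟨p.2, h ▸ hp⟩)⟩

theorem TTg.exists (hA : IsGAT TA) (hB : IsGAT TB) {a : TArg A} {c : TArg B} {p q : ℕ}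
    (ha : a.DerAt TA p) (hc : c.DerAt TB q) : ∃ e, TTg TA TB false a c e := by
  induction hN : p + q using Nat.strong_induction_on generalizing a c p q with
  | _ N ih =>
  subst hN
  have ih' : ∀ {a c p' q'}, TArg.DerAt TA p' a → TArg.DerAt TB q' c → p' + q' < p + q →
      ∃ e, TTg TA TB false a c e := fun ha hc hlt => ih _ hlt ha hc rfl
  obtain ⟨X, u, U⟩ := a
  obtain ⟨Y, v, V⟩ := c
  cases u with
  | var x =>
    cases v with
    | var y => exact ⟨_, .varvar⟩
    | app t ts =>
      obtain ⟨S, ss⟩ := U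
      obtain ⟨SS, hSS⟩ := ha.exists_sortArgs hA
      obtain ⟨TSf, hTS⟩ := hc.exists_termArgs hB
      have : ∀ i j, ∃ e : Expr (A.tensor B), ∀ hj : j < ts.length,
          (∀ hi : i < ss.length,
            TTg TA TB false ⟨X, ss[i]'hi, SS i⟩ ⟨Y, ts[j]'hj, TSf j⟩ e) ∧
          (i = ss.length →
            TTg TA TB false ⟨X, .var x, ⟨S, ss⟩⟩ ⟨Y, ts[j]'hj, TSf j⟩ e) := by
        intro i j
        by_cases hj : j < ts.length
        · obtain ⟨q', hq', hdq⟩ := hc.termArg hB hj (hTS j hj)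
          by_cases hi : i < ss.length
          · obtain ⟨p', hp', hdp⟩ := ha.sortArg hA hi (hSS i hi)
            obtain ⟨e, he⟩ := ih' hdp hdq (by omega)
            exact ⟨e, fun _ => ⟨fun _ => he, fun h => absurd h hi.ne⟩⟩
          · obtain ⟨e, he⟩ := ih' ha hdq (by omega)
            exact ⟨e, fun _ => ⟨fun h => absurd h hi, fun _ => he⟩⟩
        · obtain ⟨z⟩ : Nonempty (A.tensor B).Var := inferInstance
          exact ⟨.var z, fun h => absurd h hj⟩
      choose M hM using this
      obtain ⟨out, hout⟩ := exists_isGrid (ss.length + 1) ts.length M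
      exact ⟨_, .varapp SS TSf hSS hTS M out (fun i hi j hj => (hM i j hj).1 hi)
        (fun j hj => (hM _ j hj).2 rfl) hout⟩
  | app s ss =>
    cases v with
    | var y =>
      obtain ⟨T, ts⟩ := V
      obtain ⟨SS, hSS⟩ := ha.exists_termArgs hA
      obtain ⟨TSf, hTS⟩ := hc.exists_sortArgs hB
      have : ∀ i j, ∃ e : Expr (A.tensor B), ∀ hi : i < ss.length,
          (∀ hj : j < ts.length,
            TTg TA TB false ⟨X, ss[i]'hi, SS i⟩ ⟨Y, ts[j]'hj, TSf j⟩ e) ∧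
          (j = ts.length →
            TTg TA TB false ⟨X, ss[i]'hi, SS i⟩ ⟨Y, .var y, ⟨T, ts⟩⟩ e) := by
        intro i j
        by_cases hi : i < ss.length
        · obtain ⟨p', hp', hdp⟩ := ha.termArg hA hi (hSS i hi)
          by_cases hj : j < ts.length
          · obtain ⟨q', hq', hdq⟩ := hc.sortArg hB hj (hTS j hj)
            obtain ⟨e, he⟩ := ih' hdp hdq (by omega)
            exact ⟨e, fun _ => ⟨fun _ => he, fun h => absurd h hj.ne⟩⟩
          · obtain ⟨e, he⟩ := ih' hdp hc (by omega)
            exact ⟨e, fun _ => ⟨fun h => absurd h hj, fun _ => he⟩⟩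
        · obtain ⟨z⟩ : Nonempty (A.tensor B).Var := inferInstance
          exact ⟨.var z, fun h => absurd h hi⟩
      choose M hM using this
      obtain ⟨out, hout⟩ := exists_isGrid ss.length (ts.length + 1) M
      exact ⟨_, .appvar SS TSf hSS hTS M out (fun i hi j hj => (hM i j hi).1 hj)
        (fun i hi => (hM i _ hi).2 rfl) hout⟩
    | app t ts =>
      obtain ⟨x, hx⟩ := exists_notMem_keys X
      obtain ⟨p', hp', hdp⟩ := ha.augment x
      obtain ⟨e0, h0⟩ := ih' hdp hc (by omega)
      have : ∀ j, ∃ e, ∀ hj : j < Y.length,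
          TTg TA TB false ⟨X, .app s ss, U⟩
            ⟨Y.take j, .var (Y[j]'hj).1, (Y[j]'hj).2⟩ e := by
        intro j
        by_cases hj : j < Y.length
        · obtain ⟨q', hq', hdq⟩ := hc.ctxVar j hj
          obtain ⟨e, he⟩ := ih' ha hdq (by omega)
          exact ⟨e, fun _ => he⟩
        · exact ⟨e0, fun h => absurd h hj⟩
      choose g hg using this
      exact ⟨_, .appapp_base hx e0 h0 g hg⟩

/-! ### Tensor sorts -/

theorem TSo.occurs {b : Bool} {X : PreCtx A} {x : A.Var} {U : SortE A} {Y : PreCtx B}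
    {y : B.Var} {V : SortE B} {W : SortE (A.tensor B)} (h : TSo TA TB b X x U Y y V W)
    {p : A.Var} {q : B.Var} (ho : SOccurs (A := A.tensor B) (p, q) W) :
    (p ∈ keys X ∧ q ∈ keys Y) ∨ (p = x ∧ q ∈ keys Y) ∨ (p ∈ keys X ∧ q = y) := by
  obtain ⟨hx, hy, SS, TSf, hSS, hTS, M, out, hM, hMx, hMy, hout⟩ := h
  obtain ⟨e, he, ho⟩ := ho
  obtain ⟨i, hi, j, hj, hij, rfl⟩ := hout.mem_dropLast he
  rcases Nat.lt_succ_iff_lt_or_eq.1 hi with hi | rfl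
  · rcases Nat.lt_succ_iff_lt_or_eq.1 hj with hj | rfl
    · obtain ⟨h1, h2⟩ := (hM i hi j hj).occurs ho
      exact .inl ⟨h1.of_canonSort (hSS i hi), h2.of_canonSort (hTS j hj)⟩
    · obtain ⟨h1, h2⟩ := (hMy i hi).occurs ho
      have h1 := h1.of_canonSort (hSS i hi)
      rcases h2 with h2 | h2
      · exact .inl ⟨h1, h2⟩
      · cases h2
        exact .inr (.inr ⟨h1, rfl⟩)
  · rcases Nat.lt_succ_iff_lt_or_eq.1 hj with hj | rfl
    · obtain ⟨h1, h2⟩ := (hMx j hj).occurs ho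
      have h2 := h2.of_canonSort (hTS j hj)
      rcases h1 with h1 | h1
      · exact .inl ⟨h1, h2⟩
      · cases h1
        exact .inr (.inl ⟨rfl, h2⟩)
    · simp at hij

theorem TSo.unique (hA : IsGAT TA) (hB : IsGAT TB) {X : PreCtx A} {x : A.Var} {U : SortE A}
    {Y : PreCtx B} {y : B.Var} {V : SortE B} {W W' : SortE (A.tensor B)}
    (hX : (keys X).Nodup) (hY : (keys Y).Nodup)
    (h : TSo TA TB false X x U Y y V W) (h' : TSo TA TB false X x U Y y V W') : W = W' := by
  obtain ⟨hx, hy, SS, TSf, hSS, hTS, M, out, hM, hMx, hMy, hout⟩ := h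
  obtain ⟨-, -, SS', TSf', hSS', hTS', M', out', hM', hMx', hMy', hout'⟩ := h'
  rename_i S ss T ts
  have hs : ∀ i (hi : i < ss.length), SS i = SS' i := fun i hi =>
    (hSS i hi).unique hA hX (hSS' i hi)
  have ht : ∀ j (hj : j < ts.length), TSf j = TSf' j := fun j hj =>
    (hTS j hj).unique hB hY (hTS' j hj)
  rw [hout.dropLast_ext hout' fun i hi j hj hij => ?_]
  rcases Nat.lt_succ_iff_lt_or_eq.1 hi with hi | rfl
  · rcases Nat.lt_succ_iff_lt_or_eq.1 hj with hj | rfl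
    · exact (hM i hi j hj).unique hA hB hX hY (by rw [hs i hi, ht j hj]; exact hM' i hi j hj)
    · exact (hMy i hi).unique hA hB hX hY (by rw [hs i hi]; exact hMy' i hi)
  · rcases Nat.lt_succ_iff_lt_or_eq.1 hj with hj | rfl
    · exact (hMx j hj).unique hA hB hX hY (by rw [ht j hj]; exact hMx' j hj)
    · simp at hij

theorem TSo.renameA {b : Bool} {X : PreCtx A} {x : A.Var} {U : SortE A} {Y : PreCtx B}
    {y : B.Var} {V : SortE B} {W : SortE (A.tensor B)} (h : TSo TA TB b X x U Y y V W)
    {x' : A.Var} (hx' : ∀ p ∈ X, p.1 ≠ x') :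
    TSo TA TB b X x' U Y y V (W.subst (renA x x')) := by
  obtain ⟨hx, hy, SS, TSf, hSS, hTS, M, out, hM, hMx, hMy, hout⟩ := h
  have hx := notMem_keys hx
  simp only [SortE.subst, List.map_dropLast]
  refine .mk hx' hy SS TSf hSS hTS _ _ (fun i hi j hj => ?_)
    (fun j hj => (hMx j hj).renameA hx x') (fun i hi => ?_) (hout.map _)
  · rw [subst_renA_of_scope hx x' fun p q ho =>
      ((hM i hi j hj).occurs ho).1.of_canonSort (hSS i hi)]
    exact hM i hi j hj
  · rw [subst_renA_of_scope hx x' fun p q ho =>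
      ((hMy i hi).occurs ho).1.of_canonSort (hSS i hi)]
    exact hMy i hi

theorem TSo.renameB {b : Bool} {X : PreCtx A} {x : A.Var} {U : SortE A} {Y : PreCtx B}
    {y : B.Var} {V : SortE B} {W : SortE (A.tensor B)} (h : TSo TA TB b X x U Y y V W)
    {y' : B.Var} (hy' : ∀ p ∈ Y, p.1 ≠ y') :
    TSo TA TB b X x U Y y' V (W.subst (renB y y')) := by
  obtain ⟨hx, hy, SS, TSf, hSS, hTS, M, out, hM, hMx, hMy, hout⟩ := h
  have hy := notMem_keys hy
  simp only [SortE.subst, List.map_dropLast]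
  refine .mk hx hy' SS TSf hSS hTS _ _ (fun i hi j hj => ?_) (fun j hj => ?_)
    (fun i hi => (hMy i hi).renameB hy y') (hout.map _)
  · rw [subst_renB_of_scope hy y' fun p q ho =>
      ((hM i hi j hj).occurs ho).2.of_canonSort (hTS j hj)]
    exact hM i hi j hj
  · rw [subst_renB_of_scope hy y' fun p q ho =>
      ((hMx j hj).occurs ho).2.of_canonSort (hTS j hj)]
    exact hMx j hj

theorem TSo.exists (hA : IsGAT TA) (hB : IsGAT TB) {X : PreCtx A} {x : A.Var} {U : SortE A}
    {Y : PreCtx B} {y : B.Var} {V : SortE B} (hU : Derivable TA (.sort X U))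
    (hV : Derivable TB (.sort Y V)) (hx : ∀ p ∈ X, p.1 ≠ x) (hy : ∀ p ∈ Y, p.1 ≠ y) :
    ∃ W, TSo TA TB false X x U Y y V W := by
  obtain ⟨p, hU⟩ := hU
  obtain ⟨q, hV⟩ := hV
  obtain ⟨S, ss⟩ := U
  obtain ⟨T, ts⟩ := V
  have ha : TArg.DerAt TA p ⟨X, .var x, ⟨S, ss⟩⟩ := .inr ⟨⟨x, rfl⟩, hU⟩
  have hc : TArg.DerAt TB q ⟨Y, .var y, ⟨T, ts⟩⟩ := .inr ⟨⟨y, rfl⟩, hV⟩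
  obtain ⟨SS, hSS⟩ := ha.exists_sortArgs hA
  obtain ⟨TSf, hTS⟩ := hc.exists_sortArgs hB
  have : ∀ i j, ∃ e : Expr (A.tensor B),
      (∀ hi : i < ss.length, ∀ hj : j < ts.length,
        TTg TA TB false ⟨X, ss[i]'hi, SS i⟩ ⟨Y, ts[j]'hj, TSf j⟩ e) ∧
      (i = ss.length → ∀ hj : j < ts.length,
        TTg TA TB false ⟨X, .var x, ⟨S, ss⟩⟩ ⟨Y, ts[j]'hj, TSf j⟩ e) ∧
      (j = ts.length → ∀ hi : i < ss.length,
        TTg TA TB false ⟨X, ss[i]'hi, SS i⟩ ⟨Y, .var y, ⟨T, ts⟩⟩ e) := by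
    intro i j
    by_cases hj : j < ts.length
    · obtain ⟨q', hq', hdq⟩ := hc.sortArg hB hj (hTS j hj)
      by_cases hi : i < ss.length
      · obtain ⟨p', hp', hdp⟩ := ha.sortArg hA hi (hSS i hi)
        obtain ⟨e, he⟩ := TTg.exists hA hB hdp hdq
        exact ⟨e, fun _ _ => he, fun h => absurd h hi.ne, fun h => absurd h hj.ne⟩
      · obtain ⟨e, he⟩ := TTg.exists hA hB ha hdq
        exact ⟨e, fun h => absurd h hi, fun _ _ => he, fun h => absurd h hj.ne⟩
    · by_cases hi : i < ss.length
      · obtain ⟨p', hp', hdp⟩ := ha.sortArg hA hi (hSS i hi)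
        obtain ⟨e, he⟩ := TTg.exists hA hB hdp hc
        exact ⟨e, fun _ h => absurd h hj, fun h => absurd h hi.ne, fun _ _ => he⟩
      · obtain ⟨z⟩ : Nonempty (A.tensor B).Var := inferInstance
        exact ⟨.var z, fun h => absurd h hi, fun _ h => absurd h hj, fun _ h => absurd h hi⟩
  choose M hM using this
  obtain ⟨out, hout⟩ := exists_isGrid (ss.length + 1) (ts.length + 1) M
  exact ⟨_, .mk hx hy SS TSf hSS hTS M out (fun i hi j hj => (hM i j).1 hi hj)
    (fun j hj => (hM _ j).2.1 rfl hj) (fun i hi => (hM i _).2.2 rfl hi) hout⟩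

/-! ### Tensor contexts -/

theorem TCtx.mem {b : Bool} {X : PreCtx A} {Y : PreCtx B} {Z : PreCtx (A.tensor B)}
    (h : TCtx TA TB b X Y Z) {i j : ℕ} (hi : i < X.length) (hj : j < Y.length) :
    ∃ W, (((X[i]'hi).1, (Y[j]'hj).1), W) ∈ Z ∧
      TSo TA TB b (X.take i) (X[i]'hi).1 (X[i]'hi).2
        (Y.take j) (Y[j]'hj).1 (Y[j]'hj).2 W := by
  have hk : i * Y.length + j < Z.length := h.1 ▸ grid_index_lt hi hj
  obtain ⟨h1, h2⟩ := h.2 i j hi hj hk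
  exact ⟨_, h1 ▸ List.getElem_mem hk, h2⟩

theorem TCtx.exists_of_mem {b : Bool} {X : PreCtx A} {Y : PreCtx B} {Z : PreCtx (A.tensor B)}
    (h : TCtx TA TB b X Y Z) {p : (A.tensor B).Var × SortE (A.tensor B)} (hp : p ∈ Z) :
    ∃ i, ∃ hi : i < X.length, ∃ j, ∃ hj : j < Y.length,
      p.1 = ((X[i]'hi).1, (Y[j]'hj).1) ∧
      TSo TA TB b (X.take i) (X[i]'hi).1 (X[i]'hi).2
        (Y.take j) (Y[j]'hj).1 (Y[j]'hj).2 p.2 := by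
  obtain ⟨k, hk, rfl⟩ := List.getElem_of_mem hp
  obtain ⟨i, hi, j, hj, rfl⟩ := exists_grid_index (h.1 ▸ hk)
  exact ⟨i, hi, j, hj, h.2 i j hi hj hk⟩

theorem TCtx.unique (hA : IsGAT TA) (hB : IsGAT TB) {X : PreCtx A} {Y : PreCtx B}
    {Z Z' : PreCtx (A.tensor B)} (hX : (keys X).Nodup) (hY : (keys Y).Nodup)
    (h : TCtx TA TB false X Y Z) (h' : TCtx TA TB false X Y Z') : Z = Z' :=
  grid_ext h.1 h'.1 fun i j hi hj h1 h2 => by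
    obtain ⟨he, hs⟩ := h.2 i j hi hj h1
    obtain ⟨he', hs'⟩ := h'.2 i j hi hj h2
    exact Prod.ext (he.trans he'.symm)
      (hs.unique hA hB (nodup_keys_take hX i) (nodup_keys_take hY j) hs')

theorem Derivable.sort_of_ctx {Ax : Set (Judg A)} {X : PreCtx A} (h : Derivable Ax (.ctx X))
    {i : ℕ} (hi : i < X.length) : Derivable Ax (.sort (X.take i) (X[i]'hi).2) :=
  h.elim fun _ h => (h.sort_of_ctx i hi).elim fun m h => ⟨m, h.2⟩

theorem getElem_fresh_take {X : PreCtx A} (hX : (keys X).Nodup) {i : ℕ} (hi : i < X.length) :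
    ∀ p ∈ X.take i, p.1 ≠ (X[i]'hi).1 := by
  intro p hp h
  obtain ⟨k, hk, rfl⟩ := List.getElem_of_mem hp
  rw [List.length_take] at hk
  rw [List.getElem_take] at h
  have := keys_getElem_inj hX (by omega) hi h
  omega

theorem TCtx.exists (hA : IsGAT TA) (hB : IsGAT TB) {X : PreCtx A} {Y : PreCtx B}
    (hX : Derivable TA (.ctx X)) (hY : Derivable TB (.ctx Y)) :
    ∃ Z, TCtx TA TB false X Y Z := by
  have hX' := (hX.scoped hA.shaped).2
  have hY' := (hY.scoped hB.shaped).2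
  obtain ⟨Z, hl, hZ⟩ := exists_grid (m := X.length) (n := Y.length)
    (P := fun i j (e : (A.tensor B).Var × SortE (A.tensor B)) =>
      ∀ (hi : i < X.length) (hj : j < Y.length), e.1 = ((X[i]'hi).1, (Y[j]'hj).1) ∧
        TSo TA TB false (X.take i) (X[i]'hi).1 (X[i]'hi).2
          (Y.take j) (Y[j]'hj).1 (Y[j]'hj).2 e.2) fun i hi j hj => by
    obtain ⟨W, hW⟩ := TSo.exists hA hB (hX.sort_of_ctx hi) (hY.sort_of_ctx hj)
      (getElem_fresh_take hX' hi) (getElem_fresh_take hY' hj)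
    exact ⟨(((X[i]'hi).1, (Y[j]'hj).1), W), fun _ _ => ⟨rfl, hW⟩⟩
  exact ⟨Z, hl, fun i j hi hj h => hZ i j hi hj h hi hj⟩

theorem TCtx.take {b : Bool} {X : PreCtx A} {U : PreCtx A} {Y : PreCtx B}
    {Z : PreCtx (A.tensor B)} (h : TCtx TA TB b (X ++ U) Y Z) :
    TCtx TA TB b X Y (Z.take (X.length * Y.length)) := by
  have hl : X.length * Y.length ≤ Z.length := by
    rw [h.1, List.length_append]
    exact Nat.mul_le_mul_right _ (by omega)
  refine ⟨by simpa using hl, fun i j hi hj hk => ?_⟩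
  rw [List.length_take] at hk
  have := h.2 i j (by rw [List.length_append]; omega) hj (by omega)
  simpa [List.getElem_append_left hi, List.take_append_of_le_length hi.le] using this

/-! ### The axioms of the tensor product -/

theorem TTg.eq_var {b : Bool} {a : TArg A} {c : TArg B} {e : Expr (A.tensor B)}
    (h : TTg TA TB b a c e) {p : A.Var} {q : B.Var} (ha : a.tm = .var p)
    (hc : c.tm = .var q) : e = .var (p, q) := by
  cases h with
  | varvar => cases ha; cases hc; rfl
  | varapp => cases hc
  | appvar => cases ha
  | appapp_base => cases ha
  | appapp_star => cases ha

theorem TCtx.ctxVars_grid {b : Bool} {X : PreCtx A} {Y : PreCtx B} {Z : PreCtx (A.tensor B)}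
    (h : TCtx TA TB b X Y Z) (x : A.Var) (y : B.Var) :
    IsGrid X.length Y.length
      (fun i j => (Expr.var ((keys X).getD i x, (keys Y).getD j y) : Expr (A.tensor B)))
      (ctxVars Z) := by
  refine ⟨by simp [ctxVars, h.1], fun i j hi hj hk => ?_⟩
  have hk' : i * Y.length + j < Z.length := by simpa [ctxVars] using hk
  simp [ctxVars, (h.2 i j hi hj hk').1, hi, hj]

theorem getElem?_keys_append {X : PreCtx A} {i : ℕ} (hi : i < X.length) (x : A.Var) :
    (X.map Prod.fst ++ [x])[i]? = some (X[i]'hi).1 := by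
  rw [List.getElem?_append_left (by simpa using hi)]
  simp [hi]

theorem tensorAx_shaped (hA : Shaped TA) (hB : Shaped TB) (chA : PreCtx A → A.Var)
    (chB : PreCtx B → B.Var) : Shaped (tensorAx TA TB chA chB) where
  sort := by
    rintro Z W ⟨J, J', hJ, hJ', h⟩
    cases h with
    | @ss X U Y V Z W hZ hW =>
      have hU := hA.sort _ _ hJ
      have hV := hB.sort _ _ hJ'
      have hg := hZ.ctxVars_grid (chA X) (chB Y)
      cases hW with
      | mk hx hy SS TSf hSS hTS M out hM hMx hMy hout =>
        simp only at hU hV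
        subst hU hV
        have hl : ∀ {C : Alphabet} (X : PreCtx C), (ctxVars X).length = X.length := by
          simp [ctxVars]
        simp only [List.length_append, List.length_singleton] at hg
        rw [hl, hl] at hout
        rw [hout.dropLast_ext hg, ctxVars, ctxVars, List.map_dropLast]
        intro i hi j hj hij
        rcases Nat.lt_succ_iff_lt_or_eq.1 hi with hi | rfl
        · rcases Nat.lt_succ_iff_lt_or_eq.1 hj with hj | rfl
          · refine (hM i (by rwa [hl]) j (by rwa [hl])).eq_var ?_ ?_
            · simp [ctxVars, getElem?_keys_append hi]
            · simp [ctxVars, getElem?_keys_append hj]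
          · rw [← hl Y]
            refine (hMy i (by rwa [hl])).eq_var ?_ ?_ <;> simp [ctxVars, getElem?_keys_append hi]
        · rcases Nat.lt_succ_iff_lt_or_eq.1 hj with hj | rfl
          · rw [← hl X]
            refine (hMx j (by rwa [hl])).eq_var ?_ ?_ <;> simp [ctxVars, getElem?_keys_append hj]
          · simp at hij
  term := by
    rintro Z e W ⟨J, J', hJ, hJ', h⟩
    have hl : ∀ {C : Alphabet} (X : PreCtx C), (ctxVars X).length = X.length := by
      simp [ctxVars]
    cases h with
    | @st X U Y v V Z e W g hZ he hW hg =>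
      have hU := hA.sort _ _ hJ
      obtain ⟨t, rfl⟩ := hB.term _ _ _ hJ'
      have hg := hZ.ctxVars_grid (chA X) (chB Y)
      cases he with
      | varapp SS TSf hSS hTS M out hM hMx hout =>
        simp only at hU
        subst hU
        refine ⟨_, congrArg _ ?_⟩
        simp only [List.length_append, List.length_singleton] at hg
        rw [hl, hl] at hout
        refine hout.ext hg fun i hi j hj => ?_
        rcases Nat.lt_succ_iff_lt_or_eq.1 hi with hi | rfl
        · refine (hM i (by rwa [hl]) j (by rwa [hl])).eq_var ?_ ?_
          · simp [ctxVars, getElem?_keys_append hi]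
          · simp [ctxVars, hj]
        · rw [← hl X]
          refine (hMx j (by rwa [hl])).eq_var ?_ ?_ <;> simp [ctxVars, hj]
    | @ts X u U Y V Z e W g hZ he hW hg =>
      have hV := hB.sort _ _ hJ'
      obtain ⟨s, rfl⟩ := hA.term _ _ _ hJ
      have hg := hZ.ctxVars_grid (chA X) (chB Y)
      cases he with
      | appvar SS TSf hSS hTS M out hM hMy hout =>
        simp only at hV
        subst hV
        refine ⟨_, congrArg _ ?_⟩
        simp only [List.length_append, List.length_singleton] at hg
        rw [hl, hl] at hout
        refine hout.ext hg fun i hi j hj => ?_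
        rcases Nat.lt_succ_iff_lt_or_eq.1 hj with hj | rfl
        · refine (hM i (by rwa [hl]) j (by rwa [hl])).eq_var ?_ ?_
          · simp [ctxVars, hi]
          · simp [ctxVars, getElem?_keys_append hj]
        · rw [← hl Y]
          refine (hMy i (by rwa [hl])).eq_var ?_ ?_ <;> simp [ctxVars, hi]

/-! ### Morphisms into a tensor context -/

theorem TArg.Scope.of_scopedE {X : PreCtx A} {u : Expr A} {U : SortE A} {p : A.Var}
    (h : TArg.Scope ⟨X, u, U⟩ p) (hu : ScopedE X u) : p ∈ keys X := by
  rcases h with h | h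
  · exact h
  · exact hu p (by simp only at h; rw [h, occurs_var])

theorem Derivable.ctx_append {Ax : Set (Judg A)} (hS : Shaped Ax) {X : PreCtx A} {U : SortE A}
    (h : Derivable Ax (.sort X U)) {x : A.Var} (hx : ∀ p ∈ X, p.1 ≠ x) :
    Derivable Ax (.ctx (X ++ [(x, U)])) := by
  obtain ⟨hX, hU⟩ := h.scoped hS
  refine .of_step (.ctx_cons h hx fun i hi v hv => ?_)
  rw [List.length_append, List.length_singleton] at hi
  rcases Nat.lt_succ_iff_lt_or_eq.1 hi with hi | rfl
  · simp only [List.getElem_append_left hi, List.take_append_of_le_length hi.le] at hv ⊢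
    exact hX.1 i hi v hv
  · simp only [List.getElem_concat_length, List.take_left] at hv ⊢
    exact hU v hv

theorem Derivable.ctx_of_term {Ax : Set (Judg A)} {X : PreCtx A} {u : Expr A} {U : SortE A}
    (h : Derivable Ax (.term X u U)) : Derivable Ax (.ctx X) :=
  let ⟨_, h⟩ := h
  let ⟨_, _, h⟩ := h.sort_of_term
  let ⟨_, _, h⟩ := h.ctx_of_sort
  ⟨_, h⟩

section
variable {Ax : Set (Judg (A.tensor B))} {X : PreCtx A} {Y : PreCtx B} {Z : PreCtx (A.tensor B)}

theorem TCtx.derivable_var (hA : IsGAT TA) (hB : IsGAT TB) (hS : Shaped Ax)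
    (hX : (keys X).Nodup) (hY : (keys Y).Nodup) (hZ : TCtx TA TB false X Y Z)
    (hZd : Derivable Ax (.ctx Z)) {i j : ℕ} (hi : i < X.length) (hj : j < Y.length)
    {W : SortE (A.tensor B)}
    (hW : TSo TA TB false (X.take i) (X[i]'hi).1 (X[i]'hi).2
      (Y.take j) (Y[j]'hj).1 (Y[j]'hj).2 W) :
    Derivable Ax (.term Z (.var ((X[i]'hi).1, (Y[j]'hj).1)) W) := by
  obtain ⟨W', hm, hW'⟩ := hZ.mem hi hj
  rw [hW.unique hA hB (nodup_keys_take hX i) (nodup_keys_take hY j) hW']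
  exact hZd.var_of_ctx hS hm

theorem TCtx.fMor_renB (hA : IsGAT TA) (hB : IsGAT TB) (hS : Shaped Ax)
    (hX : (keys X).Nodup) (hY : (keys Y).Nodup) (hZ : TCtx TA TB false X Y Z)
    (hZd : Derivable Ax (.ctx Z)) {j : ℕ} (hj : j < Y.length) {y : B.Var}
    (hy : ∀ p ∈ Y.take j, p.1 ≠ y) {Z' : PreCtx (A.tensor B)}
    (hZ' : TCtx TA TB false X (Y.take j ++ [(y, (Y[j]'hj).2)]) Z') :
    FMor Ax Z' (renB y (Y[j]'hj).1) Z := by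
  refine ⟨hZd, fun p hp => ?_⟩
  obtain ⟨i, hi, k, hk, hp, hW⟩ := hZ'.exists_of_mem hp
  have hk' : k < j ∨ k = j := by
    simp only [List.length_append, List.length_take, List.length_singleton] at hk
    omega
  have hl : (Y.take j).length = j := by simp [hj.le]
  rw [hp]
  rcases hk' with hkj | rfl
  · simp only [List.getElem_append_left (hl.symm ▸ hkj), List.getElem_take,
      List.take_append_of_le_length (hl.symm ▸ hkj.le), List.take_take,
      Nat.min_eq_left hkj.le] at hW ⊢
    have hne : ∀ q ∈ keys (Y.take j), q ≠ y := fun _ h => by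
      rintro rfl
      exact notMem_keys hy h
    have hkm : (Y[k]'(hkj.trans hj)).1 ∈ keys (Y.take j) := by
      have := mem_keys_getElem (X := Y.take j) (hl.symm ▸ hkj)
      rwa [List.getElem_take] at this
    rw [renB_of_ne (hne _ hkm), SortE.subst_eq_self]
    · exact hZ.derivable_var hA hB hS hX hY hZd hi _ hW
    · rintro ⟨p, q⟩ ho
      refine renB_of_ne (hne q ?_) _ _
      have hsub : q ∈ keys (Y.take k) → q ∈ keys (Y.take j) := fun h =>
        keys_take_subset (Y.take j) k (by rwa [List.take_take, Nat.min_eq_left hkj.le])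
      rcases hW.occurs ho with h | h | h
      · exact hsub h.2
      · exact hsub h.2
      · rw [h.2]; exact hkm
  · have h1 : (Y.take k ++ [(y, (Y[k]'hj).2)])[k]'hk = (y, (Y[k]'hj).2) := by
      simp [hj.le]
    have h2 : (Y.take k ++ [(y, (Y[k]'hj).2)]).take k = Y.take k := by
      simp [hj.le]
    rw [h1, h2] at hW
    rw [h1, renB_self]
    exact hZ.derivable_var hA hB hS hX hY hZd hi _ (hW.renameB (getElem_fresh_take hY hj))

theorem TCtx.fMor_renA (hA : IsGAT TA) (hB : IsGAT TB) (hS : Shaped Ax)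
    (hX : (keys X).Nodup) (hY : (keys Y).Nodup) (hZ : TCtx TA TB false X Y Z)
    (hZd : Derivable Ax (.ctx Z)) {i : ℕ} (hi : i < X.length) {x : A.Var}
    (hx : ∀ p ∈ X.take i, p.1 ≠ x) {Z' : PreCtx (A.tensor B)}
    (hZ' : TCtx TA TB false (X.take i ++ [(x, (X[i]'hi).2)]) Y Z') :
    FMor Ax Z' (renA x (X[i]'hi).1) Z := by
  refine ⟨hZd, fun p hp => ?_⟩
  obtain ⟨k, hk, j, hj, hp, hW⟩ := hZ'.exists_of_mem hp
  have hk' : k < i ∨ k = i := by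
    simp only [List.length_append, List.length_take, List.length_singleton] at hk
    omega
  have hl : (X.take i).length = i := by simp [hi.le]
  rw [hp]
  rcases hk' with hki | rfl
  · simp only [List.getElem_append_left (hl.symm ▸ hki), List.getElem_take,
      List.take_append_of_le_length (hl.symm ▸ hki.le), List.take_take,
      Nat.min_eq_left hki.le] at hW ⊢
    have hne : ∀ p ∈ keys (X.take i), p ≠ x := fun _ h => by
      rintro rfl
      exact notMem_keys hx h
    have hkm : (X[k]'(hki.trans hi)).1 ∈ keys (X.take i) := by
      have := mem_keys_getElem (X := X.take i) (hl.symm ▸ hki)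
      rwa [List.getElem_take] at this
    rw [renA_of_ne (hne _ hkm), SortE.subst_eq_self]
    · exact hZ.derivable_var hA hB hS hX hY hZd _ hj hW
    · rintro ⟨p, q⟩ ho
      refine renA_of_ne (hne p ?_) _ _
      have hsub : p ∈ keys (X.take k) → p ∈ keys (X.take i) := fun h =>
        keys_take_subset (X.take i) k (by rwa [List.take_take, Nat.min_eq_left hki.le])
      rcases hW.occurs ho with h | h | h
      · exact hsub h.1
      · rw [h.1]; exact hkm
      · exact hsub h.1
  · have h1 : (X.take k ++ [(x, (X[k]'hi).2)])[k]'hk = (x, (X[k]'hi).2) := by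
      simp [hi.le]
    have h2 : (X.take k ++ [(x, (X[k]'hi).2)]).take k = X.take k := by
      simp [hi.le]
    rw [h1, h2] at hW
    rw [h1, renA_self]
    exact hZ.derivable_var hA hB hS hX hY hZd _ hj (hW.renameA (getElem_fresh_take hX hi))

theorem TCtx.fMor_pairsR (hA : IsGAT TA) (hB : IsGAT TB) (hS : Shaped Ax)
    (hX : (keys X).Nodup) (hY : (keys Y).Nodup) (hZ : TCtx TA TB false X Y Z)
    (hZd : Derivable Ax (.ctx Z)) {x : A.Var} {U : SortE A} (hx : ∀ p ∈ X, p.1 ≠ x)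
    {Z' : PreCtx (A.tensor B)} (hZ' : TCtx TA TB false (X ++ [(x, U)]) Y Z')
    {g : ℕ → Expr (A.tensor B)}
    (hg : ∀ j (hj : j < Y.length) (W : SortE (A.tensor B)),
      TSo TA TB false X x U (Y.take j) (Y[j]'hj).1 (Y[j]'hj).2 W →
      Derivable Ax (.term Z (g j) (W.substL (pairsR x Y g)))) :
    FMor Ax Z' (lookupV (pairsR x Y g)) Z := by
  refine ⟨hZd, fun p hp => ?_⟩
  obtain ⟨i, hi, j, hj, hp, hW⟩ := hZ'.exists_of_mem hp
  rw [List.length_append, List.length_singleton] at hi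
  rw [hp]
  rcases Nat.lt_succ_iff_lt_or_eq.1 hi with hi | rfl
  · simp only [List.getElem_append_left hi, List.take_append_of_le_length hi.le] at hW ⊢
    have hne : ∀ p ∈ keys X, p ≠ x := fun _ h => by
      rintro rfl
      exact notMem_keys hx h
    rw [lookupV_pairsR_of_notMem fun h => hne _ (mem_keys_getElem hi) h.1, SortE.subst_eq_self]
    · exact hZ.derivable_var hA hB hS hX hY hZd hi _ hW
    · rintro ⟨p, q⟩ ho
      refine lookupV_pairsR_of_notMem fun h => hne p ?_ h.1
      rcases hW.occurs ho with h | h | h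
      · exact keys_take_subset X i h.1
      · rw [h.1]; exact mem_keys_getElem hi
      · exact keys_take_subset X i h.1
  · simp only [List.getElem_concat_length, List.take_left] at hW ⊢
    rw [lookupV_pairsR x hY g hj]
    exact hg j hj _ hW

theorem TCtx.fMor_pairsL (hA : IsGAT TA) (hB : IsGAT TB) (hS : Shaped Ax)
    (hX : (keys X).Nodup) (hY : (keys Y).Nodup) (hZ : TCtx TA TB false X Y Z)
    (hZd : Derivable Ax (.ctx Z)) {y : B.Var} {V : SortE B} (hy : ∀ p ∈ Y, p.1 ≠ y)
    {Z' : PreCtx (A.tensor B)} (hZ' : TCtx TA TB false X (Y ++ [(y, V)]) Z')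
    {g : ℕ → Expr (A.tensor B)}
    (hg : ∀ i (hi : i < X.length) (W : SortE (A.tensor B)),
      TSo TA TB false (X.take i) (X[i]'hi).1 (X[i]'hi).2 Y y V W →
      Derivable Ax (.term Z (g i) (W.substL (pairsL X y g)))) :
    FMor Ax Z' (lookupV (pairsL X y g)) Z := by
  refine ⟨hZd, fun p hp => ?_⟩
  obtain ⟨i, hi, j, hj, hp, hW⟩ := hZ'.exists_of_mem hp
  rw [List.length_append, List.length_singleton] at hj
  rw [hp]
  rcases Nat.lt_succ_iff_lt_or_eq.1 hj with hj | rfl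
  · simp only [List.getElem_append_left hj, List.take_append_of_le_length hj.le] at hW ⊢
    have hne : ∀ q ∈ keys Y, q ≠ y := fun _ h => by
      rintro rfl
      exact notMem_keys hy h
    rw [lookupV_pairsL_of_notMem fun h => hne _ (mem_keys_getElem hj) h.2, SortE.subst_eq_self]
    · exact hZ.derivable_var hA hB hS hX hY hZd hi _ hW
    · rintro ⟨p, q⟩ ho
      refine lookupV_pairsL_of_notMem fun h => hne q ?_ h.2
      rcases hW.occurs ho with h | h | h
      · exact keys_take_subset Y j h.2
      · exact keys_take_subset Y j h.2
      · rw [h.2]; exact mem_keys_getElem hj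
  · simp only [List.getElem_concat_length, List.take_left] at hW ⊢
    rw [lookupV_pairsL y hX g hi]
    exact hg i hi _ hW

end

/-! ### Composing the substitutions -/

section
variable {X : PreCtx A} {Y : PreCtx B} {x x' : A.Var} {y y' : B.Var} {U : SortE A} {V : SortE B}
  {W : SortE (A.tensor B)} {gx gy : ℕ → Expr (A.tensor B)}

theorem TSo.substL_substL_pairsR (hX : (keys X).Nodup) (hY : (keys Y).Nodup)
    (hW : TSo TA TB false X x U Y y V W) (hx : x ∉ keys X) (hy : y ∉ keys Y)
    (hx' : x' ∉ keys X) (hy' : y' ∉ keys Y)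
    (hgx : ∀ i < X.length, ∀ p q, Occurs (A := A.tensor B) (p, q) (gx i) → p ∈ keys X) :
    ((((W.subst (renA x x')).subst (renB y y')).substL (pairsL X y' gx)).substL
      (pairsR x' Y gy)) = W.substL (pairsR x Y gy ++ pairsL X y gx) := by
  simp only [SortE.substL, SortE.subst_subst]
  refine SortE.subst_congr W ?_
  rintro ⟨p, q⟩ ho
  have hneX : ∀ {p z}, z ∉ keys X → p ∈ keys X → p ≠ z := fun hz hp h => hz (h ▸ hp)
  have hneY : ∀ {q z}, z ∉ keys Y → q ∈ keys Y → q ≠ z := fun hz hq h => hz (h ▸ hq)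
  rcases hW.occurs ho with ⟨hp, hq⟩ | ⟨rfl, hq⟩ | ⟨hp, rfl⟩
  · rw [renA_of_ne (hneX hx hp), Expr.subst_var, renB_of_ne (hneY hy hq), Expr.subst_var,
      lookupV_pairsL_of_notMem fun h => hneY hy' hq h.2, Expr.subst_var,
      lookupV_pairsR_of_notMem fun h => hneX hx' hp h.1,
      lookupV_append_of_notMem fun h => hneX hx hp (mem_keys_pairsR.1 h).1,
      lookupV_pairsL_of_notMem fun h => hneY hy hq h.2]
  · rw [renA_self, Expr.subst_var, renB_of_ne (hneY hy hq), Expr.subst_var,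
      lookupV_pairsL_of_notMem fun h => hx' h.1, Expr.subst_var,
      lookupV_append_of_mem (mem_keys_pairsR.2 ⟨rfl, hq⟩)]
    obtain ⟨j, hj, rfl⟩ := exists_getElem_of_mem_keys hq
    rw [lookupV_pairsR _ hY _ hj, lookupV_pairsR _ hY _ hj]
  · rw [renA_of_ne (hneX hx hp), Expr.subst_var, renB_self, Expr.subst_var,
      lookupV_append_of_notMem fun h => hy (mem_keys_pairsR.1 h).2]
    obtain ⟨i, hi, rfl⟩ := exists_getElem_of_mem_keys hp
    rw [lookupV_pairsL _ hX _ hi, lookupV_pairsL _ hX _ hi]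
    exact (gx i).subst_eq_self fun ⟨p, q⟩ ho =>
      lookupV_pairsR_of_notMem fun h => hneX hx' (hgx i hi p q ho) h.1

theorem TSo.substL_substL_pairsL (hX : (keys X).Nodup) (hY : (keys Y).Nodup)
    (hW : TSo TA TB false X x U Y y V W) (hx : x ∉ keys X) (hy : y ∉ keys Y)
    (hx' : x' ∉ keys X) (hy' : y' ∉ keys Y)
    (hgy : ∀ j < Y.length, ∀ p q, Occurs (A := A.tensor B) (p, q) (gy j) → q ∈ keys Y) :
    ((((W.subst (renA x x')).subst (renB y y')).substL (pairsR x' Y gy)).substL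
      (pairsL X y' gx)) = W.substL (pairsR x Y gy ++ pairsL X y gx) := by
  simp only [SortE.substL, SortE.subst_subst]
  refine SortE.subst_congr W ?_
  rintro ⟨p, q⟩ ho
  have hneX : ∀ {p z}, z ∉ keys X → p ∈ keys X → p ≠ z := fun hz hp h => hz (h ▸ hp)
  have hneY : ∀ {q z}, z ∉ keys Y → q ∈ keys Y → q ≠ z := fun hz hq h => hz (h ▸ hq)
  rcases hW.occurs ho with ⟨hp, hq⟩ | ⟨rfl, hq⟩ | ⟨hp, rfl⟩
  · rw [renA_of_ne (hneX hx hp), Expr.subst_var, renB_of_ne (hneY hy hq), Expr.subst_var,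
      lookupV_pairsR_of_notMem fun h => hneX hx' hp h.1, Expr.subst_var,
      lookupV_pairsL_of_notMem fun h => hneY hy' hq h.2,
      lookupV_append_of_notMem fun h => hneX hx hp (mem_keys_pairsR.1 h).1,
      lookupV_pairsL_of_notMem fun h => hneY hy hq h.2]
  · rw [renA_self, Expr.subst_var, renB_of_ne (hneY hy hq), Expr.subst_var,
      lookupV_append_of_mem (mem_keys_pairsR.2 ⟨rfl, hq⟩)]
    obtain ⟨j, hj, rfl⟩ := exists_getElem_of_mem_keys hq
    rw [lookupV_pairsR _ hY _ hj, lookupV_pairsR _ hY _ hj]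
    exact (gy j).subst_eq_self fun ⟨p, q⟩ ho =>
      lookupV_pairsL_of_notMem fun h => hneY hy' (hgy j hj p q ho) h.2
  · rw [renA_of_ne (hneX hx hp), Expr.subst_var, renB_self, Expr.subst_var,
      lookupV_pairsR_of_notMem fun h => hy' h.2, Expr.subst_var,
      lookupV_append_of_notMem fun h => hy (mem_keys_pairsR.1 h).2]
    obtain ⟨i, hi, rfl⟩ := exists_getElem_of_mem_keys hp
    rw [lookupV_pairsL _ hX _ hi, lookupV_pairsL _ hX _ hi]

theorem TSo.substL_pairsR_take (hX : x ∉ keys X) (hY : (keys Y).Nodup) {j : ℕ}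
    (hj : j < Y.length) (hW : TSo TA TB false X x U (Y.take j) y (Y[j]'hj).2 W)
    (hy : y ∉ keys (Y.take j))
    (hgy : ∀ k < j, ∀ p q, Occurs (A := A.tensor B) (p, q) (gy k) → q ∈ keys (Y.take j)) :
    (W.substL (pairsR x (Y.take j) gy)).subst (renB y (Y[j]'hj).1) =
      (W.subst (renB y (Y[j]'hj).1)).substL (pairsR x Y gy) := by
  simp only [SortE.substL, SortE.subst_subst]
  refine SortE.subst_congr W ?_
  rintro ⟨p, q⟩ ho
  have hneX : ∀ {p z}, z ∉ keys X → p ∈ keys X → p ≠ z := fun hz hp h => hz (h ▸ hp)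
  have hneY : ∀ {q}, q ∈ keys (Y.take j) → q ≠ y := fun hq h => hy (h ▸ hq)
  rcases hW.occurs ho with ⟨hp, hq⟩ | ⟨rfl, hq⟩ | ⟨hp, rfl⟩
  · rw [lookupV_pairsR_of_notMem fun h => hneX hX hp h.1, Expr.subst_var,
      renB_of_ne (hneY hq), Expr.subst_var,
      lookupV_pairsR_of_notMem fun h => hneX hX hp h.1]
  · rw [renB_of_ne (hneY hq), Expr.subst_var]
    obtain ⟨k, hk, rfl⟩ := exists_getElem_of_mem_keys hq
    rw [lookupV_pairsR _ (nodup_keys_take hY j) _ hk]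
    have hkj : k < j := by rw [List.length_take] at hk; omega
    simp only [List.getElem_take]
    rw [lookupV_pairsR _ hY _ (hkj.trans hj)]
    exact (gy k).subst_eq_self fun ⟨p, q⟩ ho => renB_of_ne (hneY (hgy k hkj p q ho)) _ _
  · rw [lookupV_pairsR_of_notMem fun h => hneX hX hp h.1, Expr.subst_var, renB_self,
      Expr.subst_var, lookupV_pairsR_of_notMem fun h => hneX hX hp h.1]

theorem TSo.substL_pairsL_take (hY : y ∉ keys Y) (hX : (keys X).Nodup) {i : ℕ}
    (hi : i < X.length) (hW : TSo TA TB false (X.take i) x (X[i]'hi).2 Y y V W)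
    (hx : x ∉ keys (X.take i))
    (hgx : ∀ k < i, ∀ p q, Occurs (A := A.tensor B) (p, q) (gx k) → p ∈ keys (X.take i)) :
    (W.substL (pairsL (X.take i) y gx)).subst (renA x (X[i]'hi).1) =
      (W.subst (renA x (X[i]'hi).1)).substL (pairsL X y gx) := by
  simp only [SortE.substL, SortE.subst_subst]
  refine SortE.subst_congr W ?_
  rintro ⟨p, q⟩ ho
  have hneX : ∀ {p}, p ∈ keys (X.take i) → p ≠ x := fun hp h => hx (h ▸ hp)
  have hneY : ∀ {q z}, z ∉ keys Y → q ∈ keys Y → q ≠ z := fun hz hq h => hz (h ▸ hq)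
  rcases hW.occurs ho with ⟨hp, hq⟩ | ⟨rfl, hq⟩ | ⟨hp, rfl⟩
  · rw [lookupV_pairsL_of_notMem fun h => hneY hY hq h.2, Expr.subst_var,
      renA_of_ne (hneX hp), Expr.subst_var,
      lookupV_pairsL_of_notMem fun h => hneY hY hq h.2]
  · rw [lookupV_pairsL_of_notMem fun h => hneY hY hq h.2, Expr.subst_var, renA_self,
      Expr.subst_var, lookupV_pairsL_of_notMem fun h => hneY hY hq h.2]
  · rw [renA_of_ne (hneX hp), Expr.subst_var]
    obtain ⟨k, hk, rfl⟩ := exists_getElem_of_mem_keys hp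
    rw [lookupV_pairsL _ (nodup_keys_take hX i) _ hk]
    have hki : k < i := by rw [List.length_take] at hk; omega
    simp only [List.getElem_take]
    rw [lookupV_pairsL _ hX _ (hki.trans hi)]
    exact (gx k).subst_eq_self fun ⟨p, q⟩ ho => renA_of_ne (hneX (hgx k hki p q ho)) _ _

end

/-! ### Tensors of pairs of terms -/

theorem Derivable.ht_pos {Ax : Set (Judg A)} {J : Judg A} (h : Derivable Ax J) :
    0 < ht Ax J :=
  Nat.pos_of_ne_zero fun h0 => by
    have := h.derAt_ht
    rw [h0] at this
    exact this

theorem ht_sort_lt {Ax : Set (Judg A)} {X : PreCtx A} {u : Expr A} {U : SortE A}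
    (h : Derivable Ax (.term X u U)) : ht Ax (.sort X U) < ht Ax (.term X u U) :=
  let ⟨_, hm, h⟩ := h.derAt_ht.sort_of_term
  h.ht_le.trans_lt hm

theorem ht_sort_take_lt {Ax : Set (Judg A)} {X : PreCtx A} {u : Expr A} {U : SortE A}
    (h : Derivable Ax (.term X u U)) {i : ℕ} (hi : i < X.length) :
    ht Ax (.sort (X.take i) (X[i]'hi).2) < ht Ax (.term X u U) :=
  let ⟨_, hm, h⟩ := h.derAt_ht.sort_of_term
  let ⟨_, hk, h⟩ := h.ctx_of_sort
  let ⟨_, hl, h⟩ := h.sort_of_ctx i hi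
  h.ht_le.trans_lt (hl.trans (hk.trans hm))

theorem mul_le_of_right_lt {p q r h : ℕ} (hp : 0 < p) (hr : r < q) (hpq : p * q ≤ h + 1) :
    p * r ≤ h :=
  Nat.le_of_lt_succ ((Nat.mul_lt_mul_of_pos_left hr hp).trans_le hpq)

theorem mul_le_of_left_lt {p q r h : ℕ} (hq : 0 < q) (hr : r < p) (hpq : p * q ≤ h + 1) :
    r * q ≤ h :=
  Nat.le_of_lt_succ ((Nat.mul_lt_mul_of_pos_right hr hq).trans_le hpq)

section
variable {chA : PreCtx A → A.Var} {chB : PreCtx B → B.Var} {h : ℕ}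
  {X : PreCtx A} {u : Expr A} {U : SortE A} {Y : PreCtx B} {v : Expr B} {V : SortE B}
  {Z : PreCtx (A.tensor B)} {W : SortE (A.tensor B)} {gx gy : ℕ → Expr (A.tensor B)}

theorem hDerivable.term_var (hA : IsGAT TA) (hB : IsGAT TB) (hchA : FreshCh chA)
    (hchB : FreshCh chB) (hder : hDerivable TA TB chA chB h)
    (hu : Derivable TA (.term X u U)) (hv : Derivable TB (.term Y v V))
    (hht : ht TA (.term X u U) * ht TB (.term Y v V) ≤ h + 1)
    (hZ : TCtx TA TB false X Y Z) (hZd : Derivable (tensorAx TA TB chA chB) (.ctx Z))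
    (hgy : ∀ j (hj : j < Y.length),
        TTg TA TB false ⟨X, u, U⟩ ⟨Y.take j, .var (Y[j]'hj).1, (Y[j]'hj).2⟩ (gy j))
    {j : ℕ} (hj : j < Y.length)
    (hW : TSo TA TB false X (chA X) U (Y.take j) (Y[j]'hj).1 (Y[j]'hj).2 W) :
    Derivable (tensorAx TA TB chA chB)
      (.term Z (gy j) (W.substL (pairsR (chA X) Y gy))) := by
  have hS := tensorAx_shaped hA.shaped hB.shaped chA chB
  have hX := (hu.scoped hA.shaped).1.2
  have hY := (hv.scoped hB.shaped).1.2
  have hs := hv.ctx_of_term.sort_of_ctx hj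
  obtain ⟨Z', hZ'⟩ := TCtx.exists hA hB hu.ctx_of_term (hs.ctx_append hB.shaped (hchB _))
  obtain ⟨e, he⟩ := TTg.exists hA hB (a := ⟨X, u, U⟩)
    (c := ⟨Y.take j, .var (chB (Y.take j)), (Y[j]'hj).2⟩)
    (.inl hu.derAt_ht) (.inr ⟨⟨_, rfl⟩, hs.derAt_ht⟩)
  obtain ⟨W', hW'⟩ := TSo.exists hA hB (x := chA X) (y := chB (Y.take j))
    ((DerAt.sort_of_term hu.derAt_ht).choose_spec.2.derivable) hs (hchA _) (hchB _)
  have hgy' : ∀ k (hk : k < (Y.take j).length), TTg TA TB false ⟨X, u, U⟩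
      ⟨(Y.take j).take k, .var ((Y.take j)[k]'hk).1, ((Y.take j)[k]'hk).2⟩ (gy k) := by
    intro k hk
    have hkj : k < j := by rw [List.length_take] at hk; omega
    simp only [List.take_take, Nat.min_eq_left hkj.le, List.getElem_take]
    exact hgy k _
  have hd := hder _ _ _ hu hs
    (mul_le_of_right_lt hu.ht_pos (ht_sort_take_lt hv hj) hht) (.ts hZ' he hW' hgy')
  obtain ⟨n, hd⟩ := hd
  have := hd.substitutive hS _ _
    (hZ.fMor_renB hA hB hS hX hY hZd hj (hchB _) hZ')
  rw [hW'.substL_pairsR_take (notMem_keys (hchA X)) hY hj (notMem_keys (hchB _))] at this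
  · rwa [(he.renameB (notMem_keys (hchB _)) _).unique hA hB hX (nodup_keys_take hY j) (hgy j hj),
      (hW'.renameB (getElem_fresh_take hY hj)).unique hA hB hX (nodup_keys_take hY j) hW] at this
  · intro k hk p q ho
    exact ((hgy' k (by rw [List.length_take]; omega)).occurs ho).2.of_take

theorem hDerivable.var_term (hA : IsGAT TA) (hB : IsGAT TB) (hchA : FreshCh chA)
    (hchB : FreshCh chB) (hder : hDerivable TA TB chA chB h)
    (hu : Derivable TA (.term X u U)) (hv : Derivable TB (.term Y v V))
    (hht : ht TA (.term X u U) * ht TB (.term Y v V) ≤ h + 1)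
    (hZ : TCtx TA TB false X Y Z) (hZd : Derivable (tensorAx TA TB chA chB) (.ctx Z))
    (hgx : ∀ i (hi : i < X.length),
        TTg TA TB false ⟨X.take i, .var (X[i]'hi).1, (X[i]'hi).2⟩ ⟨Y, v, V⟩ (gx i))
    {i : ℕ} (hi : i < X.length)
    (hW : TSo TA TB false (X.take i) (X[i]'hi).1 (X[i]'hi).2 Y (chB Y) V W) :
    Derivable (tensorAx TA TB chA chB)
      (.term Z (gx i) (W.substL (pairsL X (chB Y) gx))) := by
  have hS := tensorAx_shaped hA.shaped hB.shaped chA chB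
  have hX := (hu.scoped hA.shaped).1.2
  have hY := (hv.scoped hB.shaped).1.2
  have hs := hu.ctx_of_term.sort_of_ctx hi
  obtain ⟨Z', hZ'⟩ := TCtx.exists hA hB (hs.ctx_append hA.shaped (hchA _)) hv.ctx_of_term
  obtain ⟨e, he⟩ := TTg.exists hA hB (c := ⟨Y, v, V⟩)
    (a := ⟨X.take i, .var (chA (X.take i)), (X[i]'hi).2⟩)
    (.inr ⟨⟨_, rfl⟩, hs.derAt_ht⟩) (.inl hv.derAt_ht)
  obtain ⟨W', hW'⟩ := TSo.exists hA hB (x := chA (X.take i)) (y := chB Y) hs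
    ((DerAt.sort_of_term hv.derAt_ht).choose_spec.2.derivable) (hchA _) (hchB _)
  have hgx' : ∀ k (hk : k < (X.take i).length), TTg TA TB false
      ⟨(X.take i).take k, .var ((X.take i)[k]'hk).1, ((X.take i)[k]'hk).2⟩ ⟨Y, v, V⟩ (gx k) := by
    intro k hk
    have hki : k < i := by rw [List.length_take] at hk; omega
    simp only [List.take_take, Nat.min_eq_left hki.le, List.getElem_take]
    exact hgx k _
  have hd := hder _ _ _ hs hv
    (mul_le_of_left_lt hv.ht_pos (ht_sort_take_lt hu hi) hht) (.st hZ' he hW' hgx')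
  obtain ⟨n, hd⟩ := hd
  have := hd.substitutive hS _ _
    (hZ.fMor_renA hA hB hS hX hY hZd hi (hchA _) hZ')
  rw [hW'.substL_pairsL_take (notMem_keys (hchB Y)) hX hi (notMem_keys (hchA _))] at this
  · rwa [(he.renameA (notMem_keys (hchA _)) _).unique hA hB (nodup_keys_take hX i) hY (hgx i hi),
      (hW'.renameA (getElem_fresh_take hX hi)).unique hA hB (nodup_keys_take hX i) hY hW] at this
  · intro k hk p q ho
    exact ((hgx' k (by rw [List.length_take]; omega)).occurs ho).1.of_take

/-- The tensor `X ⊗ Y` is a context, and the term obtained from `x^U ⊗ v^V` by substituting the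
`u^U ⊗ yⱼ` is derivable. -/
theorem hDerivable.ctx_and_term_pairsR (hA : IsGAT TA) (hB : IsGAT TB) (hchA : FreshCh chA)
    (hchB : FreshCh chB) (hder : hDerivable TA TB chA chB h)
    (hu : Derivable TA (.term X u U)) (hv : Derivable TB (.term Y v V))
    (hht : ht TA (.term X u U) * ht TB (.term Y v V) ≤ h + 1)
    (hZ : TCtx TA TB false X Y Z)
    {e : Expr (A.tensor B)} (he : TTg TA TB false ⟨X, .var (chA X), U⟩ ⟨Y, v, V⟩ e)
    (hW : TSo TA TB false X (chA X) U Y (chB Y) V W)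
    (hgx : ∀ i (hi : i < X.length),
        TTg TA TB false ⟨X.take i, .var (X[i]'hi).1, (X[i]'hi).2⟩ ⟨Y, v, V⟩ (gx i))
    (hgy : ∀ j (hj : j < Y.length),
        TTg TA TB false ⟨X, u, U⟩ ⟨Y.take j, .var (Y[j]'hj).1, (Y[j]'hj).2⟩ (gy j)) :
    Derivable (tensorAx TA TB chA chB) (.ctx Z) ∧
    Derivable (tensorAx TA TB chA chB) (.term Z (e.substL (pairsR (chA X) Y gy))
      ((W.substL (pairsL X (chB Y) gx)).substL (pairsR (chA X) Y gy))) := by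
  have hS := tensorAx_shaped hA.shaped hB.shaped chA chB
  have hX := (hu.scoped hA.shaped).1.2
  have hY := (hv.scoped hB.shaped).1.2
  have hs := (DerAt.sort_of_term hu.derAt_ht).choose_spec.2.derivable
  obtain ⟨Z', hZ'⟩ := TCtx.exists hA hB (hs.ctx_append hA.shaped (hchA _)) hv.ctx_of_term
  have hd := hder _ _ _ hs hv
    (mul_le_of_left_lt hv.ht_pos (ht_sort_lt hu) hht) (.st hZ' he hW hgx)
  have hZd : Derivable (tensorAx TA TB chA chB) (.ctx Z) := by
    rw [hZ.unique hA hB hX hY hZ'.take]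
    exact ((DerAt.ctx_take hd.ctx_of_term.derAt_ht) _).derivable
  obtain ⟨n, hd⟩ := hd
  exact ⟨hZd, hd.substitutive hS _ _ (hZ.fMor_pairsR hA hB hS hX hY hZd (hchA X) hZ'
    fun j hj W hW => hder.term_var hA hB hchA hchB hu hv hht hZ hZd hgy hj hW)⟩

/-- The term obtained from `u^U ⊗ y^V` by substituting the `xᵢ ⊗ v^V` is derivable. -/
theorem hDerivable.term_pairsL (hA : IsGAT TA) (hB : IsGAT TB) (hchA : FreshCh chA)
    (hchB : FreshCh chB) (hder : hDerivable TA TB chA chB h)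
    (hu : Derivable TA (.term X u U)) (hv : Derivable TB (.term Y v V))
    (hht : ht TA (.term X u U) * ht TB (.term Y v V) ≤ h + 1)
    (hZ : TCtx TA TB false X Y Z) (hZd : Derivable (tensorAx TA TB chA chB) (.ctx Z))
    {e : Expr (A.tensor B)} (he : TTg TA TB false ⟨X, u, U⟩ ⟨Y, .var (chB Y), V⟩ e)
    (hW : TSo TA TB false X (chA X) U Y (chB Y) V W)
    (hgx : ∀ i (hi : i < X.length),
        TTg TA TB false ⟨X.take i, .var (X[i]'hi).1, (X[i]'hi).2⟩ ⟨Y, v, V⟩ (gx i))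
    (hgy : ∀ j (hj : j < Y.length),
        TTg TA TB false ⟨X, u, U⟩ ⟨Y.take j, .var (Y[j]'hj).1, (Y[j]'hj).2⟩ (gy j)) :
    Derivable (tensorAx TA TB chA chB) (.term Z (e.substL (pairsL X (chB Y) gx))
      ((W.substL (pairsR (chA X) Y gy)).substL (pairsL X (chB Y) gx))) := by
  have hS := tensorAx_shaped hA.shaped hB.shaped chA chB
  have hX := (hu.scoped hA.shaped).1.2
  have hY := (hv.scoped hB.shaped).1.2
  have hs := (DerAt.sort_of_term hv.derAt_ht).choose_spec.2.derivable
  obtain ⟨Z', hZ'⟩ := TCtx.exists hA hB hu.ctx_of_term (hs.ctx_append hB.shaped (hchB _))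
  obtain ⟨n, hd⟩ := hder _ _ _ hu hs
    (mul_le_of_right_lt hu.ht_pos (ht_sort_lt hv) hht) (.ts hZ' he hW hgy)
  exact hd.substitutive hS _ _ (hZ.fMor_pairsL hA hB hS hX hY hZd (hchB Y) hZ'
    fun i hi W hW => hder.var_term hA hB hchA hchB hu hv hht hZ hZd hgx hi hW)

theorem TTg.eq_substL_pairsR (hA : IsGAT TA) (hB : IsGAT TB) (hX : (keys X).Nodup)
    (hY : (keys Y).Nodup) (hv : ScopedE Y v) {x x' : A.Var} (hx : x ∉ keys X) (hx' : x' ∉ keys X)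
    {e : Expr (A.tensor B)}
    (he : TTg TA TB false ⟨X, .var x, U⟩ ⟨Y, v, V⟩ e) {gy' : ℕ → Expr (A.tensor B)}
    (hgy : ∀ j (hj : j < Y.length),
        TTg TA TB false ⟨X, u, U⟩ ⟨Y.take j, .var (Y[j]'hj).1, (Y[j]'hj).2⟩ (gy j))
    (hgy' : ∀ j (hj : j < Y.length),
        TTg TA TB false ⟨X, u, U⟩ ⟨Y.take j, .var (Y[j]'hj).1, (Y[j]'hj).2⟩ (gy' j)) :
    (e.subst (renA x x')).substL (pairsR x' Y gy) = e.substL (pairsR x Y gy') := by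
  rw [Expr.substL, Expr.substL, Expr.subst_subst]
  refine e.subst_congr ?_
  rintro ⟨p, q⟩ ho
  obtain ⟨hp, hq⟩ := he.occurs ho
  have hq := hq.of_scopedE hv
  by_cases hpx : p = x
  · subst hpx
    rw [renA_self, Expr.subst_var]
    obtain ⟨j, hj, rfl⟩ := exists_getElem_of_mem_keys hq
    rw [lookupV_pairsR _ hY _ hj, lookupV_pairsR _ hY _ hj]
    exact (hgy j hj).unique hA hB hX (nodup_keys_take hY j) (hgy' j hj)
  · have hp : p ∈ keys X := hp.resolve_right fun h => hpx (by cases h; rfl)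
    rw [renA_of_ne hpx, Expr.subst_var,
      lookupV_pairsR_of_notMem fun h => hx' ((h.1 : p = x') ▸ hp),
      lookupV_pairsR_of_notMem fun h => hpx h.1]

theorem TTg.eq_substL_pairsL (hA : IsGAT TA) (hB : IsGAT TB) (hX : (keys X).Nodup)
    (hY : (keys Y).Nodup) (hu : ScopedE X u) {y y' : B.Var} (hy : y ∉ keys Y) (hy' : y' ∉ keys Y)
    {e : Expr (A.tensor B)}
    (he : TTg TA TB false ⟨X, u, U⟩ ⟨Y, .var y, V⟩ e) {gx' : ℕ → Expr (A.tensor B)}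
    (hgx : ∀ i (hi : i < X.length),
        TTg TA TB false ⟨X.take i, .var (X[i]'hi).1, (X[i]'hi).2⟩ ⟨Y, v, V⟩ (gx i))
    (hgx' : ∀ i (hi : i < X.length),
        TTg TA TB false ⟨X.take i, .var (X[i]'hi).1, (X[i]'hi).2⟩ ⟨Y, v, V⟩ (gx' i)) :
    (e.subst (renB y y')).substL (pairsL X y' gx) = e.substL (pairsL X y gx') := by
  rw [Expr.substL, Expr.substL, Expr.subst_subst]
  refine e.subst_congr ?_
  rintro ⟨p, q⟩ ho
  obtain ⟨hp, hq⟩ := he.occurs ho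
  have hp := hp.of_scopedE hu
  by_cases hqy : q = y
  · subst hqy
    rw [renB_self, Expr.subst_var]
    obtain ⟨i, hi, rfl⟩ := exists_getElem_of_mem_keys hp
    rw [lookupV_pairsL _ hX _ hi, lookupV_pairsL _ hX _ hi]
    exact (hgx i hi).unique hA hB (nodup_keys_take hX i) hY (hgx' i hi)
  · have hq : q ∈ keys Y := hq.resolve_right fun h => hqy (by cases h; rfl)
    rw [renB_of_ne hqy, Expr.subst_var,
      lookupV_pairsL_of_notMem fun h => hy' ((h.2 : q = y') ▸ hq),
      lookupV_pairsL_of_notMem fun h => hqy h.2]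

/-- A tensor with a variable of the context arises by substituting into the tensor with a fresh
variable. -/
theorem TTg.var_substL_pairsR (hA : IsGAT TA) (hB : IsGAT TB) (hX : (keys X).Nodup)
    (hY : (keys Y).Nodup) (hv : ScopedE Y v) {x x' : A.Var} (hx' : x' ∉ keys X)
    {e e' : Expr (A.tensor B)}
    (he' : TTg TA TB false ⟨X, .var x', U⟩ ⟨Y, v, V⟩ e')
    (he : TTg TA TB false ⟨X, .var x, U⟩ ⟨Y, v, V⟩ e)
    (hgy : ∀ j (hj : j < Y.length), TTg TA TB false ⟨X, .var x, U⟩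
        ⟨Y.take j, .var (Y[j]'hj).1, (Y[j]'hj).2⟩ (gy j)) :
    e'.substL (pairsR x' Y gy) = e := by
  rw [← (he'.renameA hx' x).unique hA hB hX hY he]
  refine e'.subst_congr ?_
  rintro ⟨p, q⟩ ho
  by_cases hp : p = x'
  · subst hp
    obtain ⟨j, hj, rfl⟩ := exists_getElem_of_mem_keys ((he'.occurs ho).2.of_scopedE hv)
    rw [lookupV_pairsR _ hY _ hj, renA_self]
    exact (hgy j hj).eq_var rfl rfl
  · rw [lookupV_pairsR_of_notMem fun h => hp h.1, renA_of_ne hp]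

theorem TTg.var_substL_pairsL (hA : IsGAT TA) (hB : IsGAT TB) (hX : (keys X).Nodup)
    (hY : (keys Y).Nodup) (hu : ScopedE X u) {y y' : B.Var} (hy' : y' ∉ keys Y)
    {e e' : Expr (A.tensor B)}
    (he' : TTg TA TB false ⟨X, u, U⟩ ⟨Y, .var y', V⟩ e')
    (he : TTg TA TB false ⟨X, u, U⟩ ⟨Y, .var y, V⟩ e)
    (hgx : ∀ i (hi : i < X.length), TTg TA TB false
        ⟨X.take i, .var (X[i]'hi).1, (X[i]'hi).2⟩ ⟨Y, .var y, V⟩ (gx i)) :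
    e'.substL (pairsL X y' gx) = e := by
  rw [← (he'.renameB hy' y).unique hA hB hX hY he]
  refine e'.subst_congr ?_
  rintro ⟨p, q⟩ ho
  by_cases hq : q = y'
  · subst hq
    obtain ⟨i, hi, rfl⟩ := exists_getElem_of_mem_keys ((he'.occurs ho).1.of_scopedE hu)
    rw [lookupV_pairsL _ hX _ hi, renB_self]
    exact (hgx i hi).eq_var rfl rfl
  · rw [lookupV_pairsL_of_notMem fun h => hq h.2, renB_of_ne hq]

end

end

/-- Suppose `(𝔸,𝔹)` is `h`-derivable, and let `X ⊢ u : U`,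
`Y ⊢ v : V` be derivable with `ht(X ⊢ u:U) · ht(Y ⊢ v:V) ≤ h+1`.  Then, for
variables `x`, `y` not occurring in `X`, `Y` and `σ` the simultaneous
substitution `[u^U ⊗ yⱼ^{Yⱼ} | xyⱼ, xᵢ^{Xᵢ} ⊗ v^V | xᵢy]`, the judgments
`X⊗Y ⊢ u^U ⊗ v^V : (U ⊗ V)σ` and `X⊗Y ⊢ u^U ● v^V : (U ⊗ V)σ` are derivable in
`𝔸⊗𝔹`. -/
theorem term_from_pair_of_terms
    (A B : Alphabet) (TA : Set (Judg A)) (TB : Set (Judg B))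
    (hA : IsGAT TA) (hB : IsGAT TB)
    (chA : PreCtx A → A.Var) (hchA : FreshCh chA)
    (chB : PreCtx B → B.Var) (hchB : FreshCh chB)
    (h : ℕ) (hder : hDerivable TA TB chA chB h)
    (X : PreCtx A) (u : Expr A) (U : SortE A)
    (Y : PreCtx B) (v : Expr B) (V : SortE B)
    (hu : Derivable TA (.term X u U)) (hv : Derivable TB (.term Y v V))
    (hht : ht TA (.term X u U) * ht TB (.term Y v V) ≤ h + 1)
    (x : A.Var) (hx : ∀ p ∈ X, p.1 ≠ x) (y : B.Var) (hy : ∀ p ∈ Y, p.1 ≠ y)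
    (W : SortE (A.tensor B)) (hW : TSo TA TB false X x U Y y V W)
    (ZXY : PreCtx (A.tensor B)) (hZ : TCtx TA TB false X Y ZXY)
    (e1 e2 : Expr (A.tensor B))
    (he1 : TTg TA TB false ⟨X, u, U⟩ ⟨Y, v, V⟩ e1)
    (he2 : TTd TA TB false ⟨X, u, U⟩ ⟨Y, v, V⟩ e2)
    (gx gy : ℕ → Expr (A.tensor B))
    (hgx : ∀ i (hi : i < X.length),
        TTg TA TB false ⟨X.take i, .var (X[i]'hi).1, (X[i]'hi).2⟩ ⟨Y, v, V⟩ (gx i))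
    (hgy : ∀ j (hj : j < Y.length),
        TTg TA TB false ⟨X, u, U⟩ ⟨Y.take j, .var (Y[j]'hj).1, (Y[j]'hj).2⟩ (gy j)) :
    Derivable (tensorAx TA TB chA chB)
      (.term ZXY e1 (W.substL (pairsR x Y gy ++ pairsL X y gx))) ∧
    Derivable (tensorAx TA TB chA chB)
      (.term ZXY e2 (W.substL (pairsR x Y gy ++ pairsL X y gx))) := by
  obtain ⟨⟨-, hX⟩, hu', -⟩ := hu.scoped hA.shaped
  obtain ⟨⟨-, hY⟩, hv', -⟩ := hv.scoped hB.shaped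
  have hus := (DerAt.sort_of_term hu.derAt_ht).choose_spec.2
  have hvs := (DerAt.sort_of_term hv.derAt_ht).choose_spec.2
  have hx := notMem_keys hx
  have hy := notMem_keys hy
  have hxA := notMem_keys (hchA X)
  have hyB := notMem_keys (hchB Y)
  have hW' := (hW.renameA (hchA X)).renameB (hchB Y)
  have hsR := hW.substL_substL_pairsR (gy := gy) hX hY hx hy hxA hyB
    fun i hi _ _ ho => ((hgx i hi).occurs ho).1.of_take
  have hsL := hW.substL_substL_pairsL (gx := gx) hX hY hx hy hxA hyB
    fun j hj _ _ ho => ((hgy j hj).occurs ho).2.of_take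
  obtain ⟨eA, heA⟩ := TTg.exists hA hB (a := ⟨X, .var (chA X), U⟩) (c := ⟨Y, v, V⟩)
    (.inr ⟨⟨_, rfl⟩, hus⟩) (.inl hv.derAt_ht)
  obtain ⟨eB, heB⟩ := TTg.exists hA hB (a := ⟨X, u, U⟩) (c := ⟨Y, .var (chB Y), V⟩)
    (.inl hu.derAt_ht) (.inr ⟨⟨_, rfl⟩, hvs⟩)
  obtain ⟨hZd, hR⟩ := hder.ctx_and_term_pairsR hA hB hchA hchB hu hv hht hZ heA hW' hgx hgy
  have hL := hder.term_pairsL hA hB hchA hchB hu hv hht hZ hZd heB hW' hgx hgy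
  rw [hsR] at hR
  rw [hsL] at hL
  have key : ∀ e, TTg TA TB false ⟨X, u, U⟩ ⟨Y, v, V⟩ e →
      e = eA.substL (pairsR (chA X) Y gy) ∨ e = eB.substL (pairsL X (chB Y) gx) := by
    intro e he
    cases u with
    | var x₀ => exact .inl (heA.var_substL_pairsR hA hB hX hY hv' hxA he hgy).symm
    | app s ss =>
      cases v with
      | var y₀ => exact .inr (heB.var_substL_pairsL hA hB hX hY hu' hyB he hgx).symm
      | app t ts =>
        cases he with
        | @appapp_base _ _ _ _ _ _ _ _ x₁ hx₁ e₀ h₀ g hg =>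
          have hx₁ := notMem_keys hx₁
          rw [← h₀.eq_substL_pairsR hA hB hX hY hv' hx₁ hxA hgy hg,
            (h₀.renameA hx₁ _).unique hA hB hX hY heA]
          exact .inl rfl
  have key' : ∀ e, e = eA.substL (pairsR (chA X) Y gy) ∨ e = eB.substL (pairsL X (chB Y) gx) →
      Derivable (tensorAx TA TB chA chB)
        (.term ZXY e (W.substL (pairsR x Y gy ++ pairsL X y gx))) := by
    rintro e (rfl | rfl)
    · exact hR
    · exact hL
  refine ⟨key' _ (key _ he1), ?_⟩
  cases he2 with
  | varL he => exact key' _ (key _ he)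
  | varR he => exact key' _ (key _ he)
  | @appapp_base _ _ _ _ _ _ _ _ y₁ hy₁ e₀ h₀ g hg =>
    have hy₁ := notMem_keys hy₁
    rw [← h₀.eq_substL_pairsL hA hB hX hY hu' hy₁ hyB hgx hg,
      (h₀.renameB hy₁ _).unique hA hB hX hY heB]
    exact hL

end GATPaper
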